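/- Two plane curve singularities that are right-equivalent to first order are right-equivalent. Precisely: let f, g : ℂ² → ℂ be analytic at 0 with f(0) = g(0) = 0, and suppose there exist φ : ℂ² → ℂ² analytic at 0 with φ(0) = 0 and invertible derivative at 0, and ψ : ℂ → ℂ analytic at 0 with ψ(0) = 0 and ψ'(0) = 1, such that g(φ(z)) = ψ(f(z)) for all z in some neighborhood of 0 in ℂ². Then there exists Φ : ℂ² → ℂ² analytic at 0 with Φ(0) = 0 and invertible derivative at 0 such that g(Φ(z)) = f(z) for all z in some neighborhood of 0 in ℂ². (Theorem 5.2 'Geburtszange'.) -/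

import Mathlib

namespace PlaneGerm

open Filter Topology Metric Set

section Superposition

variable {K V W : Type*} [TopologicalSpace K] [CompactSpace K]
  [NormedAddCommGroup V] [NormedSpace ℂ V] [NormedAddCommGroup W] [NormedSpace ℂ W]

/-- A continuous multilinear map acts pointwise on continuous functions. -/
noncomputable def pointwiseMultilinear {n : ℕ} (p : V [×n]→L[ℂ] W) :
    C(K, V) [×n]→L[ℂ] C(K, W) :=
  MultilinearMap.mkContinuous
    { toFun := fun γ => ⟨fun k => p fun i => γ i k, by fun_prop⟩
      map_update_add' := by
        intro _ γ i x y
        ext k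
        have h : ∀ z : C(K, V), (fun j => (Function.update γ i z) j k)
            = Function.update (fun j => γ j k) i (z k) := by
          intro z; ext j; by_cases hj : j = i
          · subst hj; simp
          · simp [hj]
        simp only [ContinuousMap.coe_mk, ContinuousMap.add_apply]
        convert p.map_update_add (fun j => γ j k) i (x k) (y k) using 1
        · exact congrArg p (h (x + y))
        · exact congrArg₂ _ (congrArg p (h x)) (congrArg p (h y))
      map_update_smul' := by
        intro _ γ i c x
        ext k
        have h : ∀ z : C(K, V), (fun j => (Function.update γ i z) j k)
            = Function.update (fun j => γ j k) i (z k) := by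
          intro z; ext j; by_cases hj : j = i
          · subst hj; simp
          · simp [hj]
        simp only [ContinuousMap.coe_mk, ContinuousMap.smul_apply]
        convert p.map_update_smul (fun j => γ j k) i c (x k) using 1
        · exact congrArg p (h (c • x))
        · exact congrArg _ (congrArg p (h x)) }
    ‖p‖ (by
      intro γ
      refine (ContinuousMap.norm_le _ (by positivity)).2 fun k => ?_
      refine (p.le_opNorm _).trans ?_
      gcongr with i
      exact (γ i).norm_coe_le_norm k)

@[simp] lemma pointwiseMultilinear_apply {n : ℕ} (p : V [×n]→L[ℂ] W) (γ : Fin n → C(K, V))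
    (k : K) : pointwiseMultilinear p γ k = p fun i => γ i k := rfl

lemma norm_pointwiseMultilinear_le {n : ℕ} (p : V [×n]→L[ℂ] W) :
    ‖pointwiseMultilinear (K := K) p‖ ≤ ‖p‖ :=
  MultilinearMap.mkContinuous_norm_le _ (norm_nonneg _) _

/-- The superposition operator of an analytic germ is analytic on continuous functions. -/
lemma exists_analytic_superposition {V W : Type*} [NormedAddCommGroup V] [NormedSpace ℂ V]
    [NormedAddCommGroup W] [NormedSpace ℂ W] [CompleteSpace W] {f : V → W}
    (hf : AnalyticAt ℂ f 0) :
    ∃ R > 0, AnalyticOnNhd ℂ f (ball 0 R) ∧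
      ∀ (K : Type) [TopologicalSpace K] [CompactSpace K],
      ∃ N : C(K, V) → C(K, W), AnalyticOnNhd ℂ N (ball 0 R) ∧
        ∀ γ ∈ ball (0 : C(K, V)) R, ∀ k, N γ k = f (γ k) := by
  obtain ⟨p, r, hp⟩ := hf
  obtain ⟨R, hR, hRr⟩ : ∃ R : ℝ, 0 < R ∧ ENNReal.ofReal R ≤ r := by
    rcases eq_or_ne r ⊤ with h | h
    · exact ⟨1, one_pos, by simp [h]⟩
    · exact ⟨r.toReal, ENNReal.toReal_pos hp.r_pos.ne' h, by rw [ENNReal.ofReal_toReal h]⟩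
  have hfa : AnalyticOnNhd ℂ f (ball 0 R) := by
    intro x hx
    rw [← Metric.eball_ofReal] at hx
    exact hp.analyticOnNhd x (Metric.eball_subset_eball hRr hx)
  refine ⟨R, hR, hfa, fun K _ _ => ?_⟩
  let P : FormalMultilinearSeries ℂ C(K, V) C(K, W) := fun n => pointwiseMultilinear (p n)
  have hrad : p.radius ≤ P.radius :=
    FormalMultilinearSeries.radius_le_of_le fun n => norm_pointwiseMultilinear_le (p n)
  have hpos : 0 < P.radius := hp.radius_pos.trans_le hrad
  have hS := P.hasFPowerSeriesOnBall hpos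
  have hsub : ∀ γ ∈ ball (0 : C(K, V)) R, γ ∈ eball (0 : C(K, V)) P.radius := by
    intro γ hγ
    rw [← Metric.eball_ofReal] at hγ
    exact Metric.eball_subset_eball ((hRr.trans hp.r_le).trans hrad) hγ
  refine ⟨P.sum, fun γ hγ => hS.analyticOnNhd γ (hsub γ hγ), fun γ hγ k => ?_⟩
  have h1 := hS.hasSum (hsub γ hγ)
  have h2 := h1.map (ContinuousMap.evalCLM ℂ k : C(K, W) →L[ℂ] W)
    (ContinuousMap.evalCLM ℂ k : C(K, W) →L[ℂ] W).continuous
  have hk : γ k ∈ eball (0 : V) r := by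
    refine Metric.eball_subset_eball hRr ?_
    rw [Metric.eball_ofReal, mem_ball_zero_iff]
    exact (γ.norm_coe_le_norm k).trans_lt (mem_ball_zero_iff.1 hγ)
  have h3 := hp.hasSum hk
  rw [zero_add] at h1 h2 h3
  exact h2.unique h3

end Superposition

/-- Extension by zero of a function on a closed disc. -/
noncomputable def discExt (r : ℝ) (h : C(closedBall (0 : ℂ) r, ℂ)) (z : ℂ) : ℂ :=
  open Classical in if hz : z ∈ closedBall (0 : ℂ) r then h ⟨z, hz⟩ else 0

lemma discExt_of_mem {r : ℝ} (h : C(closedBall (0 : ℂ) r, ℂ)) {z : ℂ}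
    (hz : z ∈ closedBall (0 : ℂ) r) : discExt r h z = h ⟨z, hz⟩ := dif_pos hz

/-- Continuous functions on a closed disc that are holomorphic in its interior. -/
noncomputable def discAlgebra (r : ℝ) : Subalgebra ℂ C(closedBall (0 : ℂ) r, ℂ) where
  carrier := {h | DifferentiableOn ℂ (discExt r h) (ball 0 r)}
  mul_mem' := by
    intro a b ha hb
    refine (DifferentiableOn.mul ha hb).congr fun z hz => ?_
    simp [discExt_of_mem _ (ball_subset_closedBall hz)]
  add_mem' := by
    intro a b ha hb
    refine (DifferentiableOn.add ha hb).congr fun z hz => ?_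
    simp [discExt_of_mem _ (ball_subset_closedBall hz)]
  algebraMap_mem' := by
    intro c
    refine (differentiableOn_const c).congr fun z hz => ?_
    simp [discExt_of_mem _ (ball_subset_closedBall hz)]

lemma isClosed_discAlgebra (r : ℝ) :
    IsClosed (discAlgebra r : Set C(closedBall (0 : ℂ) r, ℂ)) := by
  refine isClosed_of_closure_subset fun h hh => ?_
  obtain ⟨u, hu, hlim⟩ := mem_closure_iff_seq_limit.1 hh
  have hunif := (ContinuousMap.tendsto_iff_tendstoUniformly.1 hlim)
  have : TendstoUniformlyOn (fun n => discExt r (u n)) (discExt r h) atTop (ball 0 r) := by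
    rw [Metric.tendstoUniformlyOn_iff]
    intro ε hε
    filter_upwards [Metric.tendstoUniformly_iff.1 hunif ε hε] with n hn z hz
    simpa [discExt_of_mem _ (ball_subset_closedBall hz)] using
      hn ⟨z, ball_subset_closedBall hz⟩
  exact this.tendstoLocallyUniformlyOn.differentiableOn
    (Eventually.of_forall fun n => hu n) isOpen_ball

/-- The disc algebra as a type of its own. -/
def DiscAlg (r : ℝ) : Type := discAlgebra r

noncomputable instance (r : ℝ) : NormedCommRing (DiscAlg r) :=
  inferInstanceAs (NormedCommRing (discAlgebra r))

noncomputable instance (r : ℝ) : NormedAlgebra ℂ (DiscAlg r) :=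
  inferInstanceAs (NormedAlgebra ℂ (discAlgebra r))

instance (r : ℝ) : CompleteSpace (DiscAlg r) :=
  (isClosed_discAlgebra r).completeSpace_coe

/-- The inclusion of the disc algebra into the continuous functions. -/
noncomputable def discIncl (r : ℝ) : DiscAlg r →ₐ[ℂ] C(closedBall (0 : ℂ) r, ℂ) :=
  (discAlgebra r).val

lemma discIncl_injective (r : ℝ) : Function.Injective (discIncl r) := Subtype.val_injective

/-- Evaluation of an element of the disc algebra. -/
noncomputable def dev {r : ℝ} (h : DiscAlg r) (z : ℂ) : ℂ := discExt r (discIncl r h) z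

section DiscAlgebra

variable {r : ℝ}

lemma dev_eq (h : DiscAlg r) {z : ℂ} (hz : z ∈ closedBall (0 : ℂ) r) :
    dev h z = discIncl r h ⟨z, hz⟩ := discExt_of_mem _ hz

lemma dev_add (a b : DiscAlg r) {z : ℂ} (hz : z ∈ closedBall (0 : ℂ) r) :
    dev (a + b) z = dev a z + dev b z := by simp [dev_eq _ hz]

lemma dev_sub (a b : DiscAlg r) {z : ℂ} (hz : z ∈ closedBall (0 : ℂ) r) :
    dev (a - b) z = dev a z - dev b z := by
  have h := dev_add (a - b) b hz
  rw [sub_add_cancel] at h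
  rw [h, add_sub_cancel_right]

lemma dev_mul (a b : DiscAlg r) {z : ℂ} (hz : z ∈ closedBall (0 : ℂ) r) :
    dev (a * b) z = dev a z * dev b z := by simp [dev_eq _ hz]

lemma dev_smul (c : ℂ) (a : DiscAlg r) {z : ℂ} (hz : z ∈ closedBall (0 : ℂ) r) :
    dev (c • a) z = c * dev a z := by simp [dev_eq _ hz]

lemma dev_one {z : ℂ} (hz : z ∈ closedBall (0 : ℂ) r) :
    dev (1 : DiscAlg r) z = 1 := by simp [dev_eq _ hz]

lemma dev_pow (a : DiscAlg r) (n : ℕ) {z : ℂ} (hz : z ∈ closedBall (0 : ℂ) r) :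
    dev (a ^ n) z = dev a z ^ n := by simp [dev_eq _ hz]

lemma dev_sum {ι : Type*} (s : Finset ι) (a : ι → DiscAlg r) {z : ℂ}
    (hz : z ∈ closedBall (0 : ℂ) r) : dev (∑ i ∈ s, a i) z = ∑ i ∈ s, dev (a i) z := by
  classical
  induction s using Finset.induction_on with
  | empty => simp [dev_eq _ hz]
  | insert i s hi ih => rw [Finset.sum_insert hi, Finset.sum_insert hi, dev_add _ _ hz, ih]

lemma norm_dev_le (a : DiscAlg r) {z : ℂ} (hz : z ∈ closedBall (0 : ℂ) r) :
    ‖dev a z‖ ≤ ‖a‖ := by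
  rw [dev_eq _ hz]; exact (discIncl r a).norm_coe_le_norm _

lemma norm_le_of_dev_le (a : DiscAlg r) {C : ℝ} (hC : 0 ≤ C)
    (h : ∀ z ∈ closedBall (0 : ℂ) r, ‖dev a z‖ ≤ C) : ‖a‖ ≤ C := by
  refine (ContinuousMap.norm_le (discIncl r a) hC).2 fun z => ?_
  rw [← dev_eq a z.2]; exact h _ z.2

lemma dev_ext {a b : DiscAlg r} (h : ∀ z ∈ closedBall (0 : ℂ) r, dev a z = dev b z) :
    a = b := by
  refine discIncl_injective r (ContinuousMap.ext fun z => ?_)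
  rw [← dev_eq a z.2, ← dev_eq b z.2]; exact h _ z.2

lemma differentiableOn_dev (a : DiscAlg r) : DifferentiableOn ℂ (dev a) (ball 0 r) := a.2

lemma continuousOn_dev (a : DiscAlg r) : ContinuousOn (dev a) (closedBall 0 r) := by
  rw [continuousOn_iff_continuous_domRestrict]
  convert (discIncl r a).continuous using 1
  ext z
  exact dev_eq a z.2

/-- The element of the disc algebra defined by a function. -/
noncomputable def discMk (F : ℂ → ℂ) (hc : ContinuousOn F (closedBall 0 r))
    (hd : DifferentiableOn ℂ F (ball 0 r)) : DiscAlg r :=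
  ⟨⟨fun z => F z, continuousOn_iff_continuous_domRestrict.1 hc⟩,
    hd.congr fun z hz => by rw [discExt_of_mem _ (ball_subset_closedBall hz)]; rfl⟩

lemma dev_discMk {F : ℂ → ℂ} (hc : ContinuousOn F (closedBall 0 r))
    (hd : DifferentiableOn ℂ F (ball 0 r)) {z : ℂ} (hz : z ∈ closedBall (0 : ℂ) r) :
    dev (discMk F hc hd) z = F z := by rw [dev_eq _ hz]; rfl

/-- Evaluation at a point of the disc, as a continuous linear functional. -/
noncomputable def devCLM (z : ℂ) (hz : z ∈ closedBall (0 : ℂ) r) : DiscAlg r →L[ℂ] ℂ :=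
  LinearMap.mkContinuous
    { toFun := fun a => dev a z
      map_add' := fun a b => dev_add a b hz
      map_smul' := fun c a => dev_smul c a hz } 1
    fun a => by rw [one_mul]; exact norm_dev_le a hz

@[simp] lemma devCLM_apply (z : ℂ) (hz : z ∈ closedBall (0 : ℂ) r) (a : DiscAlg r) :
    devCLM z hz a = dev a z := rfl

/-- The coordinate function. -/
noncomputable def discX (r : ℝ) : DiscAlg r := discMk id continuousOn_id differentiableOn_id

lemma dev_discX {z : ℂ} (hz : z ∈ closedBall (0 : ℂ) r) : dev (discX r) z = z :=
  dev_discMk _ _ hz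

lemma discX_mul_eq_zero (hr : 0 < r) {a : DiscAlg r} (h : discX r * a = 0) : a = 0 := by
  have hne : ∀ z ∈ closedBall (0 : ℂ) r, z ≠ 0 → dev a z = 0 := by
    intro z hz hz0
    have := congrArg (fun b => dev b z) h
    simp only [dev_mul _ _ hz, dev_discX hz] at this
    have h0 : dev (0 : DiscAlg r) z = 0 := by simp [dev_eq _ hz]
    rw [h0] at this
    exact (mul_eq_zero.1 this).resolve_left hz0
  refine dev_ext fun z hz => ?_
  have h0 : dev (0 : DiscAlg r) z = 0 := by simp [dev_eq _ hz]
  rw [h0]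
  by_cases hz0 : z = 0
  · subst hz0
    have hcont : ContinuousAt (dev a) 0 :=
      (differentiableOn_dev a).continuousOn.continuousAt (ball_mem_nhds _ hr)
    refine tendsto_nhds_unique (hcont.tendsto.mono_left nhdsWithin_le_nhds)
      (tendsto_const_nhds.congr' ?_ : Tendsto (dev a) (𝓝[≠] 0) (𝓝 0))
    filter_upwards [self_mem_nhdsWithin, nhdsWithin_le_nhds (closedBall_mem_nhds (0 : ℂ) hr)]
      with w hw hw'
    exact (hne w hw' hw).symm
  · exact hne z hz hz0

lemma exists_discX_mul (hr : 0 < r) (a : DiscAlg r) :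
    ∃ b : DiscAlg r, a = dev a 0 • (1 : DiscAlg r) + discX r * b := by
  have hd : DifferentiableOn ℂ (dslope (dev a) 0) (ball 0 r) :=
    (Complex.differentiableOn_dslope (ball_mem_nhds _ hr)).2 (differentiableOn_dev a)
  have hc : ContinuousOn (dslope (dev a) 0) (closedBall 0 r) :=
    (continuousOn_dslope (closedBall_mem_nhds _ hr)).2 ⟨continuousOn_dev a,
      (differentiableOn_dev a).differentiableAt (ball_mem_nhds _ hr)⟩
  refine ⟨discMk _ hc hd, dev_ext fun z hz => ?_⟩
  rw [dev_add _ _ hz, dev_smul _ _ hz, dev_mul _ _ hz, dev_one hz, dev_discX hz,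
    dev_discMk _ _ hz]
  have := sub_smul_dslope (dev a) 0 z
  simp only [sub_zero, smul_eq_mul] at this
  rw [this]; ring

lemma isUnit_of_dev_ne_zero {u : DiscAlg r}
    (h : ∀ z ∈ closedBall (0 : ℂ) r, dev u z ≠ 0) : IsUnit u := by
  refine IsUnit.of_mul_eq_one (discMk (fun z => (dev u z)⁻¹) ((continuousOn_dev u).inv₀ h)
    ((differentiableOn_dev u).inv fun z hz => h z (ball_subset_closedBall hz)))
    (dev_ext fun z hz => ?_)
  rw [dev_mul _ _ hz, dev_discMk _ _ hz, dev_one hz, mul_inv_cancel₀ (h z hz)]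

/-- Weierstrass division map: `(a, b) ↦ ∑ aᵢ yⁱ + b q`. -/
noncomputable def divMap (n : ℕ) (q : DiscAlg r) :
    ((Fin n → ℂ) × DiscAlg r) →L[ℂ] DiscAlg r :=
  (∑ i : Fin n, ((ContinuousLinearMap.proj (R := ℂ) (φ := fun _ : Fin n => ℂ) i).smulRight
      (discX r ^ (i : ℕ))).comp (ContinuousLinearMap.fst ℂ _ _)) +
    ((ContinuousLinearMap.mul ℂ (DiscAlg r)).flip q).comp (ContinuousLinearMap.snd ℂ _ _)

lemma divMap_apply (n : ℕ) (q : DiscAlg r) (a : Fin n → ℂ) (b : DiscAlg r) :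
    divMap n q (a, b) = ∑ i : Fin n, a i • discX r ^ (i : ℕ) + b * q := by
  simp [divMap, mul_comm]

lemma analyticAt_divMap (n : ℕ) (q₀ : DiscAlg r) : AnalyticAt ℂ (divMap (r := r) n) q₀ := by
  have h : divMap (r := r) n = fun q => (∑ i : Fin n,
      ((ContinuousLinearMap.proj (R := ℂ) (φ := fun _ : Fin n => ℂ) i).smulRight
      (discX r ^ (i : ℕ))).comp (ContinuousLinearMap.fst ℂ (Fin n → ℂ) (DiscAlg r))) +
      (((ContinuousLinearMap.mul ℂ (DiscAlg r)).flip q).comp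
        (ContinuousLinearMap.snd ℂ (Fin n → ℂ) (DiscAlg r))) := rfl
  rw [h]
  refine analyticAt_const.add ?_
  have h2 := ((ContinuousLinearMap.mul ℂ (DiscAlg r)).flip).analyticAt q₀
  exact AnalyticAt.comp (g := (ContinuousLinearMap.compL ℂ ((Fin n → ℂ) × DiscAlg r) (DiscAlg r)
      (DiscAlg r)).flip (ContinuousLinearMap.snd ℂ (Fin n → ℂ) (DiscAlg r)))
    (ContinuousLinearMap.analyticAt _ _) h2

lemma divMap_pow_injective (hr : 0 < r) (n : ℕ) :
    ∀ (a : Fin n → ℂ) (b : DiscAlg r),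
      ∑ i : Fin n, a i • discX r ^ (i : ℕ) + b * discX r ^ n = 0 → a = 0 ∧ b = 0 := by
  have h0 : (0 : ℂ) ∈ closedBall (0 : ℂ) r := by simp [hr.le]
  induction n with
  | zero => intro a b h; exact ⟨Subsingleton.elim _ _, by simpa using h⟩
  | succ n ih =>
    intro a b h
    have hfac : ∑ i : Fin (n + 1), a i • discX r ^ (i : ℕ) + b * discX r ^ (n + 1)
        = a 0 • (1 : DiscAlg r) + discX r *
          (∑ i : Fin n, a i.succ • discX r ^ (i : ℕ) + b * discX r ^ n) := by
      rw [Fin.sum_univ_succ, mul_add, Finset.mul_sum]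
      simp only [Fin.val_zero, pow_zero, Fin.val_succ, pow_succ']
      simp only [mul_smul_comm]
      ring
    rw [hfac] at h
    have ha0 : a 0 = 0 := by
      have := congrArg (fun b => dev b 0) h
      simp only [dev_add _ _ h0, dev_mul _ _ h0, dev_smul _ _ h0, dev_one h0, dev_discX h0] at this
      have h00 : dev (0 : DiscAlg r) 0 = 0 := by simp [dev_eq _ h0]
      simpa [h00] using this
    rw [ha0, zero_smul, zero_add] at h
    obtain ⟨h1, h2⟩ := ih _ _ (discX_mul_eq_zero hr h)
    refine ⟨?_, h2⟩
    ext i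
    refine Fin.cases ha0 (fun i => ?_) i
    exact congrFun h1 i

lemma divMap_pow_surjective (hr : 0 < r) (n : ℕ) :
    ∀ h : DiscAlg r, ∃ (a : Fin n → ℂ) (b : DiscAlg r),
      h = ∑ i : Fin n, a i • discX r ^ (i : ℕ) + b * discX r ^ n := by
  induction n with
  | zero => intro h; exact ⟨0, h, by simp⟩
  | succ n ih =>
    intro h
    obtain ⟨b, hb⟩ := exists_discX_mul hr h
    obtain ⟨a', b', h'⟩ := ih b
    refine ⟨Fin.cons (dev h 0) a', b', ?_⟩
    rw [Fin.sum_univ_succ]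
    simp only [Fin.val_zero, pow_zero, Fin.val_succ, pow_succ', Fin.cons_zero, Fin.cons_succ]
    conv_lhs => rw [hb, h', mul_add, Finset.mul_sum]
    simp only [mul_smul_comm]
    ring

/-- Weierstrass division by `yⁿ u` with `u` a unit, as a continuous linear equivalence. -/
lemma exists_divEquiv (hr : 0 < r) (n : ℕ) {u : DiscAlg r} (hu : IsUnit u) :
    ∃ e : ((Fin n → ℂ) × DiscAlg r) ≃L[ℂ] DiscAlg r,
      (e : ((Fin n → ℂ) × DiscAlg r) →L[ℂ] DiscAlg r)
        = divMap n (discX r ^ n * (u : DiscAlg r)) := by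
  obtain ⟨u, rfl⟩ := hu
  refine ⟨ContinuousLinearEquiv.ofBijective (divMap n (discX r ^ n * (u : DiscAlg r))) ?_ ?_, ?_⟩
  · rw [LinearMap.ker_eq_bot']
    rintro ⟨a, b⟩ h
    have h' : divMap n (discX r ^ n * (u : DiscAlg r)) (a, b) = 0 := h
    rw [divMap_apply] at h'
    obtain ⟨h1, h2⟩ := divMap_pow_injective hr n a (b * u) (by rw [← h']; ring)
    have h3 : b = 0 := by simpa using h2
    simp [h1, h3]
  · rw [LinearMap.range_eq_top]
    intro h
    obtain ⟨a, b, hab⟩ := divMap_pow_surjective hr n h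
    refine ⟨(a, b * (↑u⁻¹ : DiscAlg r)), ?_⟩
    change divMap n (discX r ^ n * (u : DiscAlg r)) (a, b * (↑u⁻¹ : DiscAlg r)) = h
    rw [divMap_apply, hab]
    congr 1
    calc b * (↑u⁻¹ : DiscAlg r) * (discX r ^ n * (u : DiscAlg r))
        = b * discX r ^ n * ((↑u⁻¹ : DiscAlg r) * u) := by ring
      _ = _ := by simp
  · rfl

end DiscAlgebra

lemma analyticAt_clmApply {U V W : Type*} [NormedAddCommGroup U] [NormedSpace ℂ U]
    [NormedAddCommGroup V] [NormedSpace ℂ V] [NormedAddCommGroup W] [NormedSpace ℂ W]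
    {L : U → V →L[ℂ] W} {v : U → V} {x : U} (hL : AnalyticAt ℂ L x) (hv : AnalyticAt ℂ v x) :
    AnalyticAt ℂ (fun y => L y (v y)) x :=
  AnalyticAt.comp (g := fun p : (V →L[ℂ] W) × V => p.1 p.2)
    ((ContinuousLinearMap.id ℂ (V →L[ℂ] W)).analyticAt_bilinear _) (hL.prod hv)

section Curry

variable {r : ℝ}

lemma isometry_discIncl (r : ℝ) : Isometry (discIncl r) := isometry_subtype_coe

lemma isClosed_range_discIncl (r : ℝ) : IsClosed (Set.range (discIncl r)) := by
  have : Set.range (discIncl r) = (discAlgebra r : Set C(closedBall (0 : ℂ) r, ℂ)) :=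
    Subtype.range_coe
  rw [this]
  exact isClosed_discAlgebra r

lemma analyticAt_of_discIncl {H : ℂ → DiscAlg r} {x₀ : ℂ}
    (h : AnalyticAt ℂ (fun x => discIncl r (H x)) x₀) : AnalyticAt ℂ H x₀ := by
  rw [Complex.analyticAt_iff_eventually_differentiableAt] at h ⊢
  filter_upwards [h] with x hx
  have h1 := hasDerivAt_iff_tendsto_slope.1 hx.hasDerivAt
  have hs : slope (fun x => discIncl r (H x)) x = fun y => discIncl r (slope H x y) := by
    ext1 y
    simp only [slope, vsub_eq_sub, ← map_sub, map_smul]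
  rw [hs] at h1
  obtain ⟨d, hd⟩ := (isClosed_range_discIncl r).mem_of_tendsto h1
    (Eventually.of_forall fun y => mem_range_self _)
  rw [← hd] at h1
  have h2 : Tendsto (slope H x) (𝓝[≠] x) (𝓝 d) :=
    (isometry_discIncl r).isUniformInducing.isInducing.tendsto_nhds_iff.2 h1
  exact (hasDerivAt_iff_tendsto_slope.2 h2).differentiableAt

/-- An analytic function of two variables is an analytic function of the first variable with
values in a disc algebra. -/
lemma exists_curry {f : ℂ × ℂ → ℂ} (hf : AnalyticAt ℂ f 0) :
    ∃ r₀ > 0, ∀ r < r₀, ∃ F : ℂ → DiscAlg r, AnalyticAt ℂ F 0 ∧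
      ∀ x ∈ ball (0 : ℂ) r₀, ∀ y ∈ closedBall (0 : ℂ) r, dev (F x) y = f (x, y) := by
  obtain ⟨R, hR, hfa, hN⟩ := exists_analytic_superposition hf
  refine ⟨R, hR, fun r hr => ?_⟩
  obtain ⟨N, hN, hNf⟩ := hN (closedBall (0 : ℂ) r)
  let c₀ : C(closedBall (0 : ℂ) r, ℂ × ℂ) := ⟨fun y => (0, (y : ℂ)), by fun_prop⟩
  let c₁ : C(closedBall (0 : ℂ) r, ℂ × ℂ) := ⟨fun y => (1, 0), by fun_prop⟩
  let c : ℂ → C(closedBall (0 : ℂ) r, ℂ × ℂ) := fun x => c₀ + x • c₁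
  have hc : ∀ x y, c x y = (x, (y : ℂ)) := fun x y => by simp [c, c₀, c₁]
  have hcb : ∀ x ∈ ball (0 : ℂ) R, c x ∈ ball (0 : C(closedBall (0 : ℂ) r, ℂ × ℂ)) R := by
    intro x hx
    rw [mem_ball_zero_iff] at hx ⊢
    rw [ContinuousMap.norm_lt_iff _ hR]
    intro y
    rw [hc, Prod.norm_def, max_lt_iff]
    exact ⟨hx, (mem_closedBall_zero_iff.1 y.2).trans_lt hr⟩
  have hmem : ∀ x ∈ ball (0 : ℂ) R, N (c x) ∈ discAlgebra r := by
    intro x hx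
    have : DifferentiableOn ℂ (fun y : ℂ => f (x, y)) (ball 0 r) := by
      intro y hy
      have h1 : (x, y) ∈ ball (0 : ℂ × ℂ) R := by
        rw [mem_ball_zero_iff, Prod.norm_def, max_lt_iff]
        exact ⟨mem_ball_zero_iff.1 hx, (mem_ball_zero_iff.1 hy).trans hr⟩
      exact ((hfa _ h1).differentiableAt.comp y
        ((differentiableAt_const x).prodMk differentiableAt_id)).differentiableWithinAt
    refine this.congr fun y hy => ?_
    rw [discExt_of_mem _ (ball_subset_closedBall hy), hNf _ (hcb x hx), hc]
  classical
  let F : ℂ → DiscAlg r := fun x => if hx : x ∈ ball (0 : ℂ) R then ⟨N (c x), hmem x hx⟩ else 0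
  have hF : ∀ x ∈ ball (0 : ℂ) R, discIncl r (F x) = N (c x) := by
    intro x hx
    have : F x = (⟨N (c x), hmem x hx⟩ : discAlgebra r) := dif_pos hx
    rw [this]
    rfl
  refine ⟨F, analyticAt_of_discIncl ?_, fun x hx y hy => ?_⟩
  · have h1 : AnalyticAt ℂ (fun x => N (c x)) 0 := by
      have h2 : AnalyticAt ℂ c 0 := analyticAt_const.add (analyticAt_id.smul analyticAt_const)
      exact AnalyticAt.comp (hN (c 0) (hcb 0 (mem_ball_self hR))) h2
    refine h1.congr ?_
    filter_upwards [ball_mem_nhds (0 : ℂ) hR] with x hx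
    exact (hF x hx).symm
  · rw [dev_eq _ hy, hF x hx, hNf _ (hcb x hx), hc]

/-- Inverse of the Weierstrass division map. -/
noncomputable def divInv (n : ℕ) (q : DiscAlg r) :
    DiscAlg r →L[ℂ] ((Fin n → ℂ) × DiscAlg r) :=
  ContinuousLinearMap.inverse (divMap n q)

lemma analyticAt_divInv (hr : 0 < r) (n : ℕ) {u : DiscAlg r} (hu : IsUnit u) :
    AnalyticAt ℂ (divInv (r := r) n) (discX r ^ n * u) := by
  obtain ⟨e, he⟩ := exists_divEquiv hr n hu
  have h1 : AnalyticAt ℂ ContinuousLinearMap.inverse (divMap n (discX r ^ n * u)) := by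
    rw [← he]
    exact (contDiffAt_map_inverse e).analyticAt
  exact AnalyticAt.comp h1 (analyticAt_divMap n _)

lemma eventually_divMap_isEquiv (hr : 0 < r) (n : ℕ) {u : DiscAlg r} (hu : IsUnit u) :
    ∀ᶠ q in 𝓝 (discX r ^ n * u), ∃ e : ((Fin n → ℂ) × DiscAlg r) ≃L[ℂ] DiscAlg r,
      (e : ((Fin n → ℂ) × DiscAlg r) →L[ℂ] DiscAlg r) = divMap n q := by
  obtain ⟨e, he⟩ := exists_divEquiv hr n hu
  have h1 := (analyticAt_divMap n (discX r ^ n * u)).continuousAt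
  have h2 := h1.preimage_mem_nhds (by rw [← he]; exact ContinuousLinearEquiv.nhds e)
  filter_upwards [h2] with q hq
  exact hq

lemma divMap_divInv {n : ℕ} {q : DiscAlg r}
    (hq : ∃ e : ((Fin n → ℂ) × DiscAlg r) ≃L[ℂ] DiscAlg r,
      (e : ((Fin n → ℂ) × DiscAlg r) →L[ℂ] DiscAlg r) = divMap n q) (h : DiscAlg r) :
    ∑ i : Fin n, (divInv n q h).1 i • discX r ^ (i : ℕ) + (divInv n q h).2 * q = h := by
  obtain ⟨e, he⟩ := hq
  rw [← divMap_apply, divInv, ← he, ContinuousLinearMap.inverse_equiv]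
  exact e.apply_symm_apply h

lemma divInv_divMap {n : ℕ} {q : DiscAlg r}
    (hq : ∃ e : ((Fin n → ℂ) × DiscAlg r) ≃L[ℂ] DiscAlg r,
      (e : ((Fin n → ℂ) × DiscAlg r) →L[ℂ] DiscAlg r) = divMap n q) (a : Fin n → ℂ)
    (b : DiscAlg r) :
    divInv n q (∑ i : Fin n, a i • discX r ^ (i : ℕ) + b * q) = (a, b) := by
  obtain ⟨e, he⟩ := hq
  rw [← divMap_apply, divInv, ← he, ContinuousLinearMap.inverse_equiv]
  exact e.symm_apply_apply (a, b)

/-- An analytic function with values in a disc algebra gives an analytic function of two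
variables. -/
lemma analyticAt_uncurry (hr : 0 < r) {H : ℂ → DiscAlg r} (hH : AnalyticAt ℂ H 0) :
    AnalyticAt ℂ (fun p : ℂ × ℂ => dev (H p.1) p.2) 0 := by
  have h0 : (0 : ℂ) ∈ closedBall (0 : ℂ) r := by simp [hr.le]
  obtain ⟨e, he⟩ := exists_divEquiv hr 1 (isUnit_one : IsUnit (1 : DiscAlg r))
  let D : DiscAlg r →L[ℂ] DiscAlg r := (ContinuousLinearMap.snd ℂ (Fin 1 → ℂ) (DiscAlg r)).comp
    (e.symm : DiscAlg r →L[ℂ] ((Fin 1 → ℂ) × DiscAlg r))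
  have hD : ∀ h : DiscAlg r, ∃ c : ℂ, h = c • (1 : DiscAlg r) + D h * discX r := by
    intro h
    refine ⟨(e.symm h).1 0, ?_⟩
    have h1 : divMap 1 (discX r ^ 1 * 1) (e.symm h) = h := by
      rw [← he]; exact e.apply_symm_apply h
    conv_lhs => rw [← h1]
    rw [show e.symm h = ((e.symm h).1, (e.symm h).2) from rfl, divMap_apply]
    simp [D]
  have hinv : AnalyticAt ℂ (fun p : ℂ × ℂ =>
      Ring.inverse ((1 : DiscAlg r →L[ℂ] DiscAlg r) - p.2 • D)) 0 := by
    have h1 : AnalyticAt ℂ (fun p : ℂ × ℂ => (1 : DiscAlg r →L[ℂ] DiscAlg r) - p.2 • D) 0 :=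
      analyticAt_const.sub (analyticAt_snd.smul analyticAt_const)
    refine AnalyticAt.comp (g := Ring.inverse) ?_ h1
    have := analyticAt_inverse (𝕜 := ℂ) (1 : (DiscAlg r →L[ℂ] DiscAlg r)ˣ)
    have h2 : (1 : DiscAlg r →L[ℂ] DiscAlg r) - (0 : ℂ × ℂ).2 • D
        = ((1 : (DiscAlg r →L[ℂ] DiscAlg r)ˣ) : DiscAlg r →L[ℂ] DiscAlg r) := by
      rw [Prod.snd_zero, zero_smul ℂ D, sub_zero, Units.val_one]
    rw [h2]
    exact this
  have hmain : AnalyticAt ℂ (fun p : ℂ × ℂ => devCLM 0 h0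
      (Ring.inverse ((1 : DiscAlg r →L[ℂ] DiscAlg r) - p.2 • D) (H p.1))) 0 := by
    have h2 : AnalyticAt ℂ (fun p : ℂ × ℂ => H p.1) 0 :=
      AnalyticAt.comp (g := H) hH analyticAt_fst
    exact ((devCLM 0 h0).analyticAt _).comp (analyticAt_clmApply hinv h2)
  refine hmain.congr ?_
  have hunit : ∀ᶠ p : ℂ × ℂ in 𝓝 0, IsUnit ((1 : DiscAlg r →L[ℂ] DiscAlg r) - p.2 • D) := by
    have h1 : ContinuousAt (fun p : ℂ × ℂ => (1 : DiscAlg r →L[ℂ] DiscAlg r) - p.2 • D) 0 := by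
      fun_prop
    refine h1.eventually (p := IsUnit) ?_
    have h2 : (1 : DiscAlg r →L[ℂ] DiscAlg r) - (0 : ℂ × ℂ).2 • D = 1 := by
      rw [Prod.snd_zero, zero_smul ℂ D, sub_zero]
    change ∀ᶠ y in 𝓝 ((1 : DiscAlg r →L[ℂ] DiscAlg r) - (0 : ℂ × ℂ).2 • D), IsUnit y
    rw [h2]
    exact Units.nhds (1 : (DiscAlg r →L[ℂ] DiscAlg r)ˣ)
  have hball : ∀ᶠ p : ℂ × ℂ in 𝓝 0, p.2 ∈ closedBall (0 : ℂ) r :=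
    continuous_snd.continuousAt.eventually_mem (closedBall_mem_nhds _ hr)
  filter_upwards [hunit, hball] with p hp hp2
  set k := Ring.inverse ((1 : DiscAlg r →L[ℂ] DiscAlg r) - p.2 • D) (H p.1) with hk
  have h3 : k - p.2 • D k = H p.1 := by
    have := congrArg (fun L : DiscAlg r →L[ℂ] DiscAlg r => L (H p.1))
      (Ring.mul_inverse_cancel _ hp)
    simpa using this
  obtain ⟨c, hc⟩ := hD k
  have hk0 : dev k 0 = c := by
    rw [hc, dev_add _ _ h0, dev_mul _ _ h0, dev_smul _ _ h0, dev_one h0, dev_discX h0]; ring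
  have hk2 : dev k p.2 = c + dev (D k) p.2 * p.2 := by
    conv_lhs => rw [hc]
    rw [dev_add _ _ hp2, dev_mul _ _ hp2, dev_smul _ _ hp2, dev_one hp2, dev_discX hp2]; ring
  change dev k 0 = dev (H p.1) p.2
  rw [← h3, dev_sub _ _ hp2, dev_smul _ _ hp2, hk2, hk0]; ring

end Curry

lemma analyticAt_slice {f : ℂ × ℂ → ℂ} (hf : AnalyticAt ℂ f 0) :
    AnalyticAt ℂ (fun y => f (0, y)) 0 :=
  AnalyticAt.comp (g := f) (f := fun y : ℂ => ((0 : ℂ), y)) hf (analyticAt_const.prod analyticAt_id)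

/-- Currying a function which is regular of order `m` in the second variable. -/
lemma exists_curry_order {f : ℂ × ℂ → ℂ} (hf : AnalyticAt ℂ f 0) {m : ℕ}
    (hm : analyticOrderAt (fun y => f (0, y)) 0 = m) :
    ∃ r₀ > 0, ∀ r, 0 < r → r < r₀ → ∃ F : ℂ → DiscAlg r, AnalyticAt ℂ F 0 ∧
      (∀ᶠ x in 𝓝 0, ∀ y ∈ closedBall (0 : ℂ) r, dev (F x) y = f (x, y)) ∧
      ∃ u : DiscAlg r, IsUnit u ∧ F 0 = discX r ^ m * u := by
  obtain ⟨r₁, hr₁, hcurry⟩ := exists_curry hf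
  obtain ⟨g, hg, hg0, hfg⟩ := ((analyticAt_slice hf).analyticOrderAt_eq_natCast).1 hm
  obtain ⟨r₂, hr₂, hball⟩ := Metric.eventually_nhds_iff_ball.1
    (hfg.and (hg.eventually_analyticAt.and (hg.continuousAt.eventually_ne hg0)))
  refine ⟨min r₁ r₂, lt_min hr₁ hr₂, fun r hr hrr => ?_⟩
  obtain ⟨F, hF, hFf⟩ := hcurry r (hrr.trans_le (min_le_left _ _))
  have hsub : closedBall (0 : ℂ) r ⊆ ball 0 r₂ :=
    closedBall_subset_ball (hrr.trans_le (min_le_right _ _))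
  have hgd : ∀ y ∈ closedBall (0 : ℂ) r, DifferentiableAt ℂ g y := fun y hy =>
    (hball y (hsub hy)).2.1.differentiableAt
  let u : DiscAlg r := discMk g (fun y hy => (hgd y hy).continuousAt.continuousWithinAt)
    (fun y hy => (hgd y (ball_subset_closedBall hy)).differentiableWithinAt)
  have hug : ∀ y ∈ closedBall (0 : ℂ) r, dev u y = g y := fun y hy => dev_discMk _ _ hy
  refine ⟨F, hF, ?_, u, isUnit_of_dev_ne_zero fun y hy => ?_, dev_ext fun y hy => ?_⟩
  · filter_upwards [ball_mem_nhds (0 : ℂ) hr₁] with x hx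
    exact hFf x hx
  · rw [hug y hy]
    exact (hball y (hsub hy)).2.2
  · rw [hFf 0 (mem_ball_self hr₁) y hy, dev_mul _ _ hy, dev_pow _ _ hy, dev_discX hy,
      hug y hy, (hball y (hsub hy)).1]
    simp

/-- Weierstrass preparation. -/
lemma exists_weierstrass {f : ℂ × ℂ → ℂ} (hf : AnalyticAt ℂ f 0) {m : ℕ}
    (hm : analyticOrderAt (fun y => f (0, y)) 0 = m) :
    ∃ (c : Fin m → ℂ → ℂ) (k : ℂ × ℂ → ℂ), (∀ i, AnalyticAt ℂ (c i) 0 ∧ c i 0 = 0) ∧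
      AnalyticAt ℂ k 0 ∧ k 0 ≠ 0 ∧
      ∀ᶠ p : ℂ × ℂ in 𝓝 0, p.2 ^ m - ∑ i, c i p.1 * p.2 ^ (i : ℕ) = f p * k p := by
  obtain ⟨r₀, hr₀, h⟩ := exists_curry_order hf hm
  obtain ⟨r, hr, hrr⟩ := exists_between hr₀
  obtain ⟨F, hF, hFf, u, hu, hF0⟩ := h r hr hrr
  have hS : AnalyticAt ℂ (fun x => divInv m (F x) (discX r ^ m)) 0 := by
    have h1 : AnalyticAt ℂ (fun x => divInv m (F x)) 0 :=
      AnalyticAt.comp (g := divInv (r := r) m) (by rw [hF0]; exact analyticAt_divInv hr m hu) hF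
    exact analyticAt_clmApply h1 analyticAt_const
  have hk : AnalyticAt ℂ (fun x => (divInv m (F x) (discX r ^ m)).2) 0 :=
    AnalyticAt.comp (g := Prod.snd) analyticAt_snd hS
  have hequiv : ∀ᶠ x in 𝓝 (0 : ℂ), ∃ e : ((Fin m → ℂ) × DiscAlg r) ≃L[ℂ] DiscAlg r,
      (e : ((Fin m → ℂ) × DiscAlg r) →L[ℂ] DiscAlg r) = divMap m (F x) := by
    have := hF.continuousAt.eventually (p := fun q => ∃ e :
      ((Fin m → ℂ) × DiscAlg r) ≃L[ℂ] DiscAlg r,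
      (e : ((Fin m → ℂ) × DiscAlg r) →L[ℂ] DiscAlg r) = divMap m q)
      (by rw [hF0]; exact eventually_divMap_isEquiv hr m hu)
    exact this
  obtain ⟨u, rfl⟩ := hu
  have h0 : divInv m (F 0) (discX r ^ m) = (0, (↑u⁻¹ : DiscAlg r)) := by
    have := divInv_divMap hequiv.self_of_nhds 0 (↑u⁻¹ : DiscAlg r)
    rw [← this]
    congr 1
    rw [hF0]
    simp only [Pi.zero_apply, zero_smul, Finset.sum_const_zero, zero_add]
    calc discX r ^ m = (↑u⁻¹ * ↑u) * discX r ^ m := by rw [Units.inv_mul, one_mul]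
      _ = _ := by ring
  refine ⟨fun i x => (divInv m (F x) (discX r ^ m)).1 i,
    fun p => dev (divInv m (F p.1) (discX r ^ m)).2 p.2, fun i => ⟨?_, ?_⟩,
    analyticAt_uncurry hr hk, ?_, ?_⟩
  · exact ((ContinuousLinearMap.proj (R := ℂ) (φ := fun _ : Fin m => ℂ) i).analyticAt _).comp
      (AnalyticAt.comp (g := Prod.fst) analyticAt_fst hS)
  · simp [h0]
  · have hz : (0 : ℂ) ∈ closedBall (0 : ℂ) r := by simp [hr.le]
    change dev (divInv m (F 0) (discX r ^ m)).2 0 ≠ 0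
    rw [h0]
    intro hzero
    have h1 := dev_mul (↑u⁻¹ : DiscAlg r) (u : DiscAlg r) hz
    rw [Units.inv_mul, dev_one hz, hzero, zero_mul] at h1
    exact one_ne_zero h1
  · have hball : ∀ᶠ p : ℂ × ℂ in 𝓝 0, p.2 ∈ closedBall (0 : ℂ) r :=
      continuous_snd.continuousAt.eventually_mem (closedBall_mem_nhds _ hr)
    have hfst : Tendsto (fun p : ℂ × ℂ => p.1) (𝓝 0) (𝓝 0) := continuous_fst.tendsto' _ _ rfl
    filter_upwards [hball, hfst.eventually hFf, hfst.eventually hequiv] with p hp hpF hpe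
    have h1 := congrArg (fun h => dev h p.2) (divMap_divInv hpe (discX r ^ m))
    simp only [dev_add _ _ hp, dev_sum _ _ hp, dev_smul _ _ hp, dev_pow _ _ hp, dev_discX hp,
      dev_mul _ _ hp, hpF _ hp] at h1
    rw [← h1]; ring

/-- Coefficients of `(z + s) ^ m - ∑ cᵢ (z + s) ^ i` as a polynomial in `z`. -/
noncomputable def shiftCoeff (m : ℕ) (c : Fin m → ℂ) (s : ℂ) (j : Fin m) : ℂ :=
  s ^ (m - j) * m.choose j - ∑ i, c i * (s ^ ((i : ℕ) - j) * (i : ℕ).choose j)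

lemma sub_sum_shift (m : ℕ) (c : Fin m → ℂ) (s z : ℂ) :
    (z + s) ^ m - ∑ i, c i * (z + s) ^ (i : ℕ)
      = z ^ m + ∑ j, shiftCoeff m c s j * z ^ (j : ℕ) := by
  have h1 : (z + s) ^ m = z ^ m + ∑ j : Fin m, z ^ (j : ℕ) * s ^ (m - j) * m.choose j := by
    rw [add_pow, Finset.sum_range_succ, add_comm,
      Fin.sum_univ_eq_sum_range (fun j => z ^ j * s ^ (m - j) * (m.choose j : ℂ))]
    simp
  have h2 : ∀ i : Fin m, (z + s) ^ (i : ℕ)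
      = ∑ j : Fin m, z ^ (j : ℕ) * s ^ ((i : ℕ) - j) * (i : ℕ).choose j := by
    intro i
    rw [Fin.sum_univ_eq_sum_range (fun j => z ^ j * s ^ ((i : ℕ) - j) * ((i : ℕ).choose j : ℂ)),
      add_pow]
    refine Finset.sum_subset (Finset.range_subset_range.2 i.2) fun j _ hj => ?_
    rw [Nat.choose_eq_zero_of_lt (by simpa using hj)]
    simp
  simp only [h1, h2, shiftCoeff, sub_mul, Finset.sum_sub_distrib, Finset.mul_sum, Finset.sum_mul]
  rw [Finset.sum_comm, add_sub_assoc]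
  congr 2
  · exact Finset.sum_congr rfl fun j _ => by ring
  · exact Finset.sum_congr rfl fun j _ => Finset.sum_congr rfl fun i _ => by ring

lemma shiftCoeff_last (n : ℕ) (c : Fin (n + 1) → ℂ) :
    shiftCoeff (n + 1) c (c (Fin.last n) / (n + 1)) (Fin.last n) = 0 := by
  have h : (n + 1 : ℂ) ≠ 0 := by exact_mod_cast n.succ_ne_zero
  rw [shiftCoeff, Finset.sum_eq_single (Fin.last n)]
  · simp only [Fin.val_last, Nat.add_sub_cancel_left, pow_one, Nat.choose_succ_self_right,
      Nat.sub_self, pow_zero, Nat.choose_self]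
    push_cast
    field_simp
    ring
  · intro i _ hi
    have : (i : ℕ) < n := by
      have := Fin.val_lt_last hi
      simpa using this
    rw [Fin.val_last, Nat.choose_eq_zero_of_lt this]
    simp
  · simp

lemma exists_pow_mul {d : ℂ → ℂ} (hd : AnalyticAt ℂ d 0) (h0 : d 0 = 0) :
    ∃ (ν : ℕ) (g : ℂ → ℂ), 1 ≤ ν ∧ AnalyticAt ℂ g 0 ∧ (∀ᶠ t in 𝓝 0, d t = t ^ ν * g t) ∧
      (g 0 = 0 → (∀ᶠ t in 𝓝 0, d t = 0)) ∧ ((∀ᶠ t in 𝓝 0, d t = 0) → g 0 = 0) := by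
  by_cases h : ∀ᶠ t in 𝓝 0, d t = 0
  · exact ⟨1, 0, le_rfl, analyticAt_const, by simpa using h, fun _ => h, fun _ => rfl⟩
  · have h1 : analyticOrderAt d 0 ≠ ⊤ := fun h2 => h (analyticOrderAt_eq_top.1 h2)
    obtain ⟨ν, hν⟩ := ENat.ne_top_iff_exists.1 h1
    obtain ⟨g, hg, hg0, hdg⟩ := (hd.analyticOrderAt_eq_natCast).1 hν.symm
    refine ⟨ν, g, ?_, hg, by simpa using hdg, fun h2 => absurd h2 hg0, fun h2 => absurd h2 h⟩
    rw [Nat.one_le_iff_ne_zero]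
    rintro rfl
    have := hdg.self_of_nhds
    simp [h0] at this
    exact hg0 this.symm

/-- Rescaling along the first side of the Newton polygon. -/
lemma exists_newton_rescale {m : ℕ} {D : Fin m → ℂ → ℂ}
    (hD : ∀ j, AnalyticAt ℂ (D j) 0 ∧ D j 0 = 0) (hne : ∃ j, ¬ ∀ᶠ t in 𝓝 0, D j t = 0) :
    ∃ (M r : ℕ) (d : Fin m → ℂ → ℂ), 1 ≤ M ∧ 1 ≤ r ∧ (∀ j, AnalyticAt ℂ (d j) 0) ∧
      (∀ j, ∀ᶠ t in 𝓝 0, D j (t ^ M) = t ^ (r * (m - j)) * d j t) ∧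
      (∀ j, (∀ᶠ t in 𝓝 0, D j t = 0) → d j 0 = 0) ∧ ∃ j, d j 0 ≠ 0 := by
  classical
  choose ν g hν hg hDg hg1 hg2 using fun j => exists_pow_mul (hD j).1 (hD j).2
  let S : Finset (Fin m) := Finset.univ.filter fun j => g j 0 ≠ 0
  have hS : S.Nonempty := by
    obtain ⟨j, hj⟩ := hne
    exact ⟨j, by simpa [S] using fun h => hj (hg1 j h)⟩
  have hdvd : ∀ j : Fin m, m - j ∣ m.factorial := fun j =>
    Nat.dvd_factorial (Nat.sub_pos_of_lt j.2) (Nat.sub_le _ _)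
  have hMpos : 0 < m.factorial := m.factorial_pos
  let κ : Fin m → ℕ := fun j => ν j * (m.factorial / (m - j))
  have hκ : ∀ j, κ j * (m - j) = m.factorial * ν j := by
    intro j
    rw [mul_assoc, Nat.div_mul_cancel (hdvd j), mul_comm]
  obtain ⟨j₀, hj₀, hmin⟩ := S.exists_min_image κ hS
  have hpow : Tendsto (fun t : ℂ => t ^ m.factorial) (𝓝 0) (𝓝 0) :=
    (continuous_pow _).tendsto' _ _ (zero_pow hMpos.ne')
  refine ⟨m.factorial, κ j₀, fun j t => if j ∈ S then
    t ^ (m.factorial * ν j - κ j₀ * (m - j)) * g j (t ^ m.factorial) else 0, hMpos, ?_, ?_, ?_,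
    ?_, ?_⟩
  · exact Nat.mul_pos (hν j₀) (Nat.div_pos (Nat.le_of_dvd hMpos (hdvd j₀))
      (Nat.sub_pos_of_lt j₀.2))
  · intro j
    by_cases hj : j ∈ S
    · simp only [hj, if_true]
      refine (analyticAt_id.pow _).mul ?_
      exact AnalyticAt.comp (g := g j) (by simpa [hMpos.ne'] using hg j) (analyticAt_id.pow _)
    · simp only [hj, if_false]
      exact analyticAt_const
  · intro j
    by_cases hj : j ∈ S
    · simp only [hj, if_true]
      have hle : κ j₀ * (m - j) ≤ m.factorial * ν j := by
        rw [← hκ j]; exact Nat.mul_le_mul_right _ (hmin j hj)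
      filter_upwards [hpow.eventually (hDg j)] with t ht
      rw [ht, ← mul_assoc, ← pow_add, Nat.add_sub_cancel' hle, pow_mul]
    · simp only [hj, if_false, mul_zero]
      exact hpow.eventually (hg1 j (by simpa [S] using hj))
  · intro j hj
    have : j ∉ S := by simpa [S] using hg2 j hj
    simp [this]
  · refine ⟨j₀, ?_⟩
    simp only [hj₀, if_true, hκ j₀, Nat.sub_self, pow_zero, one_mul, zero_pow hMpos.ne']
    simpa [S] using hj₀

open Polynomial in
lemma exists_root_of_small_multiplicity (n : ℕ) (d : Fin (n + 1) → ℂ) (hlast : d (Fin.last n) = 0)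
    (hne : ∃ j, d j ≠ 0) :
    ∃ (w : ℂ) (k : ℕ) (q : ℂ[X]), 1 ≤ k ∧ k < n + 1 ∧ q.eval w ≠ 0 ∧
      ∀ z : ℂ, z ^ (n + 1) + ∑ j, d j * z ^ (j : ℕ) = (z - w) ^ k * q.eval z := by
  let p : ℂ[X] := X ^ (n + 1) + ∑ j : Fin (n + 1), C (d j) * X ^ (j : ℕ)
  have hdeg : (∑ j : Fin (n + 1), C (d j) * X ^ (j : ℕ)).degree < ((n + 1 : ℕ) : WithBot ℕ) := by
    refine (degree_sum_le _ _).trans_lt ?_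
    rw [Finset.sup_lt_iff (WithBot.bot_lt_coe _)]
    exact fun j _ => (degree_C_mul_X_pow_le _ _).trans_lt (by exact_mod_cast j.2)
  have hmon : p.Monic := monic_X_pow_add hdeg
  have hpdeg : p.natDegree = n + 1 := natDegree_eq_of_degree_eq_some (by
    rw [degree_add_eq_left_of_degree_lt (by rwa [degree_X_pow]), degree_X_pow])
  have hcoeff : ∀ j : Fin (n + 1), p.coeff j = d j := by
    intro j
    simp only [p, coeff_add, coeff_X_pow, finsetSum_coeff, coeff_C_mul]
    rw [if_neg (by have := j.2; omega), zero_add, Finset.sum_eq_single j]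
    · simp
    · intro i _ hi
      rw [if_neg (fun h => hi (Fin.ext h.symm)), mul_zero]
    · simp
  obtain ⟨w, hw⟩ := IsAlgClosed.exists_root p (by
    rw [degree_eq_natDegree hmon.ne_zero, hpdeg]
    exact_mod_cast n.succ_ne_zero)
  obtain ⟨q, hq, hndvd⟩ := exists_eq_pow_rootMultiplicity_mul_and_not_dvd p hmon.ne_zero w
  have hk : 1 ≤ p.rootMultiplicity w := (rootMultiplicity_pos hmon.ne_zero).2 hw
  have hle : p.rootMultiplicity w ≤ n + 1 := by
    have := natDegree_le_of_dvd (pow_rootMultiplicity_dvd p w) hmon.ne_zero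
    rwa [natDegree_pow, natDegree_X_sub_C, mul_one, hpdeg] at this
  refine ⟨w, p.rootMultiplicity w, q, hk, lt_of_le_of_ne hle fun heq => ?_, fun h => hndvd
    (dvd_iff_isRoot.2 h), fun z => ?_⟩
  · have hdvd : (X - C w) ^ (n + 1) ∣ p := heq ▸ pow_rootMultiplicity_dvd p w
    have hpw : p = (X - C w) ^ (n + 1) :=
      eq_of_monic_of_dvd_of_natDegree_le ((monic_X_sub_C w).pow _) hmon hdvd (by
        rw [hpdeg, natDegree_pow, natDegree_X_sub_C, mul_one])
    have h1 := hcoeff (Fin.last n)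
    rw [hlast, hpw, Fin.val_last, sub_eq_add_neg, ← C_neg, coeff_X_add_C_pow] at h1
    have hw0 : w = 0 := by
      have h2 : (n + 1 : ℂ) ≠ 0 := by exact_mod_cast n.succ_ne_zero
      simpa [h2] using h1
    obtain ⟨j, hj⟩ := hne
    apply hj
    rw [← hcoeff j, hpw, hw0, C_0, sub_zero, coeff_X_pow, if_neg (by have := j.2; omega)]
  · have h1 := congrArg (eval z) hq
    simp only [eval_mul, eval_pow, eval_sub, eval_X, eval_C] at h1
    rw [← h1]
    simp [p, eval_finsetSum]

/-- Existence of a Puiseux root. -/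
lemma exists_puiseux_root : ∀ (m : ℕ), 1 ≤ m → ∀ {f : ℂ × ℂ → ℂ}, AnalyticAt ℂ f 0 →
    analyticOrderAt (fun y => f (0, y)) 0 = m →
    ∃ (N : ℕ) (a : ℂ → ℂ), 1 ≤ N ∧ AnalyticAt ℂ a 0 ∧ a 0 = 0 ∧
      ∀ᶠ t in 𝓝 0, f (t ^ N, a t) = 0 := by
  intro m
  induction m using Nat.strong_induction_on with
  | _ m ih =>
  intro hm1 f hf hm
  obtain ⟨n, rfl⟩ : ∃ n, m = n + 1 := ⟨m - 1, by omega⟩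
  obtain ⟨c, k, hc, hk, hk0, hck⟩ := exists_weierstrass hf hm
  let s : ℂ → ℂ := fun x => c (Fin.last n) x / (n + 1)
  have hs : AnalyticAt ℂ s 0 := (hc (Fin.last n)).1.div_const
  have hs0 : s 0 = 0 := by simp [s, (hc (Fin.last n)).2]
  let D : Fin (n + 1) → ℂ → ℂ := fun j x => shiftCoeff (n + 1) (fun i => c i x) (s x) j
  have hD : ∀ j, AnalyticAt ℂ (D j) 0 ∧ D j 0 = 0 := by
    intro j
    refine ⟨?_, ?_⟩
    · refine ((hs.pow _).mul analyticAt_const).sub ?_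
      refine Finset.analyticAt_fun_sum _ fun i _ => (hc i).1.mul ((hs.pow _).mul analyticAt_const)
    · have : n + 1 - (j : ℕ) ≠ 0 := by have := j.2; omega
      simp [D, shiftCoeff, hs0, (hc _).2, this]
  have hDlast : ∀ x, D (Fin.last n) x = 0 := fun x => shiftCoeff_last n fun i => c i x
  -- evaluation of `f` on the shifted variable
  have hfD : ∀ {x z : ℂ → ℂ}, Tendsto x (𝓝 0) (𝓝 0) → Tendsto z (𝓝 0) (𝓝 0) →
      (∀ᶠ t in 𝓝 0, z t ^ (n + 1) + ∑ j, D j (x t) * z t ^ (j : ℕ) = 0) →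
      ∀ᶠ t in 𝓝 0, f (x t, z t + s (x t)) = 0 := by
    intro x z hx hz h
    have hsx : Tendsto (fun t => s (x t)) (𝓝 0) (𝓝 0) := by
      have := hs.continuousAt.tendsto.comp hx
      rwa [hs0] at this
    have hp : Tendsto (fun t => (x t, z t + s (x t))) (𝓝 0) (𝓝 (0 : ℂ × ℂ)) := by
      have := hx.prodMk_nhds (hz.add hsx)
      rwa [add_zero] at this
    filter_upwards [h, hp.eventually hck, hp.eventually (hk.continuousAt.eventually_ne hk0)]
      with t ht h1 h2
    rw [sub_sum_shift (n + 1) (fun i => c i (x t))] at h1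
    exact (mul_eq_zero.1 (h1.symm.trans ht)).resolve_right h2
  by_cases hall : ∀ j, ∀ᶠ t in 𝓝 0, D j t = 0
  · refine ⟨1, s, le_rfl, hs, hs0, ?_⟩
    have := hfD (x := fun t => t) (z := fun _ => 0) tendsto_id tendsto_const_nhds (by
      filter_upwards [eventually_all.2 hall] with t ht
      simp [ht])
    simpa using this
  · push Not at hall
    obtain ⟨M, r, d, hM, hr, hd, hDd, hd0, hdne⟩ := exists_newton_rescale hD
      (by obtain ⟨j, hj⟩ := hall; exact ⟨j, by simpa using hj⟩)
    obtain ⟨w, l, q, hl1, hln, hq, hpoly⟩ := exists_root_of_small_multiplicity n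
      (fun j => d j 0) (hd0 _ (Eventually.of_forall hDlast)) hdne
    let F : ℂ × ℂ → ℂ := fun p => (w + p.2) ^ (n + 1) + ∑ j, d j p.1 * (w + p.2) ^ (j : ℕ)
    have hF : AnalyticAt ℂ F 0 := by
      have h1 : AnalyticAt ℂ (fun p : ℂ × ℂ => w + p.2) 0 := analyticAt_const.add analyticAt_snd
      refine (h1.pow _).add (Finset.analyticAt_fun_sum _ fun j _ => ?_)
      exact (AnalyticAt.comp (g := d j) (f := Prod.fst) (x := (0 : ℂ × ℂ)) (hd j) analyticAt_fst).mul (h1.pow _)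
    have hFo : analyticOrderAt (fun y => F (0, y)) 0 = l := by
      rw [(analyticAt_slice hF).analyticOrderAt_eq_natCast]
      refine ⟨fun y => q.eval (w + y), ?_, by simpa using hq, Eventually.of_forall fun y => ?_⟩
      · exact AnalyticAt.comp (g := fun z => q.eval z)
          (q.differentiable.analyticAt _) (analyticAt_const.add analyticAt_id)
      · simp only [F, hpoly, smul_eq_mul, sub_zero, add_sub_cancel_left]
    obtain ⟨N', a', hN', ha', ha0, hroot⟩ := ih l hln hl1 hF hFo
    have hN0 : M * N' ≠ 0 := by positivity
    have hNr : N' * r ≠ 0 := by positivity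
    have ht1 : Tendsto (fun t : ℂ => t ^ (N' * M)) (𝓝 0) (𝓝 0) :=
      (continuous_pow _).tendsto' _ _ (by rw [mul_comm]; exact zero_pow hN0)
    have ht2 : Tendsto (fun t : ℂ => t ^ N') (𝓝 0) (𝓝 0) :=
      (continuous_pow _).tendsto' _ _ (zero_pow (by omega))
    let z : ℂ → ℂ := fun t => t ^ (N' * r) * (w + a' t)
    have hz : AnalyticAt ℂ z 0 := (analyticAt_id.pow _).mul (analyticAt_const.add ha')
    have hz0 : z 0 = 0 := by simp [z, zero_pow hNr]
    have hs' : AnalyticAt ℂ (fun t => s (t ^ (N' * M))) 0 := by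
      refine AnalyticAt.comp (g := s) ?_ (analyticAt_id.pow _)
      simpa [mul_comm N' M, zero_pow hN0] using hs
    refine ⟨N' * M, fun t => z t + s (t ^ (N' * M)), Nat.mul_pos hN' hM, hz.add hs', ?_, ?_⟩
    · simp only [hz0, mul_comm N' M, zero_pow hN0, hs0, add_zero]
    · refine hfD ht1 (by simpa only [hz0] using hz.continuousAt.tendsto) ?_
      filter_upwards [hroot, ht2.eventually (eventually_all.2 hDd)] with t h1 h2
      have h3 : ∀ j : Fin (n + 1), D j (t ^ (N' * M)) * z t ^ (j : ℕ)
          = t ^ (N' * r * (n + 1)) * (d j (t ^ N') * (w + a' t) ^ (j : ℕ)) := by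
        intro j
        have hj : (n + 1 - (j : ℕ)) + j = n + 1 := Nat.sub_add_cancel j.2.le
        rw [pow_mul, h2 j, ← pow_mul]
        simp only [z, mul_pow]
        calc t ^ (N' * (r * (n + 1 - (j : ℕ)))) * d j (t ^ N') *
              ((t ^ (N' * r)) ^ (j : ℕ) * (w + a' t) ^ (j : ℕ))
            = t ^ (N' * r * (n + 1 - (j : ℕ)) + N' * r * j) *
              (d j (t ^ N') * (w + a' t) ^ (j : ℕ)) := by
                rw [pow_add, pow_mul t (N' * r) j, mul_assoc N']; ring
          _ = _ := by rw [← mul_add, hj]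
      simp only [h3]
      rw [← Finset.mul_sum]
      simp only [z]
      rw [mul_pow, ← pow_mul, ← mul_add]
      change _ * F (t ^ N', a' t) = 0
      rw [h1, mul_zero]

lemma exists_eq_snd_mul {G : ℂ × ℂ → ℂ} (hG : AnalyticAt ℂ G 0) (h0 : ∀ᶠ t in 𝓝 0, G (t, 0) = 0) :
    ∃ h : ℂ × ℂ → ℂ, AnalyticAt ℂ h 0 ∧ ∀ᶠ p in 𝓝 0, G p = p.2 * h p := by
  obtain ⟨r₀, hr₀, hc⟩ := exists_curry hG
  obtain ⟨r, hr, hrr⟩ := exists_between hr₀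
  obtain ⟨F, hF, hFG⟩ := hc r hrr
  have hz : (0 : ℂ) ∈ closedBall (0 : ℂ) r := by simp [hr.le]
  have he := exists_divEquiv hr 1 (isUnit_one : IsUnit (1 : DiscAlg r))
  let q : DiscAlg r := discX r ^ 1 * 1
  have hk : AnalyticAt ℂ (fun t => (divInv 1 q (F t)).2) 0 :=
    AnalyticAt.comp (g := fun v => (divInv 1 q v).2)
      (((ContinuousLinearMap.snd ℂ _ _).comp (divInv 1 q)).analyticAt _) hF
  refine ⟨_, analyticAt_uncurry hr hk, ?_⟩
  have hball : ∀ᶠ p : ℂ × ℂ in 𝓝 0, p.2 ∈ closedBall (0 : ℂ) r :=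
    continuous_snd.continuousAt.eventually_mem (closedBall_mem_nhds _ hr)
  have hfst : Tendsto (fun p : ℂ × ℂ => p.1) (𝓝 0) (𝓝 0) := continuous_fst.tendsto' _ _ rfl
  filter_upwards [hball, hfst.eventually h0, hfst.eventually (ball_mem_nhds (0 : ℂ) hr₀)]
    with p hp hp0 hpb
  have h1 := divMap_divInv he (F p.1)
  have h2 : ∀ y ∈ closedBall (0 : ℂ) r, (divInv 1 q (F p.1)).1 0
      + dev (divInv 1 q (F p.1)).2 y * y = G (p.1, y) := by
    intro y hy
    rw [← hFG p.1 hpb y hy]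
    conv_rhs => rw [← h1]
    rw [dev_add _ _ hy, dev_mul _ _ hy, mul_one, pow_one, dev_discX hy, Fin.sum_univ_one,
      dev_smul _ _ hy, dev_pow _ _ hy]
    simp [q]
  have h3 := h2 0 hz
  rw [hp0, mul_zero, add_zero] at h3
  rw [show G p = G (p.1, p.2) from rfl, ← h2 p.2 hp, h3]
  ring

/-- Puiseux factorization. -/
lemma exists_puiseux_factorization : ∀ (m : ℕ) {f : ℂ × ℂ → ℂ}, AnalyticAt ℂ f 0 →
    analyticOrderAt (fun y => f (0, y)) 0 = m →
    ∃ (N : ℕ) (a : Fin m → ℂ → ℂ) (u : ℂ × ℂ → ℂ), 1 ≤ N ∧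
      (∀ k, AnalyticAt ℂ (a k) 0 ∧ a k 0 = 0) ∧ AnalyticAt ℂ u 0 ∧ u 0 ≠ 0 ∧
      ∀ᶠ p : ℂ × ℂ in 𝓝 0, f (p.1 ^ N, p.2) = u p * ∏ k, (p.2 - a k p.1) := by
  intro m
  induction m with
  | zero =>
    intro f hf hm
    refine ⟨1, fun _ => 0, f, le_rfl, fun k => k.elim0, hf, ?_, by simp⟩
    exact (analyticAt_slice hf).analyticOrderAt_eq_zero.1 (by simpa using hm)
  | succ m ih =>
    intro f hf hm
    obtain ⟨N₁, b, hN₁, hb, hb0, hroot⟩ := exists_puiseux_root (m + 1) (by omega) hf hm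
    have hN₁0 : (0 : ℂ) ^ N₁ = 0 := zero_pow (by omega)
    have hb1 : AnalyticAt ℂ (fun p : ℂ × ℂ => b p.1) 0 :=
      AnalyticAt.comp (g := b) (f := Prod.fst) (x := (0 : ℂ × ℂ)) hb analyticAt_fst
    have hG : AnalyticAt ℂ (fun p : ℂ × ℂ => f (p.1 ^ N₁, p.2 + b p.1)) 0 := by
      refine AnalyticAt.comp (g := f) (f := fun p : ℂ × ℂ => (p.1 ^ N₁, p.2 + b p.1)) ?_
        ((analyticAt_fst.pow _).prod (analyticAt_snd.add hb1))
      simpa [hN₁0, hb0, Prod.mk_zero_zero] using hf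
    obtain ⟨h, hh, hGh⟩ := exists_eq_snd_mul hG (by simpa using hroot)
    let f' : ℂ × ℂ → ℂ := fun p => h (p.1, p.2 - b p.1)
    have hf' : AnalyticAt ℂ f' 0 := by
      refine AnalyticAt.comp (g := h) (f := fun p : ℂ × ℂ => (p.1, p.2 - b p.1)) ?_
        (analyticAt_fst.prod (analyticAt_snd.sub hb1))
      simpa [hb0, Prod.mk_zero_zero] using hh
    have hff' : ∀ᶠ p : ℂ × ℂ in 𝓝 0, f (p.1 ^ N₁, p.2) = (p.2 - b p.1) * f' p := by
      have ht : Tendsto (fun p : ℂ × ℂ => (p.1, p.2 - b p.1)) (𝓝 0) (𝓝 0) := by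
        have : ContinuousAt (fun p : ℂ × ℂ => (p.1, p.2 - b p.1)) 0 :=
          continuous_fst.continuousAt.prodMk (continuous_snd.continuousAt.sub hb1.continuousAt)
        simpa [ContinuousAt, hb0, Prod.mk_zero_zero] using this
      filter_upwards [ht.eventually hGh] with p hp
      simpa using hp
    have hm' : analyticOrderAt (fun y => f' (0, y)) 0 = m := by
      have h1 : (fun y => f (0, y)) =ᶠ[𝓝 0] id * fun y => f' (0, y) := by
        have ht : Tendsto (fun y : ℂ => ((0 : ℂ), y)) (𝓝 0) (𝓝 0) :=
          (Continuous.prodMk_right (0 : ℂ)).tendsto' _ _ rfl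
        filter_upwards [ht.eventually hff'] with y hy
        simpa [hN₁0, hb0] using hy
      rw [analyticOrderAt_congr h1, analyticOrderAt_mul analyticAt_id (analyticAt_slice hf'),
        analyticOrderAt_id, add_comm] at hm
      push_cast at hm
      exact (ENat.add_left_injective_of_ne_top (by simp)) hm
    obtain ⟨N₂, a, u, hN₂, ha, hu, hu0, hfac⟩ := ih hf' hm'
    refine ⟨N₂ * N₁, Fin.cons (fun t => b (t ^ N₂)) a, u, Nat.mul_pos hN₂ hN₁, ?_, hu, hu0, ?_⟩
    · intro k
      refine Fin.cases ⟨?_, ?_⟩ (fun k => ?_) k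
      · refine AnalyticAt.comp (g := b) ?_ (analyticAt_id.pow _)
        simpa [zero_pow (show N₂ ≠ 0 by omega)] using hb
      · simp [zero_pow (show N₂ ≠ 0 by omega), hb0]
      · exact ha k
    · have ht : Tendsto (fun p : ℂ × ℂ => (p.1 ^ N₂, p.2)) (𝓝 0) (𝓝 0) :=
        (by fun_prop : Continuous fun p : ℂ × ℂ => (p.1 ^ N₂, p.2)).tendsto' _ _ (by
          simp [zero_pow (show N₂ ≠ 0 by omega)])
      filter_upwards [ht.eventually hff', hfac] with p h1 h2
      rw [Fin.prod_univ_succ]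
      simp only [Fin.cons_zero, Fin.cons_succ]
      rw [pow_mul, h1, h2]
      ring

/-- Partial derivative in the first variable. -/
noncomputable def dx (f : ℂ × ℂ → ℂ) (p : ℂ × ℂ) : ℂ := fderiv ℂ f p (1, 0)

/-- Partial derivative in the second variable. -/
noncomputable def dy (f : ℂ × ℂ → ℂ) (p : ℂ × ℂ) : ℂ := fderiv ℂ f p (0, 1)

lemma fderiv_apply_eq (f : ℂ × ℂ → ℂ) (p v : ℂ × ℂ) :
    fderiv ℂ f p v = v.1 * dx f p + v.2 * dy f p := by
  have : v = v.1 • ((1, 0) : ℂ × ℂ) + v.2 • ((0, 1) : ℂ × ℂ) := by ext <;> simp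
  conv_lhs => rw [this]
  rw [map_add, map_smul, map_smul, dx, dy, smul_eq_mul, smul_eq_mul]

lemma analyticAt_dx {f : ℂ × ℂ → ℂ} {p : ℂ × ℂ} (hf : AnalyticAt ℂ f p) :
    AnalyticAt ℂ (dx f) p := analyticAt_clmApply hf.fderiv analyticAt_const

lemma analyticAt_dy {f : ℂ × ℂ → ℂ} {p : ℂ × ℂ} (hf : AnalyticAt ℂ f p) :
    AnalyticAt ℂ (dy f) p := analyticAt_clmApply hf.fderiv analyticAt_const

lemma hasDerivAt_comp_pair {f : ℂ × ℂ → ℂ} {x y : ℂ → ℂ} {x' y' s : ℂ}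
    (hf : DifferentiableAt ℂ f (x s, y s)) (hx : HasDerivAt x x' s) (hy : HasDerivAt y y' s) :
    HasDerivAt (fun s => f (x s, y s)) (x' * dx f (x s, y s) + y' * dy f (x s, y s)) s := by
  have h := hf.hasFDerivAt.comp_hasDerivAt s (hx.prodMk hy)
  rwa [fderiv_apply_eq] at h

lemma exists_euler_factor {e : ℂ → ℂ} (he : AnalyticAt ℂ e 0) (h0 : e 0 = 0) :
    ∃ (κ : ℕ) (g η : ℂ → ℂ), 1 ≤ κ ∧ AnalyticAt ℂ g 0 ∧ Tendsto η (𝓝 0) (𝓝 0) ∧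
      (∀ᶠ t in 𝓝 0, e t = t ^ κ * g t) ∧ (∀ᶠ t in 𝓝 0, t * deriv e t = (κ + η t) * e t) ∧
      (g 0 ≠ 0 ∨ ∀ᶠ t in 𝓝 0, e t = 0) := by
  obtain ⟨κ, g, hκ, hg, hegt, hg1, -⟩ := exists_pow_mul he h0
  by_cases hg0 : g 0 = 0
  · have h := hg1 hg0
    refine ⟨κ, g, 0, hκ, hg, tendsto_const_nhds, hegt, ?_, Or.inr h⟩
    filter_upwards [h.eventually_nhds] with t ht
    have : deriv e t = 0 := by
      rw [EventuallyEq.deriv_eq (f := fun _ => (0 : ℂ)) ht, deriv_const]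
    rw [this, ht.self_of_nhds]; simp
  · refine ⟨κ, g, fun t => t * deriv g t / g t, hκ, hg, ?_, hegt, ?_, Or.inl hg0⟩
    · have h1 : ContinuousAt (fun t => t * deriv g t / g t) 0 :=
        (continuousAt_id.mul hg.deriv.continuousAt).div hg.continuousAt hg0
      have h2 := h1.tendsto
      simpa using h2
    · filter_upwards [hegt.eventually_nhds, hg.eventually_analyticAt,
        hg.continuousAt.eventually_ne hg0] with t ht hgt hgt0
      have h1 : HasDerivAt e (κ * t ^ (κ - 1) * g t + t ^ κ * deriv g t) t :=
        ((hasDerivAt_pow κ t).mul hgt.differentiableAt.hasDerivAt).congr_of_eventuallyEq ht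
      rw [h1.deriv, ht.self_of_nhds]
      obtain ⟨k, rfl⟩ : ∃ k, κ = k + 1 := ⟨κ - 1, by omega⟩
      field_simp
      simp only [Nat.add_sub_cancel]
      ring

/-- Balancing of the roots of a product: there are no curves along which the logarithmic
derivatives stay this small. -/
lemma false_of_tendsto_logDeriv {ι : Type*} (l : Ultrafilter ι) {m : ℕ} (hm : 1 ≤ m)
    {t y : ι → ℂ} (ht : Tendsto t l (𝓝 0)) (hy : Tendsto y l (𝓝 0)) {a : Fin m → ℂ → ℂ}
    (ha : ∀ k, AnalyticAt ℂ (a k) 0 ∧ a k 0 = 0) (hne : ∀ᶠ i in l, ∀ k, y i - a k (t i) ≠ 0)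
    {c : ℂ} (h1 : Tendsto (fun i => ∑ k, 1 / (y i - a k (t i))) l (𝓝 c))
    (h2 : Tendsto (fun i => ∑ k, t i * deriv (a k) (t i) / (y i - a k (t i))) l (𝓝 0)) :
    False := by
  classical
  have : Nonempty (Fin m) := ⟨⟨0, hm⟩⟩
  obtain ⟨k₀, hk₀⟩ : ∃ k₀, ∀ᶠ i in l, ∀ k, ‖y i - a k₀ (t i)‖ ≤ ‖y i - a k (t i)‖ := by
    rw [← Ultrafilter.eventually_exists_iff]
    refine Eventually.of_forall fun i => ?_
    obtain ⟨k₀, -, h⟩ := Finset.univ.exists_min_image (fun k => ‖y i - a k (t i)‖)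
      Finset.univ_nonempty
    exact ⟨k₀, fun k => h k (Finset.mem_univ k)⟩
  let e : Fin m → ℂ → ℂ := fun k t => a k t - a k₀ t
  have he : ∀ k, AnalyticAt ℂ (e k) 0 := fun k => (ha k).1.sub (ha k₀).1
  have he0 : ∀ k, e k 0 = 0 := fun k => by simp [e, (ha _).2]
  choose κ g η hκ hg hη heg hee hgz using fun k => exists_euler_factor (he k) (he0 k)
  let w : ι → ℂ := fun i => y i - a k₀ (t i)
  let r : Fin m → ι → ℂ := fun k i => e k (t i) / (y i - a k (t i))
  have hak : ∀ k, Tendsto (fun i => a k (t i)) l (𝓝 0) := fun k => by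
    have := (ha k).1.continuousAt.tendsto.comp ht
    rwa [(ha k).2] at this
  have hw : Tendsto w l (𝓝 0) := by simpa using hy.sub (hak k₀)
  have hr1 : ∀ k, ∀ᶠ i in l, 1 + r k i = w i / (y i - a k (t i)) := by
    intro k
    filter_upwards [hne] with i hi
    have := hi k
    simp only [r, w, e]
    field_simp
    ring
  have hrb : ∀ k, ∀ᶠ i in l, r k i ∈ closedBall (0 : ℂ) 2 := by
    intro k
    filter_upwards [hne, hk₀, hr1 k] with i hi hik hir
    have h3 : ‖1 + r k i‖ ≤ 1 := by
      rw [hir, norm_div]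
      exact div_le_one_of_le₀ (hik k) (norm_nonneg _)
    rw [mem_closedBall_zero_iff]
    calc ‖r k i‖ = ‖(1 + r k i) - 1‖ := by ring_nf
      _ ≤ ‖1 + r k i‖ + ‖(1 : ℂ)‖ := norm_sub_le _ _
      _ ≤ 2 := by rw [norm_one]; linarith
  have hlim : ∀ k, ∃ ρ, Tendsto (r k) l (𝓝 ρ) := by
    intro k
    obtain ⟨ρ, -, hρ⟩ := (isCompact_closedBall (0 : ℂ) 2).ultrafilter_le_nhds
      (l.map (r k)) (le_principal_iff.2 (hrb k))
    exact ⟨ρ, hρ⟩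
  choose ρ hρ using hlim
  have hrel : ∀ k, ∀ᶠ i in l, (1 + r k i) * e k (t i) = r k i * w i := by
    intro k
    filter_upwards [hr1 k] with i hi
    rw [hi]; simp only [r]; ring
  have hw0 : ∀ᶠ i in l, w i ≠ 0 := hne.mono fun i hi => hi k₀
  -- first balance
  have hsum1 : ∑ k, (1 + ρ k) = 0 := by
    have h3 : Tendsto (fun i => ∑ k, (1 + r k i)) l (𝓝 (∑ k, (1 + ρ k))) :=
      tendsto_finsetSum _ fun k _ => tendsto_const_nhds.add (hρ k)
    have h4 : Tendsto (fun i => w i * ∑ k, 1 / (y i - a k (t i))) l (𝓝 0) := by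
      simpa using hw.mul h1
    refine tendsto_nhds_unique h3 (h4.congr' ?_)
    filter_upwards [eventually_all.2 hr1] with i hi
    rw [Finset.mul_sum]
    exact Finset.sum_congr rfl fun k _ => by rw [hi k]; ring
  -- second balance
  have hsum2 : ∑ k, (κ k : ℂ) * ρ k = 0 := by
    have h3 : Tendsto (fun i => ∑ k, (κ k + η k (t i)) * r k i) l (𝓝 (∑ k, (κ k : ℂ) * ρ k)) := by
      refine tendsto_finsetSum _ fun k _ => Tendsto.mul ?_ (hρ k)
      simpa using tendsto_const_nhds.add ((hη k).comp ht)
    have h5 : Tendsto (fun i => t i * deriv (a k₀) (t i)) l (𝓝 0) := by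
      have := ht.mul ((ha k₀).1.deriv.continuousAt.tendsto.comp ht)
      simpa using this
    have h4 := h2.sub (h5.mul h1)
    rw [zero_mul, sub_zero] at h4
    refine tendsto_nhds_unique h3 (h4.congr' ?_)
    filter_upwards [ht.eventually (eventually_all.2 hee),
      ht.eventually (eventually_all.2 fun k => (ha k).1.eventually_analyticAt)] with i hi hia
    rw [Finset.mul_sum, ← Finset.sum_sub_distrib]
    refine Finset.sum_congr rfl fun k _ => ?_
    have h6 : deriv (e k) (t i) = deriv (a k) (t i) - deriv (a k₀) (t i) :=
      deriv_fun_sub (hia k).differentiableAt (hia k₀).differentiableAt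
    have h7 := hi k
    rw [h6] at h7
    simp only [r]
    rw [(mul_div_assoc ((κ k : ℂ) + η k (t i)) (e k (t i)) (y i - a k (t i))).symm, ← h7]
    ring
  have hρ0 : ρ k₀ = 0 := by
    refine tendsto_nhds_unique (hρ k₀) (tendsto_const_nhds.congr fun i => ?_)
    simp [r, e]
  obtain ⟨k, hk0, hk1⟩ : ∃ k, ρ k ≠ 0 ∧ 1 + ρ k ≠ 0 := by
    by_contra! h
    have h3 : ∀ k, ∃ n : ℕ, 1 + ρ k = n := by
      intro k
      by_cases hk : ρ k = 0
      · exact ⟨1, by simp [hk]⟩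
      · exact ⟨0, by simp [h k hk]⟩
    choose n hn using h3
    have h4 : ∑ k, n k = 0 := by
      have := hsum1
      simp only [hn] at this
      exact_mod_cast this
    have h5 := (Finset.sum_eq_zero_iff.1 h4) k₀ (Finset.mem_univ _)
    have h6 := hn k₀
    rw [hρ0, h5] at h6
    simp at h6
  have hgt : ∀ j, Tendsto (fun i => g j (t i)) l (𝓝 (g j 0)) := fun j =>
    (hg j).continuousAt.tendsto.comp ht
  have hvanish : ∀ j, (∀ᶠ t in 𝓝 0, e j t = 0) → ρ j = 0 := by
    intro j hj
    refine tendsto_nhds_unique (hρ j) (tendsto_const_nhds.congr' ?_)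
    filter_upwards [ht.eventually hj] with i hi
    simp [r, hi]
  have hgk : g k 0 ≠ 0 := (hgz k).resolve_right fun h => hk0 (hvanish k h)
  -- comparison of the sizes of two roots
  have hcmp : ∀ p q, g q 0 ≠ 0 → κ q < κ p → ρ p * (1 + ρ q) = 0 := by
    intro p q hq hlt
    have hθ : Tendsto (fun i => t i ^ (κ p - κ q) * g p (t i) / g q (t i)) l (𝓝 0) := by
      have := ((ht.pow (κ p - κ q)).mul (hgt p)).div (hgt q) hq
      have h0 : (0 : ℂ) ^ (κ p - κ q) * g p 0 / g q 0 = 0 := by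
        simp [(Nat.sub_pos_of_lt hlt).ne']
      rw [h0] at this
      exact this
    have h3 : Tendsto (fun i => r p i * (1 + r q i)) l (𝓝 (ρ p * (1 + ρ q))) :=
      (hρ p).mul (tendsto_const_nhds.add (hρ q))
    have h4 : Tendsto (fun i => (1 + r p i) * (t i ^ (κ p - κ q) * g p (t i) / g q (t i))
        * r q i) l (𝓝 ((1 + ρ p) * 0 * ρ q)) :=
      ((tendsto_const_nhds.add (hρ p)).mul hθ).mul (hρ q)
    rw [mul_zero, zero_mul] at h4
    refine tendsto_nhds_unique h3 (h4.congr' ?_)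
    filter_upwards [hrel p, hrel q, hw0, ht.eventually (heg p), ht.eventually (heg q),
      (hgt q).eventually_ne hq] with i hp hq' hwi hep heq hgq
    apply mul_right_cancel₀ hwi
    have h5 : e p (t i) = (t i ^ (κ p - κ q) * g p (t i) / g q (t i)) * e q (t i) := by
      rw [hep, heq]
      field_simp
      rw [mul_assoc, ← pow_add, Nat.sub_add_cancel hlt.le, mul_comm]
    rw [h5] at hp
    calc (1 + r p i) * (t i ^ (κ p - κ q) * g p (t i) / g q (t i)) * r q i * w i
        = (1 + r p i) * (t i ^ (κ p - κ q) * g p (t i) / g q (t i)) * (r q i * w i) := by ring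
      _ = (1 + r p i) * ((t i ^ (κ p - κ q) * g p (t i) / g q (t i)) * e q (t i))
          * (1 + r q i) := by rw [← hq']; ring
      _ = _ := by rw [hp]; ring
  have hcase : ∀ j, ∃ n : ℕ, 1 ≤ n ∧ (κ k : ℂ) * (1 + ρ j) - κ j * ρ j = n := by
    intro j
    have hzero : ρ j = 0 → ∃ n : ℕ, 1 ≤ n ∧ (κ k : ℂ) * (1 + ρ j) - κ j * ρ j = n :=
      fun h => ⟨κ k, hκ k, by simp [h]⟩
    rcases hgz j with hj | hj
    · rcases lt_trichotomy (κ k) (κ j) with h | h | h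
      · exact hzero ((mul_eq_zero.1 (hcmp j k hgk h)).resolve_right hk1)
      · exact ⟨κ k, hκ k, by rw [h]; ring⟩
      · have h3 := (mul_eq_zero.1 (hcmp k j hj h)).resolve_left hk0
        have h4 : ρ j = -1 := by linear_combination h3
        exact ⟨κ j, hκ j, by rw [h4]; ring⟩
    · exact hzero (hvanish j hj)
  choose n hn1 hn using hcase
  have h3 : ∑ j, (n j : ℂ) = 0 := by
    simp only [← hn, Finset.sum_sub_distrib, ← Finset.mul_sum, hsum1, hsum2]
    simp
  have h4 : ∑ j, n j = 0 := by exact_mod_cast h3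
  have h5 := (Finset.sum_eq_zero_iff.1 h4) k (Finset.mem_univ _)
  have := hn1 k
  omega

lemma hasDerivAt_prod_logDeriv {m : ℕ} {h : Fin m → ℂ → ℂ} {h' : Fin m → ℂ} {s : ℂ}
    (hd : ∀ k, HasDerivAt (h k) (h' k) s) (h0 : ∀ k, h k s ≠ 0) :
    HasDerivAt (fun s => ∏ k, h k s) ((∏ k, h k s) * ∑ k, h' k / h k s) s := by
  classical
  have := HasDerivAt.fun_finsetProd (u := Finset.univ) (fun k _ => hd k)
  refine this.congr_deriv ?_
  rw [Finset.mul_sum]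
  refine Finset.sum_congr rfl fun k _ => ?_
  rw [← Finset.mul_prod_erase Finset.univ (fun k => h k s) (Finset.mem_univ k), smul_eq_mul]
  have := h0 k
  field_simp

/-- A Łojasiewicz type estimate for the logarithmic gradient. -/
lemma exists_lojasiewicz {f : ℂ × ℂ → ℂ} (hf : AnalyticAt ℂ f 0) {m : ℕ} (hm1 : 1 ≤ m)
    (hm : analyticOrderAt (fun y => f (0, y)) 0 = m) :
    ∃ C : ℝ, 0 < C ∧ ∀ᶠ p in 𝓝 (0 : ℂ × ℂ), ‖f p‖ ≤ C * (‖p.1 * dx f p‖ + ‖dy f p‖) := by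
  by_contra! hcon
  obtain ⟨N, a, u, hN, ha, hu, hu0, hfac⟩ := exists_puiseux_factorization m hf hm
  have hq : Tendsto (fun p : ℂ × ℂ => ((p.1 ^ N, p.2) : ℂ × ℂ)) (𝓝 0) (𝓝 0) := by
    have : Continuous (fun p : ℂ × ℂ => ((p.1 ^ N, p.2) : ℂ × ℂ)) := by fun_prop
    have h := this.tendsto 0
    simpa [(Nat.one_le_iff_ne_zero.1 hN), Prod.mk_zero_zero] using h
  obtain ⟨p, hp0, hp⟩ : ∃ p : ℕ → ℂ × ℂ, Tendsto p atTop (𝓝 0) ∧ ∀ n : ℕ,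
      ((n : ℝ) + 1) * (‖(p n).1 * dx f (p n)‖ + ‖dy f (p n)‖) < ‖f (p n)‖ := by
    have h1 : ∀ n : ℕ, ∃ p : ℂ × ℂ, p ∈ ball (0 : ℂ × ℂ) (1 / ((n : ℝ) + 1)) ∧
        ((n : ℝ) + 1) * (‖p.1 * dx f p‖ + ‖dy f p‖) < ‖f p‖ := by
      intro n
      have h2 := hcon ((n : ℝ) + 1) (by positivity)
      obtain ⟨p, h3, h4⟩ := (h2.and_eventually
        (ball_mem_nhds (0 : ℂ × ℂ) (by positivity : 0 < 1 / ((n : ℝ) + 1)))).exists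
      exact ⟨p, h4, h3⟩
    choose p hpb hp using h1
    refine ⟨p, ?_, hp⟩
    refine squeeze_zero_norm (fun n => (mem_ball_zero_iff.1 (hpb n)).le)
      tendsto_one_div_add_atTop_nhds_zero_nat
  have hroot : ∀ x : ℂ, ∃ t : ℂ, t ^ N = x := fun x =>
    ⟨x ^ ((N : ℂ)⁻¹), Complex.cpow_nat_inv_pow x (Nat.one_le_iff_ne_zero.1 hN)⟩
  choose rt hrt using hroot
  let t : ℕ → ℂ := fun n => rt (p n).1
  let y : ℕ → ℂ := fun n => (p n).2
  have hx0 : Tendsto (fun n => (p n).1) atTop (𝓝 0) := (continuous_fst.tendsto _).comp hp0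
  have hy0 : Tendsto y atTop (𝓝 0) := (continuous_snd.tendsto _).comp hp0
  have ht0 : Tendsto t atTop (𝓝 0) := by
    rw [tendsto_zero_iff_norm_tendsto_zero, Metric.tendsto_atTop]
    intro ε hε
    obtain ⟨n₀, hn₀⟩ := (Metric.tendsto_atTop.1 hx0) (ε ^ N) (by positivity)
    refine ⟨n₀, fun n hn => ?_⟩
    have h1 := hn₀ n hn
    rw [dist_zero_right, ← hrt (p n).1, norm_pow] at h1
    have h2 := lt_of_pow_lt_pow_left₀ N hε.le h1
    simpa using h2
  have hpy : ∀ n, p n = (t n ^ N, y n) := fun n => by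
    ext
    · exact (hrt _).symm
    · rfl
  have hty : Tendsto (fun n => (t n, y n)) atTop (𝓝 (0 : ℂ × ℂ)) := by
    have := ht0.prodMk_nhds hy0
    simpa [Prod.mk_zero_zero] using this
  -- the logarithmic derivatives of the factorization
  have hid : ∀ᶠ q in 𝓝 (0 : ℂ × ℂ), f (q.1 ^ N, q.2) ≠ 0 →
      (∀ k, q.2 - a k q.1 ≠ 0) ∧
      dy f (q.1 ^ N, q.2) = f (q.1 ^ N, q.2) * (dy u q / u q + ∑ k, 1 / (q.2 - a k q.1)) ∧
      N * (q.1 ^ N * dx f (q.1 ^ N, q.2)) = f (q.1 ^ N, q.2) *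
        (q.1 * dx u q / u q - ∑ k, q.1 * deriv (a k) q.1 / (q.2 - a k q.1)) := by
    have hfst : Tendsto (fun q : ℂ × ℂ => q.1) (𝓝 0) (𝓝 0) := continuous_fst.tendsto 0
    filter_upwards [hfac.eventually_nhds, hq.eventually hf.eventually_analyticAt,
      hu.eventually_analyticAt, hu.continuousAt.eventually_ne hu0,
      hfst.eventually (eventually_all.2 fun k => (ha k).1.eventually_analyticAt)]
      with q hqf hfa hua huq haa hfq
    obtain ⟨s, z⟩ := q
    have h0 := hqf.self_of_nhds
    simp only at h0 hfa hua huq haa hfq ⊢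
    have hne : ∀ k, z - a k s ≠ 0 := by
      intro k hk
      apply hfq
      rw [h0, Finset.prod_eq_zero (Finset.mem_univ k) hk, mul_zero]
    refine ⟨hne, ?_, ?_⟩
    · have h1 : HasDerivAt (fun z => f (s ^ N, z)) (0 * dx f (s ^ N, z) + 1 * dy f (s ^ N, z)) z :=
        hasDerivAt_comp_pair (x := fun _ => s ^ N) (y := fun z => z) hfa.differentiableAt
          (hasDerivAt_const _ _) (hasDerivAt_id _)
      have h2 : HasDerivAt (fun z => u (s, z)) (0 * dx u (s, z) + 1 * dy u (s, z)) z :=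
        hasDerivAt_comp_pair (x := fun _ => s) (y := fun z => z) hua.differentiableAt
          (hasDerivAt_const _ _) (hasDerivAt_id _)
      have h3 := hasDerivAt_prod_logDeriv (h := fun k z => z - a k s) (h' := fun _ => 1) (s := z)
        (fun k => (hasDerivAt_id z).sub_const _) hne
      have h4 := h2.mul h3
      have hc : Tendsto (fun z' : ℂ => ((s, z') : ℂ × ℂ)) (𝓝 z) (𝓝 (s, z)) :=
        (Continuous.prodMk_right s).tendsto z
      have h5 := h1.unique (h4.congr_of_eventuallyEq (hc.eventually hqf))
      rw [zero_mul, zero_add, one_mul] at h5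
      rw [h5, h0]
      field_simp
      ring
    · have h1 : HasDerivAt (fun s => f (s ^ N, z))
          ((N * s ^ (N - 1)) * dx f (s ^ N, z) + 0 * dy f (s ^ N, z)) s :=
        hasDerivAt_comp_pair (x := fun s => s ^ N) (y := fun _ => z) hfa.differentiableAt
          (hasDerivAt_pow N s) (hasDerivAt_const _ _)
      have h2 : HasDerivAt (fun s => u (s, z)) (1 * dx u (s, z) + 0 * dy u (s, z)) s :=
        hasDerivAt_comp_pair (x := fun s => s) (y := fun _ => z) hua.differentiableAt
          (hasDerivAt_id _) (hasDerivAt_const _ _)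
      have h3 := hasDerivAt_prod_logDeriv (h := fun k s => z - a k s)
        (h' := fun k => -deriv (a k) s) (s := s)
        (fun k => (haa k).differentiableAt.hasDerivAt.const_sub z) hne
      have h4 := h2.mul h3
      have hc : Tendsto (fun s' : ℂ => ((s', z) : ℂ × ℂ)) (𝓝 s) (𝓝 (s, z)) :=
        (Continuous.prodMk_left z).tendsto s
      have h5 := h1.unique (h4.congr_of_eventuallyEq (hc.eventually hqf))
      have h6 : s ^ N = s * s ^ (N - 1) := by
        rw [← pow_succ', Nat.sub_add_cancel hN]
      have h7 : ∑ k, s * deriv (a k) s / (z - a k s) =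
          - (s * ∑ k, -deriv (a k) s / (z - a k s)) := by
        rw [Finset.mul_sum, ← Finset.sum_neg_distrib]
        exact Finset.sum_congr rfl fun k _ => by ring
      rw [h7, h0]
      calc (N : ℂ) * (s ^ N * dx f (s ^ N, z))
          = s * (N * s ^ (N - 1) * dx f (s ^ N, z) + 0 * dy f (s ^ N, z)) := by
            nth_rewrite 1 [h6]; ring
        _ = _ := by rw [h5]; field_simp; ring
  have hid' := hty.eventually hid
  have hfne : ∀ n, f (t n ^ N, y n) ≠ 0 := by
    intro n h
    have := hp n
    rw [← hpy n] at h
    rw [h, norm_zero] at this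
    exact absurd this (not_lt.2 (by positivity))
  have hU1 : ContinuousAt (fun q => dy u q / u q) 0 :=
    (analyticAt_dy hu).continuousAt.div hu.continuousAt hu0
  have hU2 : ContinuousAt (fun q : ℂ × ℂ => q.1 * dx u q / u q) 0 :=
    (continuousAt_fst.mul (analyticAt_dx hu).continuousAt).div hu.continuousAt hu0
  have hlim : Tendsto (fun n : ℕ => (N : ℝ) * (1 / ((n : ℝ) + 1))) atTop (𝓝 0) := by
    simpa using tendsto_one_div_add_atTop_nhds_zero_nat.const_mul (N : ℝ)
  have hlt : ∀ n : ℕ, ∀ d : ℂ, ‖d‖ ≤ ‖(p n).1 * dx f (p n)‖ + ‖dy f (p n)‖ →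
      ‖d‖ / ‖f (p n)‖ ≤ 1 / ((n : ℝ) + 1) := by
    intro n d hd
    have h1 := hp n
    have h2 : 0 < ‖f (p n)‖ := lt_of_le_of_lt (by positivity) h1
    rw [div_le_div_iff₀ h2 (by positivity), one_mul]
    nlinarith [(Nat.cast_nonneg n : (0 : ℝ) ≤ n)]
  have hT1 : Tendsto (fun n => dy u (t n, y n) / u (t n, y n) + ∑ k, 1 / (y n - a k (t n)))
      atTop (𝓝 0) := by
    refine squeeze_zero_norm' ?_ tendsto_one_div_add_atTop_nhds_zero_nat
    filter_upwards [hid'] with n hn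
    have h1 := (hn (hfne n)).2.1
    have h2 := hlt n (dy f (p n)) (by linarith [norm_nonneg ((p n).1 * dx f (p n))])
    rw [hpy n] at h2
    rw [h1, norm_mul, mul_div_cancel_left₀ _ (norm_ne_zero_iff.2 (hfne n))] at h2
    exact h2
  have hT2 : Tendsto (fun n => t n * dx u (t n, y n) / u (t n, y n) -
      ∑ k, t n * deriv (a k) (t n) / (y n - a k (t n))) atTop (𝓝 0) := by
    refine squeeze_zero_norm' ?_ hlim
    filter_upwards [hid'] with n hn
    have h1 := (hn (hfne n)).2.2
    have h2 := hlt n ((p n).1 * dx f (p n)) (by linarith [norm_nonneg (dy f (p n))])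
    have h3 := mul_le_mul_of_nonneg_left h2 (Nat.cast_nonneg N)
    rw [hpy n] at h3
    rw [← mul_div_assoc, ← Complex.norm_natCast, ← norm_mul, Complex.norm_natCast] at h3
    simp only at h3
    rw [h1, norm_mul, mul_div_cancel_left₀ _ (norm_ne_zero_iff.2 (hfne n))] at h3
    exact h3
  let l : Ultrafilter ℕ := hyperfilter ℕ
  have hl : (l : Filter ℕ) ≤ atTop := by
    rw [← Nat.cofinite_eq_atTop]; exact hyperfilter_le_cofinite
  refine false_of_tendsto_logDeriv l hm1 (ht0.mono_left hl) (hy0.mono_left hl) ha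
    (hl (hid'.mono fun n hn => (hn (hfne n)).1)) (c := 0 - dy u 0 / u 0) ?_ ?_
  · refine Tendsto.mono_left ?_ hl
    refine (hT1.sub (hU1.tendsto.comp hty)).congr fun n => ?_
    simp
  · refine Tendsto.mono_left ?_ hl
    have h1 := (hU2.tendsto.comp hty).sub hT2
    simp only [Prod.fst_zero, zero_mul, zero_div, sub_zero] at h1
    refine h1.congr fun n => ?_
    simp

section LinearFactors

variable {r : ℝ}

/-- The linear polynomial `y - ζ` in the disc algebra. -/
noncomputable def lin (r : ℝ) (ζ : ℂ) : DiscAlg r := discX r - ζ • (1 : DiscAlg r)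

lemma dev_lin (ζ : ℂ) {z : ℂ} (hz : z ∈ closedBall (0 : ℂ) r) : dev (lin r ζ) z = z - ζ := by
  rw [lin, dev_sub _ _ hz, dev_smul _ _ hz, dev_one hz, dev_discX hz, mul_one]

lemma eq_of_dev_eq_of_ne {a b : DiscAlg r} {ζ : ℂ} (hζ : ζ ∈ ball (0 : ℂ) r)
    (h : ∀ z ∈ closedBall (0 : ℂ) r, z ≠ ζ → dev a z = dev b z) : a = b := by
  refine dev_ext fun z hz => ?_
  by_cases hz0 : z = ζ
  · subst hz0
    have hc : ∀ c : DiscAlg r, Tendsto (dev c) (𝓝[≠] z) (𝓝 (dev c z)) := fun c =>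
      ((differentiableOn_dev c).continuousOn.continuousAt
        (isOpen_ball.mem_nhds hζ)).tendsto.mono_left nhdsWithin_le_nhds
    refine tendsto_nhds_unique (hc a) ((hc b).congr' ?_)
    filter_upwards [self_mem_nhdsWithin, nhdsWithin_le_nhds (isOpen_ball.mem_nhds hζ)]
      with w hw hw'
    exact (h w (ball_subset_closedBall hw') hw).symm
  · exact h z hz hz0

lemma lin_mul_cancel {a b : DiscAlg r} {ζ : ℂ} (hζ : ζ ∈ ball (0 : ℂ) r)
    (h : lin r ζ * a = lin r ζ * b) : a = b := by
  refine eq_of_dev_eq_of_ne hζ fun z hz hne => ?_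
  have := congrArg (fun c => dev c z) h
  simp only [dev_mul _ _ hz, dev_lin _ hz] at this
  exact mul_left_cancel₀ (sub_ne_zero.2 hne) this

lemma half_mem_ball (hr : 0 < r) {ζ : ℂ} (hζ : ‖ζ‖ ≤ r / 2) : ζ ∈ ball (0 : ℂ) r := by
  rw [mem_ball_zero_iff]; linarith

lemma norm_le_of_lin_mul (hr : 0 < r) {ζ : ℂ} (hζ : ‖ζ‖ ≤ r / 2) (k : DiscAlg r) :
    ‖k‖ ≤ (2 / r) * ‖lin r ζ * k‖ := by
  refine norm_le_of_dev_le _ (by positivity) fun z hz => ?_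
  have hd : DiffContOnCl ℂ (dev k) (ball 0 r) := by
    refine ⟨differentiableOn_dev k, ?_⟩
    rw [closure_ball _ hr.ne']
    exact continuousOn_dev k
  refine Complex.norm_le_of_forall_mem_frontier_norm_le isBounded_ball hd ?_
    (by rwa [closure_ball _ hr.ne'])
  intro w hw
  rw [frontier_ball _ hr.ne'] at hw
  have hw1 : w ∈ closedBall (0 : ℂ) r := sphere_subset_closedBall hw
  have hw2 : ‖w‖ = r := by simpa using hw
  have h1 := norm_dev_le (lin r ζ * k) hw1
  rw [dev_mul _ _ hw1, dev_lin _ hw1, norm_mul] at h1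
  have h2 : r / 2 ≤ ‖w - ζ‖ := by
    have := norm_sub_norm_le w ζ
    linarith
  have h3 : r / 2 * ‖dev k w‖ ≤ ‖lin r ζ * k‖ :=
    (mul_le_mul_of_nonneg_right h2 (norm_nonneg _)).trans h1
  calc ‖dev k w‖ = (2 / r) * (r / 2 * ‖dev k w‖) := by field_simp
    _ ≤ _ := by gcongr

lemma exists_lin_mul (hr : 0 < r) {ζ : ℂ} (hζ : ‖ζ‖ ≤ r / 2) {h : DiscAlg r}
    (h0 : dev h ζ = 0) : ∃ k, h = lin r ζ * k := by
  have hb := half_mem_ball hr hζ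
  have hd : DifferentiableOn ℂ (dslope (dev h) ζ) (ball 0 r) :=
    (Complex.differentiableOn_dslope (isOpen_ball.mem_nhds hb)).2 (differentiableOn_dev h)
  have hc : ContinuousOn (dslope (dev h) ζ) (closedBall 0 r) :=
    (continuousOn_dslope (mem_of_superset (isOpen_ball.mem_nhds hb) ball_subset_closedBall)).2
      ⟨continuousOn_dev h, (differentiableOn_dev h).differentiableAt (isOpen_ball.mem_nhds hb)⟩
  refine ⟨discMk _ hc hd, dev_ext fun z hz => ?_⟩
  rw [dev_mul _ _ hz, dev_lin _ hz, dev_discMk _ _ hz]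
  have := sub_smul_dslope (dev h) ζ z
  rw [smul_eq_mul, h0, sub_zero] at this
  exact this.symm

lemma norm_lin_le (hr : 0 < r) (hr1 : r ≤ 1 / 2) {ζ : ℂ} (hζ : ‖ζ‖ ≤ r / 2) :
    ‖lin r ζ‖ ≤ 1 := by
  refine norm_le_of_dev_le _ zero_le_one fun z hz => ?_
  rw [dev_lin _ hz]
  rw [mem_closedBall_zero_iff] at hz
  linarith [norm_sub_le z ζ]

/-- The monic polynomial with given roots in the disc algebra. -/
noncomputable def linProd (r : ℝ) (s : Multiset ℂ) : DiscAlg r := (s.map (lin r)).prod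

lemma linProd_zero : linProd r 0 = 1 := by simp [linProd]

lemma linProd_cons (z : ℂ) (s : Multiset ℂ) : linProd r (z ::ₘ s) = lin r z * linProd r s := by
  simp [linProd]

lemma norm_one_discAlg_le : ‖(1 : DiscAlg r)‖ ≤ 1 :=
  norm_le_of_dev_le _ zero_le_one fun z hz => by rw [dev_one hz, norm_one]

lemma norm_linProd_le (hr : 0 < r) (hr1 : r ≤ 1 / 2) (s : Multiset ℂ)
    (hs : ∀ z ∈ s, ‖z‖ ≤ r / 2) : ‖linProd r s‖ ≤ 1 := by
  induction s using Multiset.induction_on with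
  | empty => rw [linProd_zero]; exact norm_one_discAlg_le
  | cons z s ih =>
    rw [linProd_cons]
    refine (norm_mul_le _ _).trans (mul_le_one₀ (norm_lin_le hr hr1 (hs z (by simp)))
      (norm_nonneg _) (ih fun w hw => hs w (by simp [hw])))

lemma dev_linProd_eq_zero_iff (s : Multiset ℂ) {z : ℂ} (hz : z ∈ closedBall (0 : ℂ) r) :
    dev (linProd r s) z = 0 ↔ z ∈ s := by
  induction s using Multiset.induction_on with
  | empty => simp [linProd_zero, dev_one hz]
  | cons w s ih =>
    rw [linProd_cons, dev_mul _ _ hz, mul_eq_zero, ih, dev_lin _ hz, sub_eq_zero,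
      Multiset.mem_cons]

lemma norm_le_of_linProd_mul (hr : 0 < r) (s : Multiset ℂ)
    (hs : ∀ z ∈ s, ‖z‖ ≤ r / 2) (k : DiscAlg r) :
    ‖k‖ ≤ (2 / r) ^ s.card * ‖linProd r s * k‖ := by
  induction s using Multiset.induction_on with
  | empty => simp [linProd_zero]
  | cons z s ih =>
    have h1 := norm_le_of_lin_mul hr (hs z (by simp)) (linProd r s * k)
    have h2 := ih fun w hw => hs w (by simp [hw])
    rw [linProd_cons, Multiset.card_cons, pow_succ, mul_assoc, mul_assoc]
    exact h2.trans (mul_le_mul_of_nonneg_left h1 (by positivity))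

lemma exists_linProd_mul (hr : 0 < r) (s : Multiset ℂ) (hs : ∀ z ∈ s, ‖z‖ ≤ r / 2)
    (hnd : s.Nodup) (h : DiscAlg r) (h0 : ∀ z ∈ s, dev h z = 0) :
    ∃ k, h = linProd r s * k := by
  induction s using Multiset.induction_on generalizing h with
  | empty => exact ⟨h, by simp [linProd_zero]⟩
  | cons z s ih =>
    obtain ⟨k, rfl⟩ := exists_lin_mul hr (hs z (by simp)) (h0 z (by simp))
    rw [Multiset.nodup_cons] at hnd
    obtain ⟨k', rfl⟩ := ih (fun w hw => hs w (by simp [hw])) hnd.2 k fun w hw => by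
      have h1 := h0 w (by simp [hw])
      have hwb := ball_subset_closedBall (half_mem_ball hr (hs w (by simp [hw])))
      rw [dev_mul _ _ hwb, dev_lin _ hwb] at h1
      refine (mul_eq_zero.1 h1).resolve_left (sub_ne_zero.2 ?_)
      rintro rfl
      exact hnd.1 hw
    exact ⟨k', by rw [linProd_cons, mul_assoc]⟩

/-- Cancelling linear factors. -/
lemma exists_sub_of_linProd_mul (hr : 0 < r) {U : DiscAlg r} (hU : IsUnit U) (t : Multiset ℂ)
    (ht : ∀ z ∈ t, ‖z‖ ≤ r / 2) : ∀ (s : Multiset ℂ) (q : DiscAlg r),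
      linProd r t * q = linProd r s * U → ∃ s₁ ≤ s, q = linProd r s₁ * U := by
  induction t using Multiset.induction_on with
  | empty => intro s q h; exact ⟨s, le_rfl, by rw [← h, linProd_zero, one_mul]⟩
  | cons z t ih =>
    intro s q h
    have hzb := half_mem_ball hr (ht z (by simp))
    have hzc := ball_subset_closedBall hzb
    have hz : z ∈ s := by
      rw [← dev_linProd_eq_zero_iff (r := r) s hzc]
      have h1 := congrArg (fun c => dev c z) h
      simp only [linProd_cons, dev_mul _ _ hzc, dev_lin _ hzc, sub_self, zero_mul] at h1
      refine (mul_eq_zero.1 h1.symm).resolve_right fun h2 => ?_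
      obtain ⟨V, hV⟩ := hU.exists_right_inv
      have h3 := congrArg (fun c => dev c z) hV
      simp only [dev_mul _ _ hzc, h2, zero_mul, dev_one hzc] at h3
      exact zero_ne_one h3
    obtain ⟨s', rfl⟩ := Multiset.exists_cons_of_mem hz
    rw [linProd_cons, linProd_cons, mul_assoc, mul_assoc] at h
    obtain ⟨s₁, hs₁, hq⟩ := ih (fun w hw => ht w (by simp [hw])) s' q (lin_mul_cancel hzb h)
    exact ⟨s₁, hs₁.trans (Multiset.le_cons_self _ _), hq⟩

/-- Roots of perturbations of `yⁿ u`. -/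
lemma exists_roots (hr : 0 < r) (hr1 : r ≤ 1 / 2) (n : ℕ) {u : DiscAlg r} (hu : IsUnit u) :
    ∃ K : ℝ, 0 < K ∧ ∀ᶠ Q in 𝓝 (discX r ^ n * u), ∃ s : Multiset ℂ, s.card = n ∧
      (∀ z ∈ s, ‖z‖ ≤ r / 2) ∧ ∃ U, IsUnit U ∧ ‖U‖ ≤ K ∧ ‖Ring.inverse U‖ ≤ K ∧
        Q = linProd r s * U := by
  have hid := eventually_divMap_isEquiv hr n hu
  have hcont : ContinuousAt (fun Q => divInv (r := r) n Q (discX r ^ n)) (discX r ^ n * u) :=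
    (analyticAt_divInv hr n hu).continuousAt.clm_apply continuousAt_const
  obtain ⟨u, rfl⟩ := hu
  have h0 : divInv n (discX r ^ n * (u : DiscAlg r)) (discX r ^ n) = (0, (↑u⁻¹ : DiscAlg r)) := by
    rw [← divInv_divMap hid.self_of_nhds]
    congr 1
    simp only [Pi.zero_apply, zero_smul, Finset.sum_const_zero, zero_add]
    rw [mul_comm, mul_assoc, Units.mul_inv, mul_one]
  have hlim := hcont.tendsto
  rw [h0] at hlim
  have hk : Tendsto (fun Q => (divInv (r := r) n Q (discX r ^ n)).2)
      (𝓝 (discX r ^ n * (u : DiscAlg r))) (𝓝 (↑u⁻¹ : DiscAlg r)) :=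
    (continuous_snd.tendsto _).comp hlim
  have ha : Tendsto (fun Q => (divInv (r := r) n Q (discX r ^ n)).1)
      (𝓝 (discX r ^ n * (u : DiscAlg r))) (𝓝 0) :=
    (continuous_fst.tendsto _).comp hlim
  have hki : Tendsto (fun Q => Ring.inverse (divInv (r := r) n Q (discX r ^ n)).2)
      (𝓝 (discX r ^ n * (u : DiscAlg r))) (𝓝 (u : DiscAlg r)) := by
    have := (NormedRing.inverse_continuousAt u⁻¹).tendsto.comp hk
    rwa [Ring.inverse_unit, inv_inv] at this
  have hε : 0 < (r / 2) ^ n / (n + 1) := by positivity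
  refine ⟨max (‖(u : DiscAlg r)‖ + 1) (‖(↑u⁻¹ : DiscAlg r)‖ + 1), by positivity, ?_⟩
  filter_upwards [hid, hk.eventually (Units.isOpen.mem_nhds u⁻¹.isUnit),
    hk.norm.eventually (gt_mem_nhds (lt_add_one _)),
    hki.norm.eventually (gt_mem_nhds (lt_add_one _)),
    ha.eventually (ball_mem_nhds _ hε)] with Q hQ hunit hn1 hn2 hsmall
  set k := (divInv (r := r) n Q (discX r ^ n)).2
  set a := (divInv (r := r) n Q (discX r ^ n)).1
  have hunit' : IsUnit k := hunit
  have hdiv : ∑ i : Fin n, a i • discX r ^ (i : ℕ) + k * Q = discX r ^ n :=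
    divMap_divInv hQ (discX r ^ n)
  let P : Polynomial ℂ := Polynomial.X ^ n -
    ∑ i : Fin n, Polynomial.C (a i) * Polynomial.X ^ (i : ℕ)
  have hdeg := Polynomial.degree_sum_fin_lt a
  have hPm : P.Monic := Polynomial.monic_X_pow_sub hdeg
  have hPd : P.natDegree = n := by
    apply Polynomial.natDegree_eq_of_degree_eq_some
    rw [Polynomial.degree_sub_eq_left_of_degree_lt (by rwa [Polynomial.degree_X_pow]),
      Polynomial.degree_X_pow]
  have hsplit : P.Splits := IsAlgClosed.splits P
  have hPr := hsplit.eq_prod_roots_of_monic hPm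
  refine ⟨P.roots, by rw [← hsplit.natDegree_eq_card_roots, hPd], ?_, Ring.inverse k,
    hunit'.ringInverse, hn2.le.trans (le_max_left _ _), ?_, ?_⟩
  · intro z hz
    by_contra! hlt
    have hz0 : z ^ n = ∑ i : Fin n, a i * z ^ (i : ℕ) := by
      have := (Polynomial.mem_roots hPm.ne_zero).1 hz
      simp only [P, Polynomial.IsRoot.def, Polynomial.eval_sub, Polynomial.eval_pow,
        Polynomial.eval_X, Polynomial.eval_finsetSum, Polynomial.eval_mul,
        Polynomial.eval_C] at this
      exact sub_eq_zero.1 this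
    have hρ : 0 < r / 2 := by positivity
    have hz1 : 0 < ‖z‖ := hρ.trans hlt
    have h1 : ∀ i : Fin n, ‖a i * z ^ (i : ℕ)‖ * (r / 2) ^ n ≤
        (r / 2) ^ n / (n + 1) * ‖z‖ ^ n := by
      intro i
      have h2 : ‖a i‖ ≤ (r / 2) ^ n / (n + 1) :=
        (norm_le_pi_norm a i).trans (mem_ball_zero_iff.1 hsmall).le
      rw [norm_mul, norm_pow, mul_assoc]
      refine mul_le_mul h2 ?_ (by positivity) hε.le
      have h3 : (r / 2) ^ n ≤ (r / 2) ^ (n - (i : ℕ)) :=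
        pow_le_pow_of_le_one hρ.le (by linarith) (Nat.sub_le _ _)
      calc ‖z‖ ^ (i : ℕ) * (r / 2) ^ n ≤ ‖z‖ ^ (i : ℕ) * ‖z‖ ^ (n - (i : ℕ)) := by
            gcongr
            exact h3.trans (by gcongr)
        _ = ‖z‖ ^ n := by rw [← pow_add, Nat.add_sub_cancel' i.2.le]
    have h4 : ‖z‖ ^ n * (r / 2) ^ n ≤ n * ((r / 2) ^ n / (n + 1) * ‖z‖ ^ n) := by
      calc ‖z‖ ^ n * (r / 2) ^ n = ‖∑ i : Fin n, a i * z ^ (i : ℕ)‖ * (r / 2) ^ n := by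
            rw [← hz0, norm_pow]
        _ ≤ (∑ i : Fin n, ‖a i * z ^ (i : ℕ)‖) * (r / 2) ^ n := by
            gcongr; exact norm_sum_le _ _
        _ ≤ ∑ _i : Fin n, (r / 2) ^ n / (n + 1) * ‖z‖ ^ n := by
            rw [Finset.sum_mul]; exact Finset.sum_le_sum fun i _ => h1 i
        _ = _ := by simp
    have h5 : (0 : ℝ) < ‖z‖ ^ n * (r / 2) ^ n := by positivity
    have h6 : n * ((r / 2) ^ n / (n + 1) * ‖z‖ ^ n) = ‖z‖ ^ n * (r / 2) ^ n * (n / (n + 1)) := by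
      ring
    rw [h6] at h4
    have h7 : (n : ℝ) / (n + 1) < 1 := by
      rw [div_lt_one (by positivity)]; linarith
    nlinarith
  · have h8 : Ring.inverse (Ring.inverse k) = k := by
      obtain ⟨v, hv⟩ := hunit'
      rw [← hv, Ring.inverse_unit, Ring.inverse_unit, inv_inv]
    rw [h8]
    exact hn1.le.trans (le_max_right _ _)
  · have h9 : linProd r P.roots = k * Q := by
      have h10 := congrArg (Polynomial.aeval (discX r)) hPr
      rw [map_multiset_prod, Multiset.map_map] at h10
      have h11 : (P.roots.map ((Polynomial.aeval (discX r)) ∘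
          fun a => Polynomial.X - Polynomial.C a)) = P.roots.map (lin r) := by
        refine Multiset.map_congr rfl fun z _ => ?_
        simp [lin, Algebra.algebraMap_eq_smul_one]
      rw [h11] at h10
      rw [linProd, ← h10]
      simp only [P, map_sub, map_pow, Polynomial.aeval_X, map_sum, map_mul, Polynomial.aeval_C]
      rw [← hdiv]
      simp [Algebra.smul_def]
    rw [h9, mul_comm k, mul_assoc, Ring.mul_inverse_cancel k hunit', mul_one]

end LinearFactors

section

open MeasureTheory

lemma abs_det_restrictScalars_le (d : ℂ) (hd : ‖d‖ < 1) :
    |((ContinuousLinearMap.toSpanSingleton ℂ d).restrictScalars ℝ).det| ≤ 1 := by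
  have h : ((ContinuousLinearMap.toSpanSingleton ℂ d).restrictScalars ℝ).det = ‖d‖ ^ 2 := by
    rw [ContinuousLinearMap.det]
    have h1 : (((ContinuousLinearMap.toSpanSingleton ℂ d).restrictScalars ℝ : ℂ →L[ℝ] ℂ) :
        ℂ →ₗ[ℝ] ℂ) = (LinearMap.mul ℝ ℂ d) := by
      ext; simp [mul_comm]
    rw [h1]
    have h2 := Algebra.norm_apply ℝ d
    rw [Algebra.norm_complex_apply, Complex.normSq_eq_norm_sq] at h2
    rw [h2]
    rfl
  rw [h, abs_of_nonneg (by positivity)]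
  nlinarith [norm_nonneg d]

/-- A holomorphic function on a small disc has a small set of values taken with small
derivative. -/
lemma exists_regular_value {r : ℝ} (hr1 : r < 1) {P Q : ℂ → ℂ}
    (hP : DifferentiableOn ℂ P (ball 0 r)) (hQ : DifferentiableOn ℂ Q (ball 0 r)) :
    ∃ c : ℂ, ‖c‖ < 1 ∧ ∀ y ∈ ball (0 : ℂ) r, P y ≠ 0 → Q y + c * P y = 0 →
      ‖P y‖ ≤ ‖deriv Q y + c * deriv P y‖ := by
  let F : ℂ → ℂ := fun y => Q y / P y
  let A : Set ℂ := {y | y ∈ ball (0 : ℂ) r ∧ P y ≠ 0} ∩ {y | ‖deriv F y‖ < 1}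
  have hPd : ∀ y ∈ ball (0 : ℂ) r, DifferentiableAt ℂ P y := fun y hy =>
    hP.differentiableAt (isOpen_ball.mem_nhds hy)
  have hQd : ∀ y ∈ ball (0 : ℂ) r, DifferentiableAt ℂ Q y := fun y hy =>
    hQ.differentiableAt (isOpen_ball.mem_nhds hy)
  have hAm : MeasurableSet A := by
    refine MeasurableSet.inter ?_ ?_
    · have : IsOpen (ball (0 : ℂ) r ∩ P ⁻¹' {0}ᶜ) :=
        hP.continuousOn.isOpen_inter_preimage isOpen_ball isOpen_compl_singleton
      exact this.measurableSet
    · exact measurableSet_lt (measurable_deriv F).norm measurable_const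
  have hFd : ∀ y ∈ A, HasDerivAt F (deriv F y) y := fun y hy =>
    ((hQd y hy.1.1).div (hPd y hy.1.1) hy.1.2).hasDerivAt
  have himg : volume (F '' A) ≤ volume A := by
    have h1 := addHaar_image_le_lintegral_abs_det_fderiv (volume : Measure ℂ) hAm (f := F)
      (f' := fun y => (ContinuousLinearMap.toSpanSingleton ℂ (deriv F y)).restrictScalars ℝ)
      (fun y hy => ((hFd y hy).hasFDerivAt.restrictScalars ℝ).hasFDerivWithinAt)
    refine h1.trans ?_
    calc ∫⁻ y in A, ENNReal.ofReal |((ContinuousLinearMap.toSpanSingleton ℂ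
          (deriv F y)).restrictScalars ℝ).det| ≤ ∫⁻ _ in A, 1 := by
          refine setLIntegral_mono measurable_const fun y hy => ?_
          rw [← ENNReal.ofReal_one]
          exact ENNReal.ofReal_le_ofReal (abs_det_restrictScalars_le _ hy.2)
      _ = volume A := by simp
  have hlt : volume (F '' A) < volume (ball (0 : ℂ) 1) := by
    refine (himg.trans (measure_mono fun y hy => hy.1.1)).trans_lt ?_
    rw [Complex.volume_ball, Complex.volume_ball]
    refine ENNReal.mul_lt_mul_left ?_ ?_ ?_
    · simpa using NNReal.pi_ne_zero
    · simp
    · rw [ENNReal.ofReal_one, one_pow]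
      refine pow_lt_one₀ (by simp) ?_ (by norm_num)
      rw [← ENNReal.ofReal_one]
      exact (ENNReal.ofReal_lt_ofReal_iff one_pos).2 hr1
  obtain ⟨d, hd, hdF⟩ : ∃ d ∈ ball (0 : ℂ) 1, d ∉ F '' A := by
    by_contra! h
    exact absurd (measure_mono h) (not_le.2 hlt)
  refine ⟨-d, by simpa using hd, fun y hy hy0 hyd => ?_⟩
  have hFy : F y = d := by
    simp only [F]
    rw [div_eq_iff hy0]
    linear_combination hyd
  have hge : 1 ≤ ‖deriv F y‖ := by
    by_contra! h
    exact hdF ⟨y, ⟨⟨hy, hy0⟩, h⟩, hFy⟩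
  have hder : deriv F y = (deriv Q y + -d * deriv P y) / P y := by
    have h1 : deriv F y = (deriv Q y * P y - Q y * deriv P y) / P y ^ 2 :=
      deriv_fun_div (hQd y hy) (hPd y hy) hy0
    have h2 : Q y = d * P y := by linear_combination hyd
    rw [h1, h2]
    field_simp
    ring
  rw [hder, norm_div, le_div_iff₀ (norm_pos_iff.2 hy0), one_mul] at hge
  exact hge

end

section Interpolation

variable {r : ℝ}

lemma dev_bound_of_ne (hr : 0 < r) {p q f : DiscAlg r} {C : ℝ} {ζ : ℂ} (hζ : ‖ζ‖ ≤ r / 2)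
    (h : ∀ z ∈ closedBall (0 : ℂ) r, z ≠ ζ → ‖dev f z‖ ≤ C * (‖dev p z‖ + ‖dev q z‖)) :
    ∀ z ∈ closedBall (0 : ℂ) r, ‖dev f z‖ ≤ C * (‖dev p z‖ + ‖dev q z‖) := by
  intro z hz
  by_cases hz0 : z = ζ
  · subst hz0
    have hb := half_mem_ball hr hζ
    have hc : ∀ c : DiscAlg r, Tendsto (dev c) (𝓝[≠] z) (𝓝 (dev c z)) := fun c =>
      ((differentiableOn_dev c).continuousOn.continuousAt
        (isOpen_ball.mem_nhds hb)).tendsto.mono_left nhdsWithin_le_nhds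
    refine le_of_tendsto_of_tendsto (hc f).norm (((hc p).norm.add (hc q).norm).const_mul C) ?_
    filter_upwards [self_mem_nhdsWithin, nhdsWithin_le_nhds (isOpen_ball.mem_nhds hb)]
      with w hw hw'
    exact h w (ball_subset_closedBall hw') hw
  · exact h z hz hz0

lemma dev_ne_zero_of_isUnit {U : DiscAlg r} (hU : IsUnit U) {z : ℂ}
    (hz : z ∈ closedBall (0 : ℂ) r) : dev U z ≠ 0 := by
  obtain ⟨V, hV⟩ := hU.exists_right_inv
  intro h
  have h3 := congrArg (fun c => dev c z) hV
  simp only [dev_mul _ _ hz, h, zero_mul, dev_one hz] at h3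
  exact zero_ne_one h3

/-- Removing the common zeros of two functions. -/
lemma exists_coprime_factor (hr : 0 < r) {U : DiscAlg r} (hU : IsUnit U) {C : ℝ} (n : ℕ) :
    ∀ (s : Multiset ℂ) (p q f : DiscAlg r), s.card = n → (∀ z ∈ s, ‖z‖ ≤ r / 2) →
      q = linProd r s * U →
      (∀ z ∈ closedBall (0 : ℂ) r, ‖dev f z‖ ≤ C * (‖dev p z‖ + ‖dev q z‖)) →
      ∃ (t : Multiset ℂ) (p₁ q₁ f₁ : DiscAlg r), (∀ z ∈ t, ‖z‖ ≤ r / 2) ∧ t.card ≤ n ∧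
        p = linProd r t * p₁ ∧ q = linProd r t * q₁ ∧ f = linProd r t * f₁ ∧
        (∀ z ∈ closedBall (0 : ℂ) r, ‖dev f₁ z‖ ≤ C * (‖dev p₁ z‖ + ‖dev q₁ z‖)) ∧
        ∀ z ∈ closedBall (0 : ℂ) r, dev q₁ z = 0 → dev p₁ z ≠ 0 := by
  induction n with
  | zero =>
    intro s p q f hs _ hq hb
    rw [Multiset.card_eq_zero] at hs
    subst hs
    rw [linProd_zero, one_mul] at hq
    exact ⟨0, p, q, f, by simp, by simp, by simp [linProd_zero], by simp [linProd_zero],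
      by simp [linProd_zero], hb, fun z hz h => absurd (hq ▸ h) (dev_ne_zero_of_isUnit hU hz)⟩
  | succ n ih =>
    intro s p q f hcard hs hq hb
    by_cases hp : ∃ z ∈ s, dev p z = 0
    · obtain ⟨z, hzs, hpz⟩ := hp
      have hz := hs z hzs
      have hzc := ball_subset_closedBall (half_mem_ball hr hz)
      obtain ⟨s', rfl⟩ := Multiset.exists_cons_of_mem hzs
      have hqz : dev q z = 0 := by
        rw [hq, dev_mul _ _ hzc, (dev_linProd_eq_zero_iff _ hzc).2 hzs, zero_mul]
      have hfz : dev f z = 0 := by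
        have := hb z hzc
        rw [hpz, hqz] at this
        simpa using this
      obtain ⟨p', rfl⟩ := exists_lin_mul hr hz hpz
      obtain ⟨f', rfl⟩ := exists_lin_mul hr hz hfz
      rw [linProd_cons, mul_assoc] at hq
      subst hq
      obtain ⟨t, p₁, q₁, f₁, ht, htn, hp1, hq1, hf1, hb1, hc1⟩ := ih s' p' _ f' (by simpa using hcard)
        (fun w hw => hs w (by simp [hw])) rfl (dev_bound_of_ne hr hz fun w hw hne => by
          have h1 := hb w hw
          simp only [dev_mul _ _ hw, dev_lin _ hw, norm_mul] at h1 ⊢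
          have h2 : 0 < ‖w - z‖ := norm_pos_iff.2 (sub_ne_zero.2 hne)
          refine le_of_mul_le_mul_left (h1.trans (le_of_eq ?_)) h2
          ring)
      refine ⟨z ::ₘ t, p₁, q₁, f₁, ?_, by simpa using htn, ?_, ?_, ?_, hb1, hc1⟩
      · intro w hw
        rcases Multiset.mem_cons.1 hw with rfl | hw
        · exact hz
        · exact ht w hw
      · rw [linProd_cons, mul_assoc, ← hp1]
      · rw [linProd_cons, mul_assoc, ← hq1]
      · rw [linProd_cons, mul_assoc, ← hf1]
    · push Not at hp
      refine ⟨0, p, q, f, by simp, by simp, by simp [linProd_zero], by simp [linProd_zero],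
        by simp [linProd_zero], hb, fun z hz h => hp z ?_⟩
      rw [hq, dev_mul _ _ hz] at h
      exact (dev_linProd_eq_zero_iff _ hz).1
        ((mul_eq_zero.1 h).resolve_right (dev_ne_zero_of_isUnit hU hz))

/-- Interpolation with uniform bounds. -/
lemma exists_bounded_interpolation (hr : 0 < r) (hr1 : r ≤ 1 / 2) (n : ℕ) {u : DiscAlg r}
    (hu : IsUnit u) {C : ℝ} (hC : 0 ≤ C) :
    ∃ M δ : ℝ, 0 < δ ∧ ∀ p q f : DiscAlg r, ‖q - discX r ^ n * u‖ < δ → ‖p‖ < δ → ‖f‖ ≤ 1 →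
      (∀ z ∈ closedBall (0 : ℂ) r, ‖dev f z‖ ≤ C * (‖dev p z‖ + ‖dev q z‖)) →
      ∃ a k : DiscAlg r, ‖a‖ ≤ M ∧ f ^ 2 = a * p + k * q := by
  classical
  obtain ⟨K, hK, hroots⟩ := exists_roots hr hr1 n hu
  obtain ⟨ε, hε, hball⟩ := Metric.eventually_nhds_iff_ball.1 hroots
  set B : ℝ := (2 / r) ^ n with hB
  set A : ℝ := n * (4 * C ^ 2 * K) with hA
  have h2r : 1 ≤ 2 / r := by rw [le_div_iff₀ hr]; linarith
  have hB0 : 0 ≤ B := by positivity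
  refine ⟨1 * (A + 1 * (K * (B * (B ^ 2 + A * B)))), min (ε / 2) 1, by positivity, ?_⟩
  intro p q f hq hp hf hbd
  have hq' := hq.trans_le (min_le_left _ _)
  have hp' := hp.trans_le (min_le_left _ _)
  have hp1 := (hp.trans_le (min_le_right _ _)).le
  obtain ⟨s, hsn, hs, U, hU, -, -, hqU⟩ := hball q (by rw [mem_ball_iff_norm]; linarith)
  obtain ⟨t, p₁, q₁, f₁, ht, htn, hpe, hqe, hfe, hbd₁, hcop⟩ :=
    exists_coprime_factor hr hU n s p q f hsn hs hqU hbd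
  obtain ⟨c, hc1, hc⟩ := exists_regular_value (by linarith) (differentiableOn_dev p₁)
    (differentiableOn_dev q₁)
  obtain ⟨s₂, hs₂n, hs₂, U₂, hU₂, hU₂K, hU₂i, hQ⟩ := hball (q + c • p) (by
    rw [mem_ball_iff_norm]
    calc ‖q + c • p - discX r ^ n * u‖ = ‖(q - discX r ^ n * u) + c • p‖ := by ring_nf
      _ ≤ ‖q - discX r ^ n * u‖ + ‖c‖ * ‖p‖ := by
        rw [← norm_smul]; exact norm_add_le _ _
      _ < ε := by nlinarith [norm_nonneg p])
  obtain ⟨s₁, hs₁, hQ₁⟩ := exists_sub_of_linProd_mul hr hU₂ t ht s₂ (q₁ + c • p₁) (by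
    rw [← hQ, hqe, hpe, mul_add, mul_smul_comm])
  have hs₁r : ∀ z ∈ s₁, ‖z‖ ≤ r / 2 := fun z hz => hs₂ z (Multiset.mem_of_le hs₁ hz)
  have hs₁n : s₁.card ≤ n := hs₂n ▸ Multiset.card_le_card hs₁
  have hmemc : ∀ z ∈ s₁, z ∈ closedBall (0 : ℂ) r := fun z hz =>
    ball_subset_closedBall (half_mem_ball hr (hs₁r z hz))
  have hQz : ∀ z ∈ s₁, dev q₁ z = -(c * dev p₁ z) := by
    intro z hz
    have h1 := congrArg (fun h => dev h z) hQ₁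
    simp only [dev_add _ _ (hmemc z hz), dev_smul _ _ (hmemc z hz), dev_mul _ _ (hmemc z hz),
      (dev_linProd_eq_zero_iff _ (hmemc z hz)).2 hz, zero_mul] at h1
    linear_combination h1
  have hpz : ∀ z ∈ s₁, dev p₁ z ≠ 0 := by
    intro z hz h
    refine hcop z (hmemc z hz) ?_ h
    rw [hQz z hz, h, mul_zero, neg_zero]
  have hder : ∀ z ∈ s₁, ‖dev p₁ z‖ ≤ ‖dev (linProd r (s₁.erase z)) z‖ * K := by
    intro z hz
    have hzb := half_mem_ball hr (hs₁r z hz)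
    have h1 := hc z hzb (hpz z hz) (by rw [hQz z hz]; ring)
    have hdiff : ∀ h : DiscAlg r, DifferentiableAt ℂ (dev h) z := fun h =>
      (differentiableOn_dev h).differentiableAt (isOpen_ball.mem_nhds hzb)
    have h2 : HasDerivAt (fun w => dev q₁ w + c * dev p₁ w)
        (deriv (dev q₁) z + c * deriv (dev p₁) z) z :=
      (hdiff q₁).hasDerivAt.add ((hdiff p₁).hasDerivAt.const_mul c)
    have h3 : HasDerivAt (fun w => (w - z) * dev (linProd r (s₁.erase z) * U₂) w)
        (1 * dev (linProd r (s₁.erase z) * U₂) z +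
          (z - z) * deriv (dev (linProd r (s₁.erase z) * U₂)) z) z :=
      ((hasDerivAt_id z).sub_const z).mul (hdiff _).hasDerivAt
    have h4 : (fun w => dev q₁ w + c * dev p₁ w) =ᶠ[𝓝 z]
        fun w => (w - z) * dev (linProd r (s₁.erase z) * U₂) w := by
      filter_upwards [isOpen_ball.mem_nhds hzb] with w hw
      have hwc := ball_subset_closedBall hw
      have h5 := congrArg (fun h => dev h w) hQ₁
      simp only [dev_add _ _ hwc, dev_smul _ _ hwc] at h5
      rw [h5, ← Multiset.cons_erase hz, linProd_cons, mul_assoc, dev_mul _ _ hwc, dev_lin _ hwc,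
        Multiset.erase_cons_head]
    have h6 := h2.unique (h3.congr_of_eventuallyEq h4)
    rw [sub_self, zero_mul, add_zero, one_mul, dev_mul _ _ (hmemc z hz)] at h6
    rw [h6, norm_mul] at h1
    exact h1.trans (mul_le_mul_of_nonneg_left
      ((norm_dev_le U₂ (hmemc z hz)).trans hU₂K) (norm_nonneg _))
  have hDne : ∀ z ∈ s₁, dev (linProd r (s₁.erase z)) z ≠ 0 := by
    intro z hz h
    have h1 := hder z hz
    rw [h, norm_zero, zero_mul] at h1
    exact hpz z hz (norm_le_zero_iff.1 h1)
  have hnd : s₁.Nodup := by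
    rw [Multiset.nodup_iff_count_le_one]
    intro z
    by_contra! h
    have hz : z ∈ s₁ := Multiset.count_pos.1 (by omega)
    refine hDne z hz ((dev_linProd_eq_zero_iff _ (hmemc z hz)).2 ?_)
    rw [← Multiset.count_pos, Multiset.count_erase_self]
    omega
  let a₁ : DiscAlg r := ∑ z ∈ s₁.toFinset,
    (dev f₁ z ^ 2 / (dev p₁ z * dev (linProd r (s₁.erase z)) z)) • linProd r (s₁.erase z)
  have ha₁ : ‖a₁‖ ≤ A := by
    have h1 : ∀ z ∈ s₁.toFinset,
        ‖(dev f₁ z ^ 2 / (dev p₁ z * dev (linProd r (s₁.erase z)) z)) •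
          linProd r (s₁.erase z)‖ ≤ 4 * C ^ 2 * K := by
      intro z hz
      rw [Multiset.mem_toFinset] at hz
      have h2 : ‖linProd r (s₁.erase z)‖ ≤ 1 := norm_linProd_le hr hr1 _ fun w hw =>
        hs₁r w (Multiset.mem_of_mem_erase hw)
      have h3 : ‖dev f₁ z‖ ≤ 2 * C * ‖dev p₁ z‖ := by
        have h4 := hbd₁ z (hmemc z hz)
        rw [hQz z hz, norm_neg, norm_mul] at h4
        have h5 : ‖c‖ * ‖dev p₁ z‖ ≤ ‖dev p₁ z‖ :=
          mul_le_of_le_one_left (norm_nonneg _) hc1.le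
        nlinarith
      have hp0 := norm_pos_iff.2 (hpz z hz)
      have hD0 := norm_pos_iff.2 (hDne z hz)
      have h6 : ‖dev f₁ z ^ 2 / (dev p₁ z * dev (linProd r (s₁.erase z)) z)‖ ≤ 4 * C ^ 2 * K := by
        rw [norm_div, norm_pow, norm_mul, div_le_iff₀ (by positivity)]
        calc ‖dev f₁ z‖ ^ 2 ≤ (2 * C * ‖dev p₁ z‖) ^ 2 := by gcongr
          _ = 4 * C ^ 2 * ‖dev p₁ z‖ * ‖dev p₁ z‖ := by ring
          _ ≤ 4 * C ^ 2 * ‖dev p₁ z‖ * (‖dev (linProd r (s₁.erase z)) z‖ * K) := by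
            gcongr; exact hder z hz
          _ = _ := by ring
      rw [norm_smul]
      calc _ ≤ 4 * C ^ 2 * K * 1 := mul_le_mul h6 h2 (norm_nonneg _) (by positivity)
        _ = _ := mul_one _
    refine (norm_sum_le_of_le _ h1).trans ?_
    rw [Finset.sum_const, nsmul_eq_mul, hA]
    gcongr
    exact_mod_cast (Multiset.toFinset_card_le s₁).trans hs₁n
  have ha₁z : ∀ z ∈ s₁, dev a₁ z = dev f₁ z ^ 2 / dev p₁ z := by
    intro z hz
    simp only [a₁, dev_sum _ _ (hmemc z hz), dev_smul _ _ (hmemc z hz)]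
    rw [Finset.sum_eq_single z]
    · have h1 := hDne z hz
      have h2 := hpz z hz
      field_simp
    · intro w hw hne
      rw [(dev_linProd_eq_zero_iff _ (hmemc z hz)).2, mul_zero]
      exact (Multiset.mem_erase_of_ne (Ne.symm hne)).2 hz
    · intro h
      exact absurd (Multiset.mem_toFinset.2 hz) h
  obtain ⟨b, hb⟩ := exists_linProd_mul hr s₁ hs₁r hnd (f₁ ^ 2 - a₁ * p₁) fun z hz => by
    rw [dev_sub _ _ (hmemc z hz), dev_pow _ _ (hmemc z hz), dev_mul _ _ (hmemc z hz), ha₁z z hz,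
      div_mul_cancel₀ _ (hpz z hz), sub_self]
  have hBt : (2 / r) ^ t.card ≤ B := pow_le_pow_right₀ h2r htn
  have hf₁ : ‖f₁‖ ≤ B := by
    have h1 := norm_le_of_linProd_mul hr t ht f₁
    rw [← hfe] at h1
    calc ‖f₁‖ ≤ _ := h1
      _ ≤ B * 1 := mul_le_mul hBt hf (norm_nonneg _) hB0
      _ = B := mul_one _
  have hp₁ : ‖p₁‖ ≤ B := by
    have h1 := norm_le_of_linProd_mul hr t ht p₁
    rw [← hpe] at h1
    calc ‖p₁‖ ≤ _ := h1
      _ ≤ B * 1 := mul_le_mul hBt hp1 (norm_nonneg _) hB0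
      _ = B := mul_one _
  have hA0 : 0 ≤ A := by positivity
  have hbn : ‖b‖ ≤ B * (B ^ 2 + A * B) := by
    have h1 := norm_le_of_linProd_mul hr s₁ hs₁r b
    rw [← hb] at h1
    refine h1.trans (mul_le_mul (pow_le_pow_right₀ h2r hs₁n) ?_ (norm_nonneg _) hB0)
    refine (norm_sub_le _ _).trans (add_le_add ?_ ?_)
    · rw [pow_two, pow_two]
      exact (norm_mul_le _ _).trans (mul_le_mul hf₁ hf₁ (norm_nonneg _) hB0)
    · exact (norm_mul_le _ _).trans (mul_le_mul ha₁ hp₁ (norm_nonneg _) hA0)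
  set b₁ : DiscAlg r := Ring.inverse U₂ * b with hb₁
  have hb₁n : ‖b₁‖ ≤ K * (B * (B ^ 2 + A * B)) :=
    (norm_mul_le _ _).trans (mul_le_mul hU₂i hbn (norm_nonneg _) hK.le)
  have hmain : f₁ ^ 2 = a₁ * p₁ + b₁ * (q₁ + c • p₁) := by
    have h1 : b₁ * (q₁ + c • p₁) = linProd r s₁ * b := by
      rw [hQ₁, hb₁]
      calc Ring.inverse U₂ * b * (linProd r s₁ * U₂)
          = (Ring.inverse U₂ * U₂) * (linProd r s₁ * b) := by ring
        _ = _ := by rw [Ring.inverse_mul_cancel _ hU₂, one_mul]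
    rw [h1, ← hb]; ring
  refine ⟨linProd r t * (a₁ + c • b₁), linProd r t * b₁, ?_, ?_⟩
  · refine (norm_mul_le _ _).trans (mul_le_mul (norm_linProd_le hr hr1 t ht) ?_ (norm_nonneg _)
      zero_le_one)
    refine (norm_add_le _ _).trans (add_le_add ha₁ ?_)
    rw [norm_smul]
    exact mul_le_mul hc1.le hb₁n (norm_nonneg _) zero_le_one
  · rw [hfe, hpe, hqe, mul_pow, hmain]
    simp only [Algebra.smul_def]
    ring

/-- Interpolation by polynomials with uniformly bounded coefficients. -/
lemma exists_bounded_coeffs (hr : 0 < r) (hr1 : r ≤ 1 / 2) (n : ℕ) {u : DiscAlg r}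
    (hu : IsUnit u) {C : ℝ} (hC : 0 ≤ C) :
    ∃ M δ : ℝ, 0 < δ ∧ ∀ p q f : DiscAlg r, ‖q - discX r ^ n * u‖ < δ → ‖p‖ < δ → ‖f‖ ≤ 1 →
      (∀ z ∈ closedBall (0 : ℂ) r, ‖dev f z‖ ≤ C * (‖dev p z‖ + ‖dev q z‖)) →
      ∃ (α : Fin n → ℂ) (k : DiscAlg r), ‖α‖ ≤ M ∧
        f ^ 2 = (∑ i : Fin n, α i • discX r ^ (i : ℕ)) * p + k * q := by
  obtain ⟨M, δ, hδ, h⟩ := exists_bounded_interpolation hr hr1 n hu hC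
  have hcont := (analyticAt_divInv hr n hu).continuousAt.norm
  obtain ⟨ε, hε, hball⟩ := Metric.eventually_nhds_iff_ball.1
    ((eventually_divMap_isEquiv hr n hu).and
      (hcont.tendsto.eventually (gt_mem_nhds (lt_add_one _))))
  refine ⟨(‖divInv n (discX r ^ n * u)‖ + 1) * M, min δ ε, lt_min hδ hε, ?_⟩
  intro p q f hq hp hf hbd
  obtain ⟨a, k, ha, hfa⟩ := h p q f (hq.trans_le (min_le_left _ _))
    (hp.trans_le (min_le_left _ _)) hf hbd
  obtain ⟨heq, hn⟩ := hball q (by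
    rw [mem_ball_iff_norm]; exact hq.trans_le (min_le_right _ _))
  refine ⟨(divInv n q a).1, (divInv n q a).2 * p + k, ?_, ?_⟩
  · calc ‖(divInv n q a).1‖ ≤ ‖divInv n q a‖ := norm_fst_le _
      _ ≤ ‖divInv n q‖ * ‖a‖ := ContinuousLinearMap.le_opNorm _ _
      _ ≤ _ := mul_le_mul hn.le ha (norm_nonneg _) (by positivity)
  · have h1 := divMap_divInv heq a
    rw [hfa]
    nth_rewrite 1 [← h1]
    ring

end Interpolation

lemma natCast_le_analyticOrderAt_of_bound {w : ℂ → ℂ} (hw : AnalyticAt ℂ w 0) {k : ℕ} {B : ℝ}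
    (h : ∀ᶠ x in 𝓝[≠] (0 : ℂ), ‖w x‖ ≤ B * ‖x‖ ^ k) : (k : ℕ∞) ≤ analyticOrderAt w 0 := by
  by_contra! hlt
  have hne : analyticOrderAt w 0 ≠ ⊤ := ne_top_of_lt hlt
  obtain ⟨l, hl⟩ := ENat.ne_top_iff_exists.1 hne
  rw [← hl] at hlt
  have hlk : l < k := by exact_mod_cast hlt
  obtain ⟨g, hg, hg0, hwg⟩ := (AnalyticAt.analyticOrderAt_eq_natCast hw).1 hl.symm
  have h1 : Tendsto (fun x : ℂ => B * ‖x‖ ^ (k - l)) (𝓝[≠] 0) (𝓝 0) := by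
    have h2 : Continuous (fun x : ℂ => B * ‖x‖ ^ (k - l)) := by fun_prop
    have h3 := h2.tendsto 0
    rw [norm_zero, zero_pow (Nat.sub_pos_of_lt hlk).ne', mul_zero] at h3
    exact h3.mono_left nhdsWithin_le_nhds
  refine hg0 (tendsto_nhds_unique (hg.continuousAt.tendsto.mono_left nhdsWithin_le_nhds)
    (squeeze_zero_norm' ?_ h1))
  filter_upwards [h, nhdsWithin_le_nhds hwg, self_mem_nhdsWithin] with x hx hx2 hx0
  have hx0' : 0 < ‖x‖ := norm_pos_iff.2 hx0
  rw [hx2, sub_zero, smul_eq_mul, norm_mul, norm_pow] at hx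
  refine le_of_mul_le_mul_left ?_ (pow_pos hx0' l)
  calc ‖x‖ ^ l * ‖g x‖ ≤ B * ‖x‖ ^ k := hx
    _ = ‖x‖ ^ l * (B * ‖x‖ ^ (k - l)) := by
      rw [← Nat.add_sub_cancel' hlk.le, pow_add, Nat.add_sub_cancel_left]; ring

lemma eventually_nhds_zero_of_punctured {w : ℂ → ℂ} (hw : AnalyticAt ℂ w 0)
    (h : ∀ᶠ x in 𝓝[≠] (0 : ℂ), w x = 0) : ∀ᶠ x in 𝓝 (0 : ℂ), w x = 0 :=
  hw.frequently_zero_iff_eventually_zero.1 h.frequently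

/-- An analytic linear system with bounded solutions has an analytic solution. -/
lemma exists_analytic_solution {ι : Type*} [Fintype ι] (n : ℕ) :
    ∀ (A : ι → Fin n → ℂ → ℂ) (w : ι → ℂ → ℂ), (∀ i j, AnalyticAt ℂ (A i j) 0) →
      (∀ i, AnalyticAt ℂ (w i) 0) → (∃ B : ℝ, ∀ᶠ x in 𝓝[≠] (0 : ℂ), ∃ α : Fin n → ℂ,
        ‖α‖ ≤ B ∧ ∀ i, ∑ j, A i j x * α j = w i x) →
      ∃ a : Fin n → ℂ → ℂ, (∀ j, AnalyticAt ℂ (a j) 0) ∧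
        ∀ᶠ x in 𝓝 (0 : ℂ), ∀ i, ∑ j, A i j x * a j x = w i x := by
  classical
  induction n with
  | zero =>
    rintro A w - hw ⟨B, hB⟩
    refine ⟨fun _ _ => 0, fun _ => analyticAt_const, eventually_all.2 fun i => ?_⟩
    have h1 : ∀ᶠ x in 𝓝[≠] (0 : ℂ), w i x = 0 := by
      filter_upwards [hB] with x hx
      obtain ⟨α, -, h⟩ := hx
      simpa using (h i).symm
    filter_upwards [eventually_nhds_zero_of_punctured (hw i) h1] with x hx
    simp [hx]
  | succ n ih =>
    rintro A w hA hw ⟨B, hB⟩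
    by_cases hall : ∀ i j, analyticOrderAt (A i j) 0 = ⊤
    · refine ⟨fun _ _ => 0, fun _ => analyticAt_const, eventually_all.2 fun i => ?_⟩
      have h0 : ∀ᶠ x in 𝓝 (0 : ℂ), ∀ j, A i j x = 0 :=
        eventually_all.2 fun j => analyticOrderAt_eq_top.1 (hall i j)
      have h1 : ∀ᶠ x in 𝓝[≠] (0 : ℂ), w i x = 0 := by
        filter_upwards [hB, nhdsWithin_le_nhds h0] with x hx hx0
        obtain ⟨α, -, h⟩ := hx
        rw [← h i]
        simp [hx0]
      filter_upwards [eventually_nhds_zero_of_punctured (hw i) h1] with x hx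
      simp [hx]
    push Not at hall
    obtain ⟨i₁, j₁, h₁⟩ := hall
    obtain ⟨⟨i₀, j₀⟩, -, hmin⟩ := (Finset.univ : Finset (ι × Fin (n + 1))).exists_min_image
      (fun q => analyticOrderAt (A q.1 q.2) 0) ⟨(i₁, j₁), Finset.mem_univ _⟩
    have hmin' : ∀ i j, analyticOrderAt (A i₀ j₀) 0 ≤ analyticOrderAt (A i j) 0 := fun i j =>
      hmin (i, j) (Finset.mem_univ _)
    obtain ⟨k, hk⟩ := ENat.ne_top_iff_exists.1 (ne_top_of_le_ne_top h₁ (hmin' i₁ j₁))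
    rw [← hk] at hmin'
    choose D hD hAD using fun i j => (natCast_le_analyticOrderAt (hA i j)).1 (hmin' i j)
    have hAD' : ∀ᶠ x in 𝓝 (0 : ℂ), ∀ i j, A i j x = x ^ k * D i j x :=
      eventually_all.2 fun i => eventually_all.2 fun j => by simpa using hAD i j
    have hD0 : D i₀ j₀ 0 ≠ 0 := by
      intro h0
      obtain ⟨g, hg, hg0, hAg⟩ := (AnalyticAt.analyticOrderAt_eq_natCast (hA i₀ j₀)).1 hk.symm
      have h2 : ∀ᶠ x in 𝓝[≠] (0 : ℂ), D i₀ j₀ x = g x := by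
        filter_upwards [nhdsWithin_le_nhds (hAD i₀ j₀), nhdsWithin_le_nhds hAg,
          self_mem_nhdsWithin] with x h3 h4 hx
        rw [h3, sub_zero, smul_eq_mul, smul_eq_mul] at h4
        exact mul_left_cancel₀ (pow_ne_zero k hx) h4
      have h5 : g 0 = D i₀ j₀ 0 :=
        tendsto_nhds_unique (hg.continuousAt.tendsto.mono_left (nhdsWithin_le_nhds (s := {0}ᶜ)))
          (((hD i₀ j₀).continuousAt.tendsto.mono_left nhdsWithin_le_nhds).congr' h2)
      exact hg0 (h5.trans h0)
    have hword : ∀ i, (k : ℕ∞) ≤ analyticOrderAt (w i) 0 := by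
      intro i
      refine natCast_le_analyticOrderAt_of_bound (hw i) (B := ∑ j, (‖D i j 0‖ + 1) * B) ?_
      have hDb : ∀ᶠ x in 𝓝 (0 : ℂ), ∀ j, ‖D i j x‖ < ‖D i j 0‖ + 1 := eventually_all.2 fun j =>
        (hD i j).continuousAt.norm.tendsto.eventually (gt_mem_nhds (lt_add_one _))
      filter_upwards [hB, nhdsWithin_le_nhds hAD', nhdsWithin_le_nhds hDb] with x hx hx1 hx2
      obtain ⟨α, hα, h⟩ := hx
      rw [← h i, Finset.sum_mul]
      refine norm_sum_le_of_le _ fun j _ => ?_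
      rw [hx1 i j, norm_mul, norm_mul, norm_pow]
      calc ‖x‖ ^ k * ‖D i j x‖ * ‖α j‖ ≤ ‖x‖ ^ k * (‖D i j 0‖ + 1) * B := by
            gcongr
            · exact (hx2 j).le
            · exact (norm_le_pi_norm α j).trans hα
        _ = _ := by ring
    choose v hv hwv using fun i => (natCast_le_analyticOrderAt (hw i)).1 (hword i)
    have hwv' : ∀ᶠ x in 𝓝 (0 : ℂ), ∀ i, w i x = x ^ k * v i x :=
      eventually_all.2 fun i => by simpa using hwv i
    have hDne : ∀ᶠ x in 𝓝 (0 : ℂ), D i₀ j₀ x ≠ 0 := (hD i₀ j₀).continuousAt.eventually_ne hD0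
    obtain ⟨a', ha', hsol⟩ := ih
      (fun i j x => D i (j₀.succAbove j) x - D i j₀ x * D i₀ (j₀.succAbove j) x / D i₀ j₀ x)
      (fun i x => v i x - D i j₀ x * v i₀ x / D i₀ j₀ x)
      (fun i j => (hD _ _).sub (((hD _ _).mul (hD _ _)).div (hD _ _) hD0))
      (fun i => (hv i).sub (((hD _ _).mul (hv _)).div (hD _ _) hD0)) ⟨B, by
        filter_upwards [hB, nhdsWithin_le_nhds hAD', nhdsWithin_le_nhds hwv',
          nhdsWithin_le_nhds hDne, self_mem_nhdsWithin] with x hx hx1 hx2 hx3 hx0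
        obtain ⟨α, hα, h⟩ := hx
        have hrow : ∀ i, D i j₀ x * α j₀ + ∑ j, D i (j₀.succAbove j) x * α (j₀.succAbove j)
            = v i x := by
          intro i
          have h4 := h i
          rw [hx2 i, Fin.sum_univ_succAbove _ j₀] at h4
          simp only [hx1, mul_assoc, ← Finset.mul_sum] at h4
          rw [← mul_add] at h4
          exact mul_left_cancel₀ (pow_ne_zero k hx0) h4
        refine ⟨fun j => α (j₀.succAbove j), ?_, fun i => ?_⟩
        · refine (pi_norm_le_iff_of_nonneg ((norm_nonneg _).trans hα)).2 fun j =>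
            (norm_le_pi_norm α _).trans hα
        · have h5 := hrow i
          have h6 := hrow i₀
          have h7 : ∑ j, (D i (j₀.succAbove j) x - D i j₀ x * D i₀ (j₀.succAbove j) x / D i₀ j₀ x) *
              α (j₀.succAbove j) = ∑ j, D i (j₀.succAbove j) x * α (j₀.succAbove j) -
              D i j₀ x / D i₀ j₀ x * ∑ j, D i₀ (j₀.succAbove j) x * α (j₀.succAbove j) := by
            rw [Finset.mul_sum, ← Finset.sum_sub_distrib]
            exact Finset.sum_congr rfl fun j _ => by ring
          rw [h7, ← h5, ← h6]
          field_simp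
          ring⟩
    let p : ℂ → ℂ := fun x =>
      (v i₀ x - ∑ j, D i₀ (j₀.succAbove j) x * a' j x) / D i₀ j₀ x
    have hp : AnalyticAt ℂ p 0 := by
      refine AnalyticAt.div ((hv i₀).sub ?_) (hD _ _) hD0
      exact Finset.analyticAt_fun_sum _ fun j _ => (hD _ _).mul (ha' j)
    refine ⟨Fin.insertNth (α := fun _ => ℂ → ℂ) j₀ p a', fun j => ?_, ?_⟩
    · rcases Fin.eq_self_or_eq_succAbove j₀ j with rfl | ⟨j', rfl⟩
      · rw [Fin.insertNth_apply_same]; exact hp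
      · rw [Fin.insertNth_apply_succAbove]; exact ha' j'
    · filter_upwards [hsol, hAD', hwv', hDne] with x hx hx1 hx2 hx3 i
      rw [Fin.sum_univ_succAbove _ j₀]
      simp only [Fin.insertNth_apply_same, Fin.insertNth_apply_succAbove, hx1, hx2, mul_assoc,
        ← Finset.mul_sum]
      rw [← mul_add]
      congr 1
      have h1 := hx i
      have h7 : ∑ j, (D i (j₀.succAbove j) x - D i j₀ x * D i₀ (j₀.succAbove j) x / D i₀ j₀ x) *
          a' j x = ∑ j, D i (j₀.succAbove j) x * a' j x -
          D i j₀ x / D i₀ j₀ x * ∑ j, D i₀ (j₀.succAbove j) x * a' j x := by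
        rw [Finset.mul_sum, ← Finset.sum_sub_distrib]
        exact Finset.sum_congr rfl fun j _ => by ring
      rw [h7] at h1
      simp only [p]
      linear_combination h1

lemma analyticOrderAt_dy_slice {f : ℂ × ℂ → ℂ} (hf : AnalyticAt ℂ f 0) (hf0 : f 0 = 0) {n : ℕ}
    (hm : analyticOrderAt (fun y => f (0, y)) 0 = (n + 1 : ℕ)) :
    analyticOrderAt (fun y => dy f (0, y)) 0 = n := by
  have hline : Tendsto (fun y : ℂ => ((0 : ℂ), y)) (𝓝 0) (𝓝 0) := by
    have : Continuous (fun y : ℂ => ((0 : ℂ), y)) := by fun_prop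
    simpa [Prod.mk_zero_zero] using this.tendsto 0
  have h1 : (fun y => dy f (0, y)) =ᶠ[𝓝 0] deriv (fun y => f (0, y)) := by
    filter_upwards [hline.eventually hf.eventually_analyticAt] with y hy
    have := hasDerivAt_comp_pair (x := fun _ => (0 : ℂ)) (y := fun y => y) (s := y)
      hy.differentiableAt (hasDerivAt_const y 0) (hasDerivAt_id y)
    rw [this.deriv]
    ring
  have h2 := AnalyticAt.analyticOrderAt_deriv_add_one (analyticAt_slice hf)
  have h3 : (fun y : ℂ => f (0, y) - f (0, 0)) = fun y => f (0, y) := by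
    funext y
    rw [Prod.mk_zero_zero, hf0, sub_zero]
  rw [h3, hm, ← analyticOrderAt_congr h1] at h2
  push_cast at h2
  exact ENat.add_left_injective_of_ne_top (n := 1) (by simp) h2

lemma eq_zero_of_sq_eq_mul {F b q : ℂ → ℂ} (hF : AnalyticAt ℂ F 0) (hb : AnalyticAt ℂ b 0)
    (hq : AnalyticAt ℂ q 0) {n : ℕ} (hFn : analyticOrderAt F 0 = (n + 1 : ℕ))
    (hqn : analyticOrderAt q 0 = n) (h : ∀ᶠ y in 𝓝 0, F y ^ 2 = b y * q y) : b 0 = 0 := by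
  by_contra hb0
  have h1 : analyticOrderAt (F ^ 2) 0 = analyticOrderAt (b * q) 0 := analyticOrderAt_congr h
  rw [analyticOrderAt_mul hb hq, analyticOrderAt_pow hF, hFn, hqn,
    hb.analyticOrderAt_eq_zero.2 hb0, zero_add, nsmul_eq_mul] at h1
  have h2 : 2 * (n + 1) = n := by exact_mod_cast h1
  omega

/-- If `f (0, ·)` has finite order then `f ^ 2` is the derivative of `f` along an analytic vector
field vanishing at the origin. -/
lemma exists_vectorField_of_slice {f : ℂ × ℂ → ℂ} (hf : AnalyticAt ℂ f 0) (hf0 : f 0 = 0) {n : ℕ}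
    (hm : analyticOrderAt (fun y => f (0, y)) 0 = (n + 1 : ℕ)) :
    ∃ X : ℂ × ℂ → ℂ × ℂ, AnalyticAt ℂ X 0 ∧ X 0 = 0 ∧
      ∀ᶠ z in 𝓝 (0 : ℂ × ℂ), fderiv ℂ f z (X z) = f z ^ 2 := by
  obtain ⟨C, hC, hloj⟩ := exists_lojasiewicz hf (Nat.succ_pos n) hm
  have hqn := analyticOrderAt_dy_slice hf hf0 hm
  obtain ⟨r₁, hr₁, hcf⟩ := exists_curry hf
  obtain ⟨r₂, hr₂, hcx⟩ := exists_curry (analyticAt_dx hf)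
  obtain ⟨r₃, hr₃, hcy⟩ := exists_curry_order (analyticAt_dy hf) hqn
  have hf1 : ∀ᶠ p in 𝓝 (0 : ℂ × ℂ), ‖f p‖ < 1 :=
    hf.continuousAt.norm.tendsto.eventually (gt_mem_nhds (by simp [hf0]))
  obtain ⟨r₄, hr₄, hbox⟩ := Metric.eventually_nhds_iff_ball.1 (hloj.and hf1)
  obtain ⟨r, hr, hrr⟩ : ∃ r, 0 < r ∧ r < min (min r₁ r₂) (min (min r₃ r₄) (1 / 2)) :=
    exists_between (by positivity)
  simp only [lt_min_iff] at hrr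
  obtain ⟨⟨hrr₁, hrr₂⟩, ⟨hrr₃, hrr₄⟩, hr1⟩ := hrr
  obtain ⟨F, hFa, hF⟩ := hcf r hrr₁
  obtain ⟨G, hGa, hG⟩ := hcx r hrr₂
  obtain ⟨q, hqa, hq, u, hu, hq0⟩ := hcy r hr hrr₃
  let P : ℂ → DiscAlg r := fun x => x • G x
  have hPa : AnalyticAt ℂ P 0 := analyticAt_id.smul hGa
  have hP0 : P 0 = 0 := zero_smul ℂ (G 0)
  have hFev : ∀ᶠ x in 𝓝 (0 : ℂ), ∀ y ∈ closedBall (0 : ℂ) r, dev (F x) y = f (x, y) :=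
    Filter.mem_of_superset (ball_mem_nhds 0 hr₁) hF
  have hPev : ∀ᶠ x in 𝓝 (0 : ℂ), ∀ y ∈ closedBall (0 : ℂ) r, dev (P x) y = x * dx f (x, y) := by
    filter_upwards [ball_mem_nhds (0 : ℂ) hr₂] with x hx y hy
    rw [dev_smul _ _ hy, hG x hx y hy]
  have hboxev : ∀ᶠ x in 𝓝 (0 : ℂ), ∀ y ∈ closedBall (0 : ℂ) r,
      ‖f (x, y)‖ ≤ C * (‖x * dx f (x, y)‖ + ‖dy f (x, y)‖) ∧ ‖f (x, y)‖ < 1 := by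
    filter_upwards [ball_mem_nhds (0 : ℂ) hr₄] with x hx y hy
    refine hbox (x, y) ?_
    rw [mem_ball_zero_iff] at hx ⊢
    rw [mem_closedBall_zero_iff] at hy
    exact max_lt hx (hy.trans_lt hrr₄)
  obtain ⟨M, δ, hδ, hcoef⟩ := exists_bounded_coeffs hr hr1.le n hu hC.le
  have hqδ : ∀ᶠ x in 𝓝 (0 : ℂ), ‖q x - discX r ^ n * u‖ < δ := by
    have h := (hqa.continuousAt.sub (continuousAt_const (y := discX r ^ n * u))).norm
    refine h.tendsto.eventually (gt_mem_nhds ?_)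
    simpa [hq0] using hδ
  have hPδ : ∀ᶠ x in 𝓝 (0 : ℂ), ‖P x‖ < δ := by
    refine hPa.continuousAt.norm.tendsto.eventually (gt_mem_nhds ?_)
    rw [hP0, norm_zero]
    exact hδ
  have hequiv : ∀ᶠ x in 𝓝 (0 : ℂ), ∃ e : ((Fin n → ℂ) × DiscAlg r) ≃L[ℂ] DiscAlg r,
      (e : ((Fin n → ℂ) × DiscAlg r) →L[ℂ] DiscAlg r) = divMap n (q x) := by
    have h := eventually_divMap_isEquiv hr n hu
    rw [← hq0] at h
    exact hqa.continuousAt.tendsto.eventually h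
  have hinv : AnalyticAt ℂ (fun x => divInv n (q x)) 0 := by
    refine AnalyticAt.comp (g := divInv n) (f := q) ?_ hqa
    rw [hq0]
    exact analyticAt_divInv hr n hu
  have hXP : ∀ j : Fin n, AnalyticAt ℂ (fun x => discX r ^ (j : ℕ) * P x) 0 := fun j =>
    analyticAt_const.mul hPa
  let A : Fin n → Fin n → ℂ → ℂ := fun i j x => (divInv n (q x) (discX r ^ (j : ℕ) * P x)).1 i
  let w : Fin n → ℂ → ℂ := fun i x => (divInv n (q x) (F x ^ 2)).1 i
  have hcoord : ∀ (H : ℂ → DiscAlg r) (i : Fin n), AnalyticAt ℂ H 0 →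
      AnalyticAt ℂ (fun x => (divInv n (q x) (H x)).1 i) 0 := fun H i hH =>
    (((ContinuousLinearMap.proj (R := ℂ) (φ := fun _ : Fin n => ℂ) i).comp
      (ContinuousLinearMap.fst ℂ (Fin n → ℂ) (DiscAlg r))).analyticAt _).comp
      (analyticAt_clmApply hinv hH)
  have hlin : ∀ (x : ℂ) (α : Fin n → ℂ) (i : Fin n),
      (divInv n (q x) ((∑ j : Fin n, α j • discX r ^ (j : ℕ)) * P x)).1 i =
        ∑ j, A i j x * α j := by
    intro x α i
    have h1 : (∑ j : Fin n, α j • discX r ^ (j : ℕ)) * P x =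
        ∑ j : Fin n, α j • (discX r ^ (j : ℕ) * P x) := by
      rw [Finset.sum_mul]
      exact Finset.sum_congr rfl fun j _ => smul_mul_assoc _ _ _
    rw [h1, map_sum, Prod.fst_sum, Finset.sum_apply]
    refine Finset.sum_congr rfl fun j _ => ?_
    rw [map_smul, Prod.smul_fst, Pi.smul_apply, smul_eq_mul, mul_comm]
  obtain ⟨a, haa, ha⟩ := exists_analytic_solution n A w (fun i j => hcoord _ i (hXP j))
    (fun i => hcoord _ i (hFa.pow 2)) ⟨M, nhdsWithin_le_nhds (by
      filter_upwards [hFev, hPev, hq, hboxev, hqδ, hPδ, hequiv] with x h1 h2 h3 h4 h5 h6 h7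
      have hFle : ‖F x‖ ≤ 1 := norm_le_of_dev_le _ zero_le_one fun y hy => by
        rw [h1 y hy]; exact (h4 y hy).2.le
      obtain ⟨α, k, hα, hk⟩ := hcoef (P x) (q x) (F x) h5 h6 hFle fun y hy => by
        rw [h1 y hy, h2 y hy, h3 y hy]; exact (h4 y hy).1
      refine ⟨α, hα, fun i => ?_⟩
      have h8 := divInv_divMap h7 0 k
      simp only [Pi.zero_apply, zero_smul ℂ, Finset.sum_const_zero, zero_add] at h8
      change _ = (divInv n (q x) (F x ^ 2)).1 i
      rw [hk, map_add, h8, ← hlin]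
      simp)⟩
  let S : ℂ → DiscAlg r := fun x => ∑ j : Fin n, a j x • discX r ^ (j : ℕ)
  have hSa : AnalyticAt ℂ S 0 := Finset.analyticAt_fun_sum _ fun j _ =>
    (haa j).smul analyticAt_const
  let b : ℂ → DiscAlg r := fun x => (divInv n (q x) (F x ^ 2 - S x * P x)).2
  have hba : AnalyticAt ℂ b 0 :=
    ((ContinuousLinearMap.snd ℂ (Fin n → ℂ) (DiscAlg r)).analyticAt _).comp
      (analyticAt_clmApply hinv ((hFa.pow 2).sub (hSa.mul hPa)))
  have hkey : ∀ᶠ x in 𝓝 (0 : ℂ), F x ^ 2 = S x * P x + b x * q x := by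
    filter_upwards [ha, hequiv] with x h1 h2
    have h3 := divMap_divInv h2 (F x ^ 2 - S x * P x)
    have h4 : ∀ i, (divInv n (q x) (F x ^ 2 - S x * P x)).1 i = 0 := by
      intro i
      rw [map_sub, Prod.fst_sub, Pi.sub_apply, hlin x (fun j => a j x) i, h1 i]
      exact sub_self _
    simp only [h4, zero_smul ℂ, Finset.sum_const_zero, zero_add] at h3
    rw [show b x * q x = _ from h3]
    ring
  have hkey' : ∀ᶠ x in 𝓝 (0 : ℂ), ∀ y ∈ closedBall (0 : ℂ) r,
      f (x, y) ^ 2 = dev (S x) y * (x * dx f (x, y)) + dev (b x) y * dy f (x, y) := by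
    filter_upwards [hkey, hFev, hPev, hq] with x h1 h2 h3 h4 y hy
    rw [← h2 y hy, ← h3 y hy, ← h4 y hy, ← dev_pow _ _ hy, h1, dev_add _ _ hy, dev_mul _ _ hy,
      dev_mul _ _ hy]
  have hbu := analyticAt_uncurry hr hba
  have hb0 : dev (b 0) 0 = 0 := by
    refine eq_zero_of_sq_eq_mul (analyticAt_slice hf) (analyticAt_slice hbu)
      (analyticAt_slice (analyticAt_dy hf)) hm hqn ?_
    filter_upwards [closedBall_mem_nhds (0 : ℂ) hr] with y hy
    rw [hkey'.self_of_nhds y hy]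
    ring
  refine ⟨fun p => (p.1 * dev (S p.1) p.2, dev (b p.1) p.2),
    (analyticAt_fst.mul (analyticAt_uncurry hr hSa)).prod hbu, ?_, ?_⟩
  · simp [hb0, Prod.mk_zero_zero]
  · rw [← Prod.mk_zero_zero, nhds_prod_eq]
    filter_upwards [hkey'.prod_mk (closedBall_mem_nhds (0 : ℂ) hr)] with p hp
    rw [fderiv_apply_eq, hp.1 p.2 hp.2]
    ring

lemma exists_line_not_eventually_zero {f : ℂ × ℂ → ℂ} (hf : AnalyticAt ℂ f 0)
    (hne : ¬ ∀ᶠ z in 𝓝 (0 : ℂ × ℂ), f z = 0) :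
    ∃ v : ℂ × ℂ, ¬ ∀ᶠ t in 𝓝 (0 : ℂ), f (t • v) = 0 := by
  by_contra! hcon
  apply hne
  obtain ⟨R, hR, hfa⟩ := Metric.eventually_nhds_iff_ball.1 hf.eventually_analyticAt
  filter_upwards [ball_mem_nhds (0 : ℂ × ℂ) hR] with z hz
  let s : Set ℂ := (fun t : ℂ => t • z) ⁻¹' ball (0 : ℂ × ℂ) R
  have hs : IsPreconnected s := by
    have : Convex ℝ s := (convex_ball (0 : ℂ × ℂ) R).is_linear_preimage
      ((LinearMap.toSpanSingleton ℂ (ℂ × ℂ) z).restrictScalars ℝ).isLinear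
    exact this.isPreconnected
  have ha : AnalyticOnNhd ℂ (fun t : ℂ => f (t • z)) s := fun t ht =>
    AnalyticAt.comp (g := f) (f := fun t : ℂ => t • z) (hfa _ ht)
      (analyticAt_id.smul analyticAt_const)
  have h0 : (0 : ℂ) ∈ s := by simpa [s] using hR
  have h1 : (1 : ℂ) ∈ s := by simpa [s] using hz
  have h2 := ha.eqOn_zero_of_preconnected_of_eventuallyEq_zero hs h0 (hcon z) h1
  simpa using h2

/-- The square of an analytic function vanishing at the origin is its derivative along an analytic
vector field vanishing at the origin. -/
lemma exists_vectorField {f : ℂ × ℂ → ℂ} (hf : AnalyticAt ℂ f 0) (hf0 : f 0 = 0) :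
    ∃ X : ℂ × ℂ → ℂ × ℂ, AnalyticAt ℂ X 0 ∧ X 0 = 0 ∧
      ∀ᶠ z in 𝓝 (0 : ℂ × ℂ), fderiv ℂ f z (X z) = f z ^ 2 := by
  by_cases hz : ∀ᶠ z in 𝓝 (0 : ℂ × ℂ), f z = 0
  · exact ⟨fun _ => 0, analyticAt_const, rfl, hz.mono fun z h => by simp [h]⟩
  obtain ⟨v, hv⟩ := exists_line_not_eventually_zero hf hz
  have hv0 : v ≠ 0 := by
    rintro rfl
    simp [hf0] at hv
  obtain ⟨L, hL⟩ := SeparatingDual.exists_continuousLinearEquiv_apply_eq (R := ℂ)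
    (x := ((0, 1) : ℂ × ℂ)) (y := v) (by simp) hv0
  have hLy : ∀ y : ℂ, L (0, y) = y • v := fun y => by
    rw [← hL, ← map_smul]
    simp
  have hfL : AnalyticAt ℂ (fun z => f (L z)) 0 := by
    refine AnalyticAt.comp (g := f) (f := L) ?_ (L.toContinuousLinearMap.analyticAt 0)
    rwa [map_zero]
  have htop : analyticOrderAt (fun y => f (L (0, y))) 0 ≠ ⊤ := by
    rw [ne_eq, analyticOrderAt_eq_top]
    simpa [hLy] using hv
  obtain ⟨m, hm⟩ := ENat.ne_top_iff_exists.1 htop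
  have hm0 : m ≠ 0 := by
    rintro rfl
    have h := (analyticAt_slice hfL).analyticOrderAt_eq_zero.1 hm.symm
    exact h (by simp [Prod.mk_zero_zero, hf0])
  obtain ⟨n, rfl⟩ := Nat.exists_eq_succ_of_ne_zero hm0
  obtain ⟨X, hX, hX0, hXf⟩ := exists_vectorField_of_slice hfL (by simp [hf0]) hm.symm
  have hLs : AnalyticAt ℂ L.symm 0 := L.symm.toContinuousLinearMap.analyticAt 0
  refine ⟨fun z => L (X (L.symm z)), ?_, by simp [hX0], ?_⟩
  · refine (L.toContinuousLinearMap.analyticAt _).comp ?_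
    refine AnalyticAt.comp (g := X) (f := L.symm) ?_ hLs
    rwa [map_zero]
  · have h1 : Tendsto L.symm (𝓝 0) (𝓝 0) := by
      simpa using L.symm.continuous.tendsto 0
    filter_upwards [h1.eventually hXf] with z h2
    have h3 : fderiv ℂ (fun z => f (L z)) (L.symm z) = (fderiv ℂ f z).comp
        (L : (ℂ × ℂ) →L[ℂ] (ℂ × ℂ)) := by
      have := L.comp_right_fderiv (f := f) (x := L.symm z)
      rwa [L.apply_symm_apply] at this
    rw [h3, L.apply_symm_apply] at h2
    exact h2

section Flow

variable {V : Type*} [NormedAddCommGroup V]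

/-- Extension of a path to the real line, constant outside of the unit interval. -/
noncomputable def pathExt (γ : C(unitInterval, V)) (s : ℝ) : V :=
  γ (projIcc 0 1 zero_le_one s)

lemma continuous_pathExt (γ : C(unitInterval, V)) : Continuous (pathExt γ) :=
  γ.continuous.comp continuous_projIcc

lemma pathExt_of_mem (γ : C(unitInterval, V)) {s : ℝ} (hs : s ∈ Icc (0 : ℝ) 1) :
    pathExt γ s = γ ⟨s, hs⟩ := by
  rw [pathExt, projIcc_of_mem zero_le_one hs]

variable [NormedSpace ℂ V]

/-- The primitive of a path vanishing at the initial time. -/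
noncomputable def primitive [CompleteSpace V] : C(unitInterval, V) →L[ℂ] C(unitInterval, V) :=
  LinearMap.mkContinuous
    { toFun := fun γ => ⟨fun t => ∫ s in (0 : ℝ)..t, pathExt γ s,
        (intervalIntegral.continuous_primitive
          (fun _ _ => (continuous_pathExt γ).intervalIntegrable _ _) 0).comp
          continuous_subtype_val⟩
      map_add' := fun γ η => by
        ext t
        exact intervalIntegral.integral_add ((continuous_pathExt γ).intervalIntegrable _ _)
          ((continuous_pathExt η).intervalIntegrable _ _)
      map_smul' := fun c γ => by
        ext t
        exact intervalIntegral.integral_smul c (pathExt γ) }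
    1 (by
      intro γ
      rw [one_mul, ContinuousMap.norm_le _ (norm_nonneg γ)]
      intro t
      have h := intervalIntegral.norm_integral_le_of_norm_le_const (a := 0) (b := (t : ℝ))
        (f := pathExt γ) (C := ‖γ‖) fun s _ => γ.norm_coe_le_norm _
      refine h.trans (mul_le_of_le_one_right (norm_nonneg _) ?_)
      rw [sub_zero, abs_of_nonneg t.2.1]
      exact t.2.2)

lemma primitive_apply [CompleteSpace V] (γ : C(unitInterval, V)) (t : unitInterval) :
    primitive γ t = ∫ s in (0 : ℝ)..t, pathExt γ s := rfl

lemma norm_primitive_le [CompleteSpace V] :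
    ‖(primitive : C(unitInterval, V) →L[ℂ] C(unitInterval, V))‖ ≤ 1 :=
  LinearMap.mkContinuous_norm_le _ zero_le_one _

/-- Constant paths. -/
noncomputable def constPath : V →L[ℂ] C(unitInterval, V) :=
  LinearMap.mkContinuous
    { toFun := fun v => ContinuousMap.const _ v
      map_add' := fun _ _ => rfl
      map_smul' := fun _ _ => rfl }
    1 (by
      intro v
      rw [one_mul, ContinuousMap.norm_le _ (norm_nonneg v)]
      exact fun _ => le_rfl)

lemma norm_constPath_le (v : V) : ‖constPath v‖ ≤ ‖v‖ :=
  (ContinuousMap.norm_le _ (norm_nonneg v)).2 fun _ => le_rfl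

/-- A continuous linear map at distance less than one from the identity is invertible. -/
lemma exists_equiv_of_norm_sub_one_lt [CompleteSpace V] {T : V →L[ℂ] V} (h : ‖1 - T‖ < 1) :
    ∃ e : V ≃L[ℂ] V, (e : V →L[ℂ] V) = T :=
  ⟨ContinuousLinearEquiv.unitsEquiv ℂ V (Units.oneSub (1 - T) h), by
    ext v
    simp⟩

/-- Analytic dependence on the initial value of the time one flow of a small analytic vector
field. -/
lemma exists_flow [CompleteSpace V] {X : V → V} (hX : AnalyticAt ℂ X 0)
    (hsmall : ∀ᶠ y in 𝓝 (0 : V), ‖X y‖ ≤ 1 / 4 * ‖y‖) :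
    ∃ Γ : V → ℝ → V, AnalyticAt ℂ (fun v => Γ v 1) 0 ∧ (∀ v, Γ v 0 = v) ∧
      (∀ᶠ v in 𝓝 (0 : V), ‖Γ v 1 - v‖ ≤ 1 / 2 * ‖v‖) ∧
      ∀ U ∈ 𝓝 (0 : V), ∀ᶠ v in 𝓝 (0 : V), ∀ t ∈ Icc (0 : ℝ) 1,
        Γ v t ∈ U ∧ HasDerivAt (Γ v) (X (Γ v t)) t := by
  obtain ⟨R, hR, -, hN⟩ := exists_analytic_superposition hX
  obtain ⟨N, hNa, hN⟩ := hN unitInterval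
  obtain ⟨ρ, hρ, hρX⟩ := Metric.eventually_nhds_iff_ball.1 hsmall
  have hNsmall : ∀ᶠ γ in 𝓝 (0 : C(unitInterval, V)), ‖N γ‖ ≤ 1 / 4 * ‖γ‖ := by
    filter_upwards [ball_mem_nhds 0 hR, ball_mem_nhds 0 hρ] with γ h1 h2
    rw [ContinuousMap.norm_le _ (by positivity)]
    intro t
    rw [hN γ h1]
    have h3 := γ.norm_coe_le_norm t
    have h4 := hρX (γ t) (by
      rw [mem_ball_zero_iff] at h2 ⊢
      exact h3.trans_lt h2)
    linarith
  have hN0 : N 0 = 0 := by simpa using hNsmall.self_of_nhds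
  have hNan : AnalyticAt ℂ N 0 := hNa 0 (mem_ball_self hR)
  have hND : ‖fderiv ℂ N 0‖ ≤ 1 / 4 := by
    refine hNan.differentiableAt.hasFDerivAt.le_of_lip' (by norm_num) ?_
    filter_upwards [hNsmall] with γ h
    simpa [hN0] using h
  have hJN : ∀ᶠ γ in 𝓝 (0 : C(unitInterval, V)), ‖primitive (N γ)‖ ≤ 1 / 4 * ‖γ‖ := by
    filter_upwards [hNsmall] with γ h
    refine (primitive.le_opNorm _).trans ((mul_le_of_le_one_left (norm_nonneg _) ?_).trans h)
    exact norm_primitive_le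
  let T : C(unitInterval, V) → C(unitInterval, V) := fun γ => γ - primitive (N γ)
  have hT0 : T 0 = 0 := by simp [T, hN0]
  have hTa : AnalyticAt ℂ T 0 := analyticAt_id.sub
    (analyticAt_clmApply (L := fun _ => primitive) analyticAt_const hNan)
  obtain ⟨e, he⟩ : ∃ e : C(unitInterval, V) ≃L[ℂ] C(unitInterval, V),
      (e : C(unitInterval, V) →L[ℂ] C(unitInterval, V)) = 1 - primitive.comp (fderiv ℂ N 0) := by
    refine exists_equiv_of_norm_sub_one_lt ?_
    rw [sub_sub_cancel]
    refine (ContinuousLinearMap.opNorm_comp_le _ _).trans_lt ?_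
    nlinarith [norm_primitive_le (V := V), norm_nonneg (fderiv ℂ N 0)]
  have hTd : HasFDerivAt T (e : C(unitInterval, V) →L[ℂ] C(unitInterval, V)) 0 := by
    rw [he]
    exact (hasFDerivAt_id _).sub
      (HasFDerivAt.comp (g := primitive) (f := N) 0 (primitive (V := V)).hasFDerivAt
        hNan.differentiableAt.hasFDerivAt)
  have hTc : ContDiffAt ℂ ⊤ T 0 := hTa.contDiffAt
  have hTs := hTc.hasStrictFDerivAt' hTd (by simp)
  let S := hTs.localInverse T e 0
  have hSa : AnalyticAt ℂ S 0 := by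
    have h := (hTc.to_localInverse hTd (by simp)).analyticAt
    rwa [hT0] at h
  have hS0 : S 0 = 0 := by
    have h := hTs.localInverse_apply_image
    rwa [hT0] at h
  have hTS : ∀ᶠ γ in 𝓝 (0 : C(unitInterval, V)), T (S γ) = γ := by
    have h := hTs.eventually_right_inverse
    rwa [hT0] at h
  let s : V → C(unitInterval, V) := fun v => S (constPath v)
  have hsa : AnalyticAt ℂ s 0 := by
    refine AnalyticAt.comp (g := S) (f := constPath (V := V)) ?_ ((constPath (V := V)).analyticAt 0)
    rwa [map_zero]
  have hs0 : s 0 = 0 := by simp [s, hS0]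
  have hst : Tendsto s (𝓝 0) (𝓝 0) := by
    have := hsa.continuousAt.tendsto
    rwa [hs0] at this
  have hc0 : Tendsto (constPath : V → C(unitInterval, V)) (𝓝 0) (𝓝 0) := by
    simpa using (constPath (V := V)).continuous.tendsto 0
  have hsv : ∀ᶠ v in 𝓝 (0 : V), s v = constPath v + primitive (N (s v)) := by
    filter_upwards [hc0.eventually hTS] with v h
    exact sub_eq_iff_eq_add.1 h
  have hsn : ∀ᶠ v in 𝓝 (0 : V), ‖s v‖ ≤ 4 / 3 * ‖v‖ ∧ ‖primitive (N (s v))‖ ≤ 1 / 2 * ‖v‖ := by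
    filter_upwards [hsv, hst.eventually hJN] with v h1 h2
    have h3 := norm_add_le (constPath v) (primitive (N (s v)))
    rw [← h1] at h3
    have h4 := norm_constPath_le v
    have h5 := norm_nonneg v
    constructor <;> linarith
  let Γ : V → ℝ → V := fun v t => v + ∫ x in (0 : ℝ)..t, pathExt (N (s v)) x
  have hΓ : ∀ v, ∀ t : unitInterval, Γ v t = (constPath v + primitive (N (s v))) t :=
    fun v t => rfl
  have hΓs : ∀ᶠ v in 𝓝 (0 : V), ∀ t : unitInterval, Γ v t = s v t := by
    filter_upwards [hsv] with v h t
    rw [hΓ, ← h]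
  refine ⟨Γ, ?_, fun v => by simp [Γ], ?_, ?_⟩
  · have h1 : AnalyticAt ℂ (fun v => s v 1) 0 :=
      analyticAt_clmApply
      (L := fun _ => ContinuousMap.evalCLM ℂ (1 : unitInterval)) analyticAt_const hsa
    refine h1.congr ?_
    filter_upwards [hΓs] with v h
    exact (h 1).symm
  · filter_upwards [hsn] with v h
    have h1 : Γ v 1 - v = primitive (N (s v)) 1 := by simp [Γ, primitive_apply]
    rw [h1]
    exact ((primitive (N (s v))).norm_coe_le_norm 1).trans h.2
  · intro U hU
    obtain ⟨ε, hε, hεU⟩ := Metric.mem_nhds_iff.1 hU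
    filter_upwards [hΓs, hst (ball_mem_nhds 0 hR), hst (ball_mem_nhds 0 hε)] with v h1 h2 h3 t ht
    have h4 : Γ v t = s v ⟨t, ht⟩ := h1 ⟨t, ht⟩
    refine ⟨hεU ?_, ?_⟩
    · rw [h4]
      rw [mem_preimage, mem_ball_zero_iff] at h3
      rw [mem_ball_zero_iff]
      exact ((s v).norm_coe_le_norm _).trans_lt h3
    · rw [h4, ← hN _ h2, ← pathExt_of_mem]
      exact (intervalIntegral.integral_hasDerivAt_right
        ((continuous_pathExt _).intervalIntegrable _ _)
        (Continuous.stronglyMeasurableAtFilter (continuous_pathExt _) _ _)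
        (continuous_pathExt _).continuousAt).const_add v

end Flow

/-- Germs of biholomorphisms of the plane at the origin. -/
def IsBihol (Φ : ℂ × ℂ → ℂ × ℂ) : Prop :=
  AnalyticAt ℂ Φ 0 ∧ Φ 0 = 0 ∧
    ∃ e : (ℂ × ℂ) ≃L[ℂ] (ℂ × ℂ), (e : (ℂ × ℂ) →L[ℂ] (ℂ × ℂ)) = fderiv ℂ Φ 0

lemma IsBihol.tendsto {Φ : ℂ × ℂ → ℂ × ℂ} (h : IsBihol Φ) : Tendsto Φ (𝓝 0) (𝓝 0) := by
  have := h.1.continuousAt.tendsto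
  rwa [h.2.1] at this

lemma IsBihol.comp {Φ Ψ : ℂ × ℂ → ℂ × ℂ} (hΦ : IsBihol Φ) (hΨ : IsBihol Ψ) :
    IsBihol (fun z => Φ (Ψ z)) := by
  obtain ⟨hΦ, hΦ0, e, he⟩ := hΦ
  obtain ⟨hΨ, hΨ0, e', he'⟩ := hΨ
  rw [← hΨ0] at hΦ
  refine ⟨AnalyticAt.comp (g := Φ) (f := Ψ) hΦ hΨ, by simp only [hΨ0, hΦ0], e'.trans e, ?_⟩
  have h := fderiv_comp (𝕜 := ℂ) (g := Φ) (f := Ψ) 0 hΦ.differentiableAt hΨ.differentiableAt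
  rw [hΨ0] at h
  rw [show fderiv ℂ (fun z => Φ (Ψ z)) 0 = _ from h, ← he, ← he']
  rfl

lemma isBihol_of_norm_sub_le {Φ : ℂ × ℂ → ℂ × ℂ} (hΦ : AnalyticAt ℂ Φ 0)
    (h : ∀ᶠ z in 𝓝 (0 : ℂ × ℂ), ‖Φ z - z‖ ≤ 1 / 2 * ‖z‖) : IsBihol Φ := by
  have h0 : Φ 0 = 0 := by simpa using h.self_of_nhds
  refine ⟨hΦ, h0, exists_equiv_of_norm_sub_one_lt ?_⟩
  rw [norm_sub_rev]
  have hd : HasFDerivAt (fun z => Φ z - z) (fderiv ℂ Φ 0 - 1) 0 :=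
    hΦ.differentiableAt.hasFDerivAt.sub (hasFDerivAt_id 0)
  refine (hd.le_of_lip' (C := 1 / 2) (by norm_num) ?_).trans_lt (by norm_num)
  filter_upwards [h] with z hz
  simpa [h0] using hz

/-- The solution of `u' = s u ^ 2`. -/
lemma mul_one_sub_eq_of_hasDerivAt {u : ℝ → ℂ} {s : ℂ} {M : ℝ}
    (hu : ∀ t ∈ Icc (0 : ℝ) 1, HasDerivAt u (s * u t ^ 2) t)
    (hM : ∀ t ∈ Icc (0 : ℝ) 1, ‖u t‖ ≤ M) : u 1 * (1 - s * u 0) = u 0 := by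
  let q : ℝ → ℂ := fun t => u t * (1 - t * (s * u 0)) - u 0
  have hq : ∀ t ∈ Icc (0 : ℝ) 1, HasDerivAt q (s * u t * q t) t := by
    intro t ht
    have h1 : HasDerivAt (fun t : ℝ => (1 : ℂ) - t * (s * u 0)) (-(1 * (s * u 0))) t :=
      ((Complex.ofRealCLM.hasDerivAt (x := t)).mul_const (s * u 0)).const_sub 1
    refine (((hu t ht).mul h1).sub_const (u 0)).congr_deriv ?_
    simp only [q]
    ring
  have h := eq_zero_of_abs_deriv_le_mul_abs_self_of_eq_zero_right (f := q) (K := ‖s‖ * M)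
    (fun t ht => (hq t ht).continuousAt.continuousWithinAt)
    (fun t ht => (hq t (Ico_subset_Icc_self ht)).hasDerivWithinAt) (by simp [q])
    (fun t ht => by
      rw [norm_mul, norm_mul]
      gcongr
      exact hM t (Ico_subset_Icc_self ht)) 1 (right_mem_Icc.2 zero_le_one)
  simpa [q, sub_eq_zero] using h

lemma exists_norm_le_mul {V W : Type*} [NormedAddCommGroup V] [NormedSpace ℂ V]
    [NormedAddCommGroup W] [NormedSpace ℂ W] {h : V → W} (hh : AnalyticAt ℂ h 0) (h0 : h 0 = 0) :
    ∃ B : ℝ, 0 < B ∧ ∀ᶠ z in 𝓝 (0 : V), ‖h z‖ ≤ B * ‖z‖ := by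
  obtain ⟨B, hB, hb⟩ := hh.differentiableAt.isBigO_sub.exists_pos
  exact ⟨B, hB, by simpa [h0] using hb.bound⟩

lemma exists_bihol_of_small {f : ℂ × ℂ → ℂ} (hf : AnalyticAt ℂ f 0) (hf0 : f 0 = 0) :
    ∃ ε : ℝ, 0 < ε ∧ ∀ σ : ℂ → ℂ, AnalyticAt ℂ σ 0 → ‖σ 0‖ < ε →
      ∃ Φ, IsBihol Φ ∧ ∀ᶠ z in 𝓝 (0 : ℂ × ℂ), f (Φ z) * (1 - σ (f z) * f z) = f z := by
  obtain ⟨X, hX, hX0, hXf⟩ := exists_vectorField hf hf0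
  obtain ⟨B, hB, hXB⟩ := exists_norm_le_mul hX hX0
  refine ⟨1 / (8 * B), by positivity, fun σ hσ hσε => ?_⟩
  let h : ℂ × ℂ → ℂ := fun z => σ (f z) - σ 0
  have hh : AnalyticAt ℂ h 0 := by
    refine AnalyticAt.sub (AnalyticAt.comp (g := σ) (f := f) ?_ hf) analyticAt_const
    rwa [hf0]
  have hh0 : h 0 = 0 := by simp [h, hf0]
  obtain ⟨Λ, hΛ, hhΛ⟩ := exists_norm_le_mul hh hh0
  have hΛ' : (Λ : ℂ) ≠ 0 := by exact_mod_cast hΛ.ne'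
  let Y : ℂ × (ℂ × ℂ) → ℂ × (ℂ × ℂ) := fun v => (0, (Λ * v.1 + σ 0) • X v.2)
  have hsnd : Tendsto (Prod.snd : ℂ × (ℂ × ℂ) → ℂ × ℂ) (𝓝 0) (𝓝 0) := continuous_snd.tendsto 0
  have hs : AnalyticAt ℂ (fun v : ℂ × (ℂ × ℂ) => (Λ : ℂ) * v.1 + σ 0) 0 :=
    (analyticAt_const.mul analyticAt_fst).add analyticAt_const
  have hY : AnalyticAt ℂ Y 0 := analyticAt_const.prod (hs.smul
    (AnalyticAt.comp (g := X) (f := Prod.snd) (x := (0 : ℂ × (ℂ × ℂ))) hX analyticAt_snd))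
  have hs1 : ∀ᶠ v in 𝓝 (0 : ℂ × (ℂ × ℂ)), ‖(Λ : ℂ) * v.1 + σ 0‖ < 1 / (8 * B) :=
    hs.continuousAt.norm.tendsto.eventually (gt_mem_nhds (by simpa using hσε))
  have hsmall : ∀ᶠ v in 𝓝 (0 : ℂ × (ℂ × ℂ)), ‖Y v‖ ≤ 1 / 4 * ‖v‖ := by
    filter_upwards [hs1, hsnd.eventually hXB] with v h1 h2
    have h3 : ‖v.2‖ ≤ ‖v‖ := norm_snd_le v
    calc ‖Y v‖ = ‖(Λ : ℂ) * v.1 + σ 0‖ * ‖X v.2‖ := by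
          rw [← norm_smul]
          exact max_eq_right ((norm_zero (E := ℂ)).trans_le (norm_nonneg _))
      _ ≤ 1 / (8 * B) * (B * ‖v‖) := by gcongr; exact h2.trans (by gcongr)
      _ = 1 / 8 * ‖v‖ := by field_simp
      _ ≤ 1 / 4 * ‖v‖ := by gcongr; norm_num
  obtain ⟨Γ, hΓ1, hΓ0, hΓn, hΓ⟩ := exists_flow hY hsmall
  let ι : ℂ × ℂ → ℂ × (ℂ × ℂ) := fun z => (h z / Λ, z)
  have hι : AnalyticAt ℂ ι 0 := (hh.div_const).prod analyticAt_id
  have hι0 : ι 0 = 0 := by simp [ι, hh0]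
  have hιt : Tendsto ι (𝓝 0) (𝓝 0) := by
    have := hι.continuousAt.tendsto
    rwa [hι0] at this
  have hιn : ∀ᶠ z in 𝓝 (0 : ℂ × ℂ), ‖ι z‖ ≤ ‖z‖ := by
    filter_upwards [hhΛ] with z hz
    refine max_le ?_ le_rfl
    change ‖h z / Λ‖ ≤ ‖z‖
    rw [norm_div, div_le_iff₀ (by positivity), Complex.norm_real, Real.norm_of_nonneg hΛ.le,
      mul_comm]
    exact hz
  let Φ : ℂ × ℂ → ℂ × ℂ := fun z => (Γ (ι z) 1).2
  have hΦ : AnalyticAt ℂ Φ 0 := by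
    refine AnalyticAt.comp (g := fun v => (Γ v 1).2) (f := ι) ?_ hι
    rw [hι0]
    exact AnalyticAt.comp (g := Prod.snd) (f := fun v => Γ v 1) analyticAt_snd hΓ1
  refine ⟨Φ, isBihol_of_norm_sub_le hΦ ?_, ?_⟩
  · filter_upwards [hιn, hιt.eventually hΓn] with z h1 h2
    have h3 : ‖Φ z - z‖ ≤ ‖Γ (ι z) 1 - ι z‖ := norm_snd_le (Γ (ι z) 1 - ι z)
    linarith
  · have hf1 : ∀ᶠ z in 𝓝 (0 : ℂ × ℂ), ‖f z‖ < 1 :=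
      hf.continuousAt.norm.tendsto.eventually (gt_mem_nhds (by simp [hf0]))
    have hU := hsnd.eventually (hXf.and (hf1.and hf.eventually_analyticAt))
    filter_upwards [hιt.eventually (hΓ _ hU)] with z hz
    have hconst : ∀ t ∈ Icc (0 : ℝ) 1, (Γ (ι z) t).1 = h z / Λ := by
      intro t ht
      have h1 := constant_of_has_deriv_right_zero (f := fun t => (Γ (ι z) t).1) (a := 0) (b := 1)
        (fun t ht => (hz t ht).2.continuousAt.fst.continuousWithinAt)
        (fun t ht => by
          have h2 := (hz t (Ico_subset_Icc_self ht)).2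
          exact ((ContinuousLinearMap.fst ℝ ℂ (ℂ × ℂ)).hasFDerivAt.comp_hasDerivAt t
            h2).hasDerivWithinAt) t ht
      rw [h1, hΓ0]
    have hsc : (Λ : ℂ) * (h z / Λ) + σ 0 = σ (f z) := by
      rw [mul_div_cancel₀ _ hΛ']
      simp [h]
    have hu : ∀ t ∈ Icc (0 : ℝ) 1, HasDerivAt (fun t => f (Γ (ι z) t).2)
        (σ (f z) * f (Γ (ι z) t).2 ^ 2) t := by
      intro t ht
      obtain ⟨⟨h1, -, h2⟩, h3⟩ := hz t ht
      have h4 : HasDerivAt (fun t => (Γ (ι z) t).2) (σ (f z) • X (Γ (ι z) t).2) t := by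
        have h5 := (ContinuousLinearMap.snd ℝ ℂ (ℂ × ℂ)).hasFDerivAt.comp_hasDerivAt t h3
        rw [← hsc, ← hconst t ht]
        exact h5
      have h6 := (h2.differentiableAt.hasFDerivAt.restrictScalars ℝ).comp_hasDerivAt t h4
      refine h6.congr_deriv ?_
      rw [ContinuousLinearMap.coe_restrictScalars', map_smul, h1, smul_eq_mul]
    have h1 := mul_one_sub_eq_of_hasDerivAt hu (M := 1) fun t ht => (hz t ht).1.2.1.le
    rwa [hΓ0] at h1

lemma exists_bihol_of_analytic {f : ℂ × ℂ → ℂ} (hf : AnalyticAt ℂ f 0) (hf0 : f 0 = 0)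
    {σ : ℂ → ℂ} (hσ : AnalyticAt ℂ σ 0) :
    ∃ Φ, IsBihol Φ ∧ ∀ᶠ z in 𝓝 (0 : ℂ × ℂ), f (Φ z) * (1 - σ (f z) * f z) = f z := by
  obtain ⟨ε, hε, hsmall⟩ := exists_bihol_of_small hf hf0
  have key : ∀ n : ℕ, ∀ σ : ℂ → ℂ, AnalyticAt ℂ σ 0 → ‖σ 0‖ < (n + 1) * ε →
      ∃ Φ, IsBihol Φ ∧ ∀ᶠ z in 𝓝 (0 : ℂ × ℂ), f (Φ z) * (1 - σ (f z) * f z) = f z := by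
    intro n
    induction n with
    | zero => exact fun σ hσ h => hsmall σ hσ (by simpa using h)
    | succ n ih =>
      intro σ hσ h
      have hn : ((n : ℂ) + 2) ≠ 0 := by exact_mod_cast (Nat.succ_ne_zero (n + 1))
      have hnn : ‖(n : ℂ) + 2‖ = n + 2 := by
        have := Complex.norm_natCast (n + 2)
        push_cast at this
        exact this
      have hpos : (0 : ℝ) < n + 2 := by positivity
      push_cast at h
      obtain ⟨Φ₁, hΦ₁, h₁⟩ := hsmall (fun _ => σ 0 / (n + 2)) analyticAt_const (by
        rw [norm_div, hnn, div_lt_iff₀ hpos]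
        linarith)
      obtain ⟨Φ₂, hΦ₂, h₂⟩ := ih (fun u => σ u - σ 0 / (n + 2)) (hσ.sub analyticAt_const) (by
        have : σ 0 - σ 0 / ((n : ℂ) + 2) = σ 0 * (((n : ℂ) + 1) / (n + 2)) := by
          field_simp
          ring
        have hn1 : ‖(n : ℂ) + 1‖ = n + 1 := by
          have := Complex.norm_natCast (n + 1)
          push_cast at this
          exact this
        rw [this, norm_mul, norm_div, hnn, hn1, mul_div_assoc', div_lt_iff₀ hpos]
        nlinarith)
      refine ⟨fun z => Φ₁ (Φ₂ z), hΦ₁.comp hΦ₂, ?_⟩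
      filter_upwards [h₂, hΦ₂.tendsto.eventually h₁] with z hz₂ hz₁
      linear_combination (1 - (σ (f z) - σ 0 / (n + 2)) * f z) * hz₁ +
        (1 + σ 0 / (n + 2) * f (Φ₁ (Φ₂ z))) * hz₂
  obtain ⟨n, hn⟩ := exists_nat_gt (‖σ 0‖ / ε)
  rw [div_lt_iff₀ hε] at hn
  exact key n σ hσ (by nlinarith)

lemma analyticAt_dslope {F : ℂ → ℂ} (hF : AnalyticAt ℂ F 0) : AnalyticAt ℂ (dslope F 0) 0 := by
  obtain ⟨p, hp⟩ := hF
  exact hp.has_fpower_series_dslope_fslope.analyticAt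

/-- The inverse of a germ tangent to the identity, in a form adapted to Riccati equations. -/
lemma exists_inverse_riccati {ψ : ℂ → ℂ} (hψ : AnalyticAt ℂ ψ 0) (hψ0 : ψ 0 = 0)
    (hψd : deriv ψ 0 = 1) :
    ∃ σ : ℂ → ℂ, AnalyticAt ℂ σ 0 ∧
      ∀ᶠ p in 𝓝 (0 : ℂ × ℂ), p.1 * (1 - σ p.2 * p.2) = p.2 → ψ p.1 = p.2 := by
  have hd0 : deriv ψ 0 ≠ 0 := by simp [hψd]
  let χ : ℂ → ℂ := hψ.hasStrictDerivAt.localInverse _ _ _ hd0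
  have hχ : AnalyticAt ℂ χ 0 := by
    have := hψ.analyticAt_localInverse hd0
    rwa [hψ0] at this
  have hχ0 : χ 0 = 0 := by
    have : χ (ψ 0) = 0 := HasStrictFDerivAt.localInverse_apply_image ..
    rwa [hψ0] at this
  have hψχ : ∀ᶠ u in 𝓝 (0 : ℂ), ψ (χ u) = u := by
    have := HasStrictDerivAt.eventually_right_inverse hψ.hasStrictDerivAt hd0
    rwa [hψ0] at this
  have hχd : deriv χ 0 = 1 := by
    have h : HasStrictDerivAt χ (deriv ψ 0)⁻¹ (ψ 0) := hψ.hasStrictDerivAt.to_localInverse hd0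
    rw [hψ0, hψd, inv_one] at h
    exact h.hasDerivAt.deriv
  let c : ℂ → ℂ := dslope χ 0
  have hc : AnalyticAt ℂ c 0 := analyticAt_dslope hχ
  have hc0 : c 0 = 1 := by rw [← hχd]; exact dslope_same χ 0
  have hcu : ∀ u, u * c u = χ u := fun u => by
    simpa [hχ0] using sub_smul_dslope χ 0 u
  let d : ℂ → ℂ := dslope c 0
  have hd : AnalyticAt ℂ d 0 := analyticAt_dslope hc
  have hdu : ∀ u, u * d u = c u - 1 := fun u => by
    simpa [hc0] using sub_smul_dslope c 0 u
  have hc1 : c 0 ≠ 0 := by simp [hc0]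
  refine ⟨fun u => d u / c u, hd.div hc hc1, ?_⟩
  have hsnd : Tendsto (Prod.snd : ℂ × ℂ → ℂ) (𝓝 0) (𝓝 0) := continuous_snd.tendsto 0
  filter_upwards [hsnd.eventually hψχ, hsnd.eventually (hc.continuousAt.eventually_ne hc1)]
    with p h1 h2 h3
  have h4 : p.1 = χ p.2 := by
    rw [← hcu p.2]
    have h5 : 1 - d p.2 / c p.2 * p.2 = (c p.2)⁻¹ := by
      field_simp
      linear_combination -hdu p.2
    rwa [h5, mul_inv_eq_iff_eq_mul₀ h2] at h3
  rw [h4, h1]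

theorem exists_bihol_eq {f g : ℂ × ℂ → ℂ} (hf : AnalyticAt ℂ f 0) (hf0 : f 0 = 0)
    {φ : ℂ × ℂ → ℂ × ℂ} (hφ : IsBihol φ) {ψ : ℂ → ℂ} (hψ : AnalyticAt ℂ ψ 0) (hψ0 : ψ 0 = 0)
    (hψd : deriv ψ 0 = 1) (heq : ∀ᶠ z in 𝓝 (0 : ℂ × ℂ), g (φ z) = ψ (f z)) :
    ∃ Φ, IsBihol Φ ∧ ∀ᶠ z in 𝓝 (0 : ℂ × ℂ), g (Φ z) = f z := by
  obtain ⟨σ, hσ, hσψ⟩ := exists_inverse_riccati hψ hψ0 hψd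
  obtain ⟨Φ, hΦ, h⟩ := exists_bihol_of_analytic hf hf0 hσ
  refine ⟨fun z => φ (Φ z), hφ.comp hΦ, ?_⟩
  have hft : Tendsto f (𝓝 0) (𝓝 0) := by
    have := hf.continuousAt.tendsto
    rwa [hf0] at this
  have ht : Tendsto (fun z => (f (Φ z), f z)) (𝓝 0) (𝓝 ((0 : ℂ), (0 : ℂ))) :=
    (hft.comp hΦ.tendsto).prodMk_nhds hft
  rw [Prod.mk_zero_zero] at ht
  filter_upwards [h, ht.eventually hσψ, hΦ.tendsto.eventually heq] with z h1 h2 h3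
  rw [h3, h2 h1]

end PlaneGerm

/-- **Theorem 5.2 ("Geburtszange").**
Two plane curve singularities that are right-equivalent to first order are
right-equivalent. -/
theorem stmt0
    (f g : ℂ × ℂ → ℂ) (hf : AnalyticAt ℂ f 0) (hg : AnalyticAt ℂ g 0)
    (hf0 : f 0 = 0) (hg0 : g 0 = 0)
    (φ : ℂ × ℂ → ℂ × ℂ) (hφ : AnalyticAt ℂ φ 0) (hφ0 : φ 0 = 0)
    (hφd : ∃ e : (ℂ × ℂ) ≃L[ℂ] (ℂ × ℂ), (e : (ℂ × ℂ) →L[ℂ] (ℂ × ℂ)) = fderiv ℂ φ 0)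
    (ψ : ℂ → ℂ) (hψ : AnalyticAt ℂ ψ 0) (hψ0 : ψ 0 = 0) (hψd : deriv ψ 0 = 1)
    (heq : ∀ᶠ z in nhds (0 : ℂ × ℂ), g (φ z) = ψ (f z)) :
    ∃ Φ : ℂ × ℂ → ℂ × ℂ, AnalyticAt ℂ Φ 0 ∧ Φ 0 = 0 ∧
      (∃ e : (ℂ × ℂ) ≃L[ℂ] (ℂ × ℂ), (e : (ℂ × ℂ) →L[ℂ] (ℂ × ℂ)) = fderiv ℂ Φ 0) ∧
      ∀ᶠ z in nhds (0 : ℂ × ℂ), g (Φ z) = f z := by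
  obtain ⟨Φ, ⟨hΦ, hΦ0, hΦd⟩, h⟩ :=
    PlaneGerm.exists_bihol_eq hf hf0 ⟨hφ, hφ0, hφd⟩ hψ hψ0 hψd heq
  exact ⟨Φ, hΦ, hΦ0, hΦd, h⟩
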